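/- There exists a positive absolute constant B with the following property: for every k ≥ 6 and ε > 0, for all real numbers α₁, α_k and all sufficiently large N (in terms of k and ε), there exists an integer n with 1 ≤ n ≤ N such that ‖α_k n^k + α₁ n‖ ≤ C(k,ε) · N^{−ρ_k + ε}, where ρ_k = 1/(k(2 log k + B log log k)) and C(k,ε) depends only on k and ε. -/

import Mathlib

/-- Distance from a real number to the nearest integer. -/
noncomputable def nearestIntDist (x : ℝ) : ℝ := |x - round x|

/-- The additive character `e(x) = exp(2πix)`. -/
noncomputable def ee (x : ℝ) : ℂ := Complex.exp (2 * Real.pi * x * Complex.I)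

theorem ee_zero : ee 0 = 1 := by simp [ee]

theorem ee_add (x y : ℝ) : ee (x + y) = ee x * ee y := by
  unfold ee
  rw [← Complex.exp_add]
  congr 1
  push_cast
  ring

theorem ee_ne_zero (x : ℝ) : ee x ≠ 0 := Complex.exp_ne_zero _

theorem norm_ee (x : ℝ) : ‖ee x‖ = 1 := by
  have h := Complex.norm_exp_ofReal_mul_I (2 * Real.pi * x)
  unfold ee
  push_cast at h
  exact h

theorem ee_int (n : ℤ) : ee n = 1 := by
  unfold ee
  have := Complex.exp_int_mul_two_pi_mul_I n
  rw [← this]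
  congr 1
  push_cast
  ring

theorem ee_nat (n : ℕ) : ee n = 1 := by
  have := ee_int n
  simpa using this

theorem ee_neg (x : ℝ) : ee (-x) = (starRingEnd ℂ) (ee x) := by
  unfold ee
  rw [← Complex.exp_conj]
  congr 1
  simp only [map_mul, Complex.conj_ofReal, Complex.conj_I, map_ofNat]
  push_cast
  ring

theorem ee_neg' (x : ℝ) : ee (-x) = (ee x)⁻¹ := by
  apply eq_inv_of_mul_eq_one_left
  rw [← ee_add]
  simp [ee_zero]

theorem ee_sub (x y : ℝ) : ee (x - y) = ee x * (starRingEnd ℂ) (ee y) := by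
  rw [sub_eq_add_neg, ee_add, ee_neg]

theorem ee_nat_mul (n : ℕ) (x : ℝ) : ee (n * x) = ee x ^ n := by
  unfold ee
  rw [← Complex.exp_nat_mul]
  congr 1
  push_cast
  ring

theorem ee_sum {ι : Type*} (s : Finset ι) (f : ι → ℝ) : ee (∑ i ∈ s, f i) = ∏ i ∈ s, ee (f i) := by
  classical
  induction s using Finset.induction_on with
  | empty => simp [ee_zero]
  | insert a s ha ih => rw [Finset.sum_insert ha, Finset.prod_insert ha, ee_add, ih]

theorem continuous_ee : Continuous ee := by
  unfold ee
  fun_prop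

theorem ee_eq_one_iff (x : ℝ) : ee x = 1 ↔ ∃ n : ℤ, x = n := by
  constructor
  · intro h
    unfold ee at h
    rw [Complex.exp_eq_one_iff] at h
    obtain ⟨n, hn⟩ := h
    refine ⟨n, ?_⟩
    have h2 : (2 * Real.pi * Complex.I : ℂ) ≠ 0 := Complex.two_pi_I_ne_zero
    have h3 : (2 * Real.pi * Complex.I : ℂ) * x = (2 * Real.pi * Complex.I : ℂ) * n := by
      linear_combination hn
    have h4 := mul_left_cancel₀ h2 h3
    exact_mod_cast h4
  · rintro ⟨n, rfl⟩
    exact ee_int n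

theorem norm_ee_sub_one (x : ℝ) : ‖ee x - 1‖ = 2 * |Real.sin (Real.pi * x)| := by
  have h := Complex.norm_exp_I_mul_ofReal_sub_one (2 * Real.pi * x)
  have h2 : ee x = Complex.exp (Complex.I * ((2 * Real.pi * x : ℝ) : ℂ)) := by
    unfold ee
    congr 1
    push_cast
    ring
  rw [h2, h, Real.norm_eq_abs, abs_mul]
  congr 1
  · norm_num
  · congr 2
    ring

theorem nearestIntDist_nonneg (x : ℝ) : 0 ≤ nearestIntDist x := abs_nonneg _

theorem nearestIntDist_le_abs_sub (x : ℝ) (n : ℤ) : nearestIntDist x ≤ |x - n| := round_le x n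

theorem nearestIntDist_add_le (x y : ℝ) : nearestIntDist (x + y) ≤ nearestIntDist x + |y| := by
  refine (nearestIntDist_le_abs_sub (x + y) (round x)).trans ?_
  have : x + y - round x = (x - round x) + y := by ring
  rw [this]
  exact abs_add_le _ _

theorem norm_ee_sub_one_ge (x : ℝ) : 4 * nearestIntDist x ≤ ‖ee x - 1‖ := by
  have h1 : ee x = ee (x - round x) := by
    have : x = (x - round x) + (round x : ℤ) := by ring
    conv_lhs => rw [this]
    rw [ee_add, ee_int, mul_one]
  rw [h1, norm_ee_sub_one]
  have h2 : |x - round x| ≤ 1 / 2 := abs_sub_round x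
  unfold nearestIntDist
  set y := x - round x
  have h3 : |Real.sin (Real.pi * y)| = Real.sin (Real.pi * |y|) := by
    rcases le_or_gt 0 y with hy | hy
    · rw [abs_of_nonneg hy, abs_of_nonneg]
      apply Real.sin_nonneg_of_nonneg_of_le_pi
      · positivity
      · rw [abs_of_nonneg hy] at h2
        nlinarith [Real.pi_pos]
    · rw [abs_of_neg hy]
      rw [abs_of_neg hy] at h2
      rw [mul_neg, Real.sin_neg, abs_of_nonpos]
      have : 0 ≤ Real.sin (Real.pi * (-y)) := by
        apply Real.sin_nonneg_of_nonneg_of_le_pi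
        · nlinarith [Real.pi_pos]
        · nlinarith [Real.pi_pos]
      rw [mul_neg, Real.sin_neg] at this
      linarith
  rw [h3]
  have h4 := Real.mul_le_sin (x := Real.pi * |y|) (by positivity) (by nlinarith [Real.pi_pos])
  have : 2 / Real.pi * (Real.pi * |y|) = 2 * |y| := by
    field_simp
  linarith

/-- The geometric sum bound. -/
theorem norm_geom_le (L : ℕ) (x δ : ℝ) (hδ : 0 < δ) (hx : δ ≤ nearestIntDist x) :
    ‖∑ l ∈ Finset.range L, ee x ^ l‖ ≤ 1 / (2 * δ) := by
  have h1 := norm_ee_sub_one_ge x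
  have hne : ee x ≠ 1 := by
    intro h
    rw [h] at h1
    simp at h1
    linarith
  rw [geom_sum_eq hne, norm_div]
  have h2 : ‖ee x ^ L - 1‖ ≤ 2 := by
    refine (norm_sub_le _ _).trans ?_
    rw [norm_pow, norm_ee]
    norm_num
  have h3 : 0 < ‖ee x - 1‖ := by linarith
  rw [div_le_div_iff₀ h3 (by positivity)]
  nlinarith [norm_nonneg (ee x ^ L - 1)]

/-- A trigonometric polynomial without constant term which is bounded away from zero
outside a small neighbourhood of the integers. -/
theorem kernel (m L : ℕ) (hm : 0 < m) (hL : 0 < L) (δ : ℝ) (hδ : 0 < δ)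
    (hmL : 4 * m * L ≤ (2 * δ * L) ^ (2 * m)) :
    ∃ w : ℤ → ℝ, (∀ h, |w h| ≤ 1) ∧ ∀ x : ℝ, δ ≤ nearestIntDist x →
      (∑ h ∈ (Finset.Icc (-((m * L : ℕ) : ℤ)) ((m * L : ℕ) : ℤ)).erase 0,
        (w h : ℂ) * ee (h * x)).re ≤ -(1 / 2) := by
  classical
  let A : Polynomial ℝ := (∑ l ∈ Finset.range L, Polynomial.X ^ l) ^ m
  let a : ℕ → ℝ := fun j => A.coeff j
  let T : Finset ℕ := Finset.range (m * L)
  have hdeg : A.natDegree < m * L := by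
    have h1 : (∑ l ∈ Finset.range L, (Polynomial.X : Polynomial ℝ) ^ l).natDegree ≤ L - 1 := by
      apply Polynomial.natDegree_sum_le_of_forall_le
      intro l hl
      rw [Finset.mem_range] at hl
      simp
      omega
    have h2 : A.natDegree ≤ m * (L - 1) := Polynomial.natDegree_pow_le_of_le m h1
    have h3 : m * (L - 1) < m * L := Nat.mul_lt_mul_of_pos_left (by omega) hm
    omega
  have hevalC : ∀ z : ℂ, (∑ l ∈ Finset.range L, z ^ l) ^ m = ∑ j ∈ T, (a j : ℂ) * z ^ j := by
    intro z
    have h1 : Polynomial.eval₂ (algebraMap ℝ ℂ) z A = ∑ j ∈ T, (a j : ℂ) * z ^ j := by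
      rw [Polynomial.eval₂_eq_sum_range' _ hdeg]
      rfl
    rw [← h1]
    simp [A, Polynomial.eval₂_pow, Polynomial.eval₂_finsetSum]
  have hevalR : (L : ℝ) ^ m = ∑ j ∈ T, a j := by
    have h1 := hevalC 1
    simp at h1
    exact_mod_cast h1
  let c : ℤ → ℝ := fun h => ∑ p ∈ (T ×ˢ T).filter (fun p => ((p.1 : ℤ) - p.2) = h), a p.1 * a p.2
  have hc0 : c 0 = ∑ j ∈ T, a j ^ 2 := by
    have : (T ×ˢ T).filter (fun p => ((p.1 : ℤ) - p.2) = 0) = T.image (fun j => (j, j)) := by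
      ext ⟨i, j⟩
      simp only [Finset.mem_filter, Finset.mem_product, Finset.mem_image, Prod.mk.injEq]
      constructor
      · rintro ⟨⟨h1, h2⟩, h3⟩
        exact ⟨i, h1, rfl, by omega⟩
      · rintro ⟨b, hb, rfl, rfl⟩
        exact ⟨⟨hb, hb⟩, by simp⟩
    simp only [c]
    rw [this, Finset.sum_image (by intro x _ y _ hxy; simpa using hxy)]
    exact Finset.sum_congr rfl (fun j _ => by ring)
  have hcle : ∀ h, |c h| ≤ c 0 := by
    intro h
    rw [hc0]
    have h1 : |c h| ≤ ∑ p ∈ (T ×ˢ T).filter (fun p => ((p.1 : ℤ) - p.2) = h), (a p.1 ^ 2 / 2 + a p.2 ^ 2 / 2) := by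
      refine (Finset.abs_sum_le_sum_abs _ _).trans (Finset.sum_le_sum fun p _ => ?_)
      rw [abs_le]
      constructor
      · nlinarith [sq_nonneg (a p.1 + a p.2)]
      · nlinarith [sq_nonneg (a p.1 - a p.2)]
    refine h1.trans ?_
    rw [Finset.sum_add_distrib]
    have h2 : ∑ p ∈ (T ×ˢ T).filter (fun p => ((p.1 : ℤ) - p.2) = h), a p.1 ^ 2 / 2 ≤ ∑ j ∈ T, a j ^ 2 / 2 := by
      rw [← Finset.sum_image (s := (T ×ˢ T).filter (fun p => ((p.1 : ℤ) - p.2) = h)) (g := Prod.fst) (f := fun j => a j ^ 2 / 2)]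
      · apply Finset.sum_le_sum_of_subset_of_nonneg
        · intro j hj
          simp only [Finset.mem_image, Finset.mem_filter, Finset.mem_product] at hj
          obtain ⟨p, hp, rfl⟩ := hj
          exact hp.1.1
        · intros
          positivity
      · rintro ⟨i, j⟩ h1 ⟨i', j'⟩ h2 h3
        simp only [Finset.coe_filter, Finset.mem_product, Set.mem_ofPred_eq] at h1 h2 h3
        ext
        · exact h3
        · simp only
          have h4 : i = i' := h3
          omega
    have h3 : ∑ p ∈ (T ×ˢ T).filter (fun p => ((p.1 : ℤ) - p.2) = h), a p.2 ^ 2 / 2 ≤ ∑ j ∈ T, a j ^ 2 / 2 := by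
      rw [← Finset.sum_image (s := (T ×ˢ T).filter (fun p => ((p.1 : ℤ) - p.2) = h)) (g := Prod.snd) (f := fun j => a j ^ 2 / 2)]
      · apply Finset.sum_le_sum_of_subset_of_nonneg
        · intro j hj
          simp only [Finset.mem_image, Finset.mem_filter, Finset.mem_product] at hj
          obtain ⟨p, hp, rfl⟩ := hj
          exact hp.1.2
        · intros
          positivity
      · rintro ⟨i, j⟩ h1 ⟨i', j'⟩ h2 h3
        simp only [Finset.coe_filter, Finset.mem_product, Set.mem_ofPred_eq] at h1 h2 h3
        have h4 : j = j' := h3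
        ext
        · simp only
          omega
        · exact h3
    have h4 : ∑ j ∈ T, a j ^ 2 / 2 + ∑ j ∈ T, a j ^ 2 / 2 = ∑ j ∈ T, a j ^ 2 := by
      rw [← Finset.sum_add_distrib]
      exact Finset.sum_congr rfl (fun j _ => by ring)
    linarith
  have hmLpos : (0 : ℝ) < m * L := by positivity
  have hc0ge : (L : ℝ) ^ (2 * m) ≤ (m * L) * c 0 := by
    have h1 := sq_sum_le_card_mul_sum_sq (s := T) (f := a)
    rw [← hevalR, ← hc0] at h1
    simp only [T, Finset.card_range] at h1
    push_cast at h1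
    calc (L : ℝ) ^ (2 * m) = ((L : ℝ) ^ m) ^ 2 := by rw [← pow_mul, mul_comm]
      _ ≤ _ := h1
  have hc0pos : 0 < c 0 := by
    have : (0 : ℝ) < (L : ℝ) ^ (2 * m) := by positivity
    by_contra hcon
    push Not at hcon
    nlinarith
  have hexp : ∀ x : ℝ, ((‖∑ l ∈ Finset.range L, ee x ^ l‖ ^ (2 * m) : ℝ) : ℂ) =
      ∑ h ∈ Finset.Icc (-((m * L : ℕ) : ℤ)) ((m * L : ℕ) : ℤ), (c h : ℂ) * ee (h * x) := by
    intro x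
    have h1 : ((‖∑ l ∈ Finset.range L, ee x ^ l‖ ^ (2 * m) : ℝ) : ℂ) =
        (∑ j ∈ T, (a j : ℂ) * ee x ^ j) * (starRingEnd ℂ) (∑ j ∈ T, (a j : ℂ) * ee x ^ j) := by
      rw [← hevalC, Complex.mul_conj, Complex.normSq_eq_norm_sq, norm_pow, ← pow_mul, mul_comm m 2]
    rw [h1, map_sum, Finset.sum_mul_sum, ← Finset.sum_product']
    have h2 : ∀ p ∈ T ×ˢ T, ((p.1 : ℤ) - p.2) ∈ Finset.Icc (-((m * L : ℕ) : ℤ)) ((m * L : ℕ) : ℤ) := by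
      rintro ⟨i, j⟩ hp
      simp only [T, Finset.mem_product, Finset.mem_range] at hp
      rw [Finset.mem_Icc]
      constructor <;> omega
    rw [← Finset.sum_fiberwise_of_maps_to h2]
    refine Finset.sum_congr rfl fun h _ => ?_
    simp only [c]
    push_cast
    rw [Finset.sum_mul]
    refine Finset.sum_congr rfl fun p hp => ?_
    rw [Finset.mem_filter] at hp
    have h3 : (h : ℝ) * x = p.1 * x - p.2 * x := by
      rw [← hp.2]
      push_cast
      ring
    rw [h3, ee_sub, ee_nat_mul, ee_nat_mul]
    simp
    ring
  refine ⟨fun h => c h / c 0, fun h => ?_, fun x hx => ?_⟩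
  · rw [abs_div, abs_of_pos hc0pos]
    exact div_le_one_of_le₀ (hcle h) hc0pos.le
  · have h0 : (0 : ℤ) ∈ Finset.Icc (-((m * L : ℕ) : ℤ)) ((m * L : ℕ) : ℤ) := by
      rw [Finset.mem_Icc]
      constructor
      · have : (0 : ℤ) ≤ ((m * L : ℕ) : ℤ) := by positivity
        omega
      · positivity
    have h1 := hexp x
    rw [← Finset.add_sum_erase _ _ h0] at h1
    simp only [Int.cast_zero, zero_mul, ee_zero, mul_one] at h1
    have h2 : ∑ h ∈ (Finset.Icc (-((m * L : ℕ) : ℤ)) ((m * L : ℕ) : ℤ)).erase 0, ((c h / c 0 : ℝ) : ℂ) * ee (h * x)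
        = ((‖∑ l ∈ Finset.range L, ee x ^ l‖ ^ (2 * m) / c 0 - 1 : ℝ) : ℂ) := by
      push_cast at h1 ⊢
      rw [h1]
      have : (c 0 : ℂ) ≠ 0 := by exact_mod_cast hc0pos.ne'
      rw [add_div, div_self this, add_sub_cancel_left, Finset.sum_div]
      exact Finset.sum_congr rfl fun h _ => by ring
    rw [h2, Complex.ofReal_re]
    have h3 : ‖∑ l ∈ Finset.range L, ee x ^ l‖ ^ (2 * m) ≤ (1 / (2 * δ)) ^ (2 * m) :=
      pow_le_pow_left₀ (norm_nonneg _) (norm_geom_le L x δ hδ hx) _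
    have h4 : (1 / (2 * δ)) ^ (2 * m) ≤ c 0 / 2 := by
      have h5 : (1 / (2 * δ)) ^ (2 * m) * (2 * δ * L) ^ (2 * m) = (L : ℝ) ^ (2 * m) := by
        rw [← mul_pow]
        congr 1
        field_simp
      have h6 : (0 : ℝ) < (1 / (2 * δ)) ^ (2 * m) := by positivity
      have h7 : (1 / (2 * δ)) ^ (2 * m) * (4 * m * L) ≤ (m * L) * c 0 := by
        refine le_trans ?_ hc0ge
        rw [← h5]
        exact mul_le_mul_of_nonneg_left hmL h6.le
      have h8 : (m * L : ℝ) * ((1 / (2 * δ)) ^ (2 * m) * 4) ≤ (m * L) * c 0 := by linarith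
      have h9 := le_of_mul_le_mul_left h8 hmLpos
      linarith
    have h5 : ‖∑ l ∈ Finset.range L, ee x ^ l‖ ^ (2 * m) / c 0 ≤ 1 / 2 := by
      rw [div_le_iff₀ hc0pos]
      linarith
    linarith

theorem pow_gap (k m M : ℕ) (hk : 1 ≤ k) (h : m ≤ M) :
    m ^ k + (M - m) * m ^ (k - 1) ≤ M ^ k := by
  obtain ⟨d, rfl⟩ := Nat.exists_eq_add_of_le h
  obtain ⟨j, rfl⟩ := Nat.exists_eq_add_of_le hk
  simp only [Nat.add_sub_cancel_left]
  calc m ^ (1 + j) + d * m ^ j = (m + d) * m ^ j := by ring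
    _ ≤ (m + d) * (m + d) ^ j := Nat.mul_le_mul_left _ (Nat.pow_le_pow_left h j)
    _ = (m + d) ^ (1 + j) := by ring

/-- Spacing lemma. -/
theorem spacing (k Y : ℕ) (hk : 1 ≤ k) (hY : 1 ≤ Y) (h : ℤ) (hh : h ≠ 0) (v T : ℝ) (hT : 0 ≤ T)
    (S : Finset ℕ) (hS : ∀ y ∈ S, Y < y) (hSv : ∀ y ∈ S, |(h : ℝ) * (y : ℝ) ^ k - v| ≤ T) :
    (S.card : ℝ) ≤ 2 * T / (|(h : ℝ)| * (Y : ℝ) ^ (k - 1)) + 1 := by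
  have hhpos : (0 : ℝ) < |(h : ℝ)| := by
    rw [abs_pos]
    exact_mod_cast hh
  have hYpos : (0 : ℝ) < (Y : ℝ) ^ (k - 1) := by
    have : (0 : ℝ) < Y := by exact_mod_cast hY
    positivity
  rcases S.eq_empty_or_nonempty with rfl | hne
  · simp
    positivity
  set m := S.min' hne
  set M := S.max' hne
  have hm : m ∈ S := S.min'_mem hne
  have hM : M ∈ S := S.max'_mem hne
  have hmM : m ≤ M := S.min'_le _ hM
  have hcard : S.card ≤ M - m + 1 := by
    have : S ⊆ Finset.Icc m M := by
      intro y hy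
      rw [Finset.mem_Icc]
      exact ⟨S.min'_le _ hy, S.le_max' _ hy⟩
    have h1 := Finset.card_le_card this
    rw [Nat.card_Icc] at h1
    omega
  have hcard' : (S.card : ℝ) ≤ (M : ℝ) - m + 1 := by
    have : (S.card : ℝ) ≤ ((M - m + 1 : ℕ) : ℝ) := by exact_mod_cast hcard
    push_cast [Nat.cast_sub hmM] at this
    exact this
  have hgap : ((M : ℝ) - m) * (Y : ℝ) ^ (k - 1) ≤ (M : ℝ) ^ k - (m : ℝ) ^ k := by
    have h1 : ((m ^ k + (M - m) * m ^ (k - 1) : ℕ) : ℝ) ≤ ((M ^ k : ℕ) : ℝ) := by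
      exact_mod_cast pow_gap k m M hk hmM
    push_cast [Nat.cast_sub hmM] at h1
    have h2 : (Y : ℝ) ^ (k - 1) ≤ (m : ℝ) ^ (k - 1) := by
      apply pow_le_pow_left₀ (by positivity)
      exact_mod_cast (hS m hm).le
    have h3 : (0 : ℝ) ≤ (M : ℝ) - m := by
      rw [sub_nonneg]
      exact_mod_cast hmM
    nlinarith
  have h1 := hSv m hm
  have h2 := hSv M hM
  have h3 : |(h : ℝ)| * ((M : ℝ) ^ k - (m : ℝ) ^ k) ≤ 2 * T := by
    have h4 : 0 ≤ (M : ℝ) ^ k - (m : ℝ) ^ k := by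
      rw [sub_nonneg]
      apply pow_le_pow_left₀ (by positivity)
      exact_mod_cast hmM
    rw [← abs_of_nonneg h4, ← abs_mul]
    have h5 : (h : ℝ) * ((M : ℝ) ^ k - (m : ℝ) ^ k) =
      ((h : ℝ) * (M : ℝ) ^ k - v) - ((h : ℝ) * (m : ℝ) ^ k - v) := by ring
    rw [h5]
    refine (abs_sub _ _).trans ?_
    linarith
  have h6 : (M : ℝ) - m ≤ 2 * T / (|(h : ℝ)| * (Y : ℝ) ^ (k - 1)) := by
    rw [le_div_iff₀ (by positivity)]
    calc ((M : ℝ) - m) * (|(h : ℝ)| * (Y : ℝ) ^ (k - 1))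
        = |(h : ℝ)| * (((M : ℝ) - m) * (Y : ℝ) ^ (k - 1)) := by ring
      _ ≤ |(h : ℝ)| * ((M : ℝ) ^ k - (m : ℝ) ^ k) := mul_le_mul_of_nonneg_left hgap hhpos.le
      _ ≤ _ := h3
  linarith

/-- The box of tuples. -/
def ybox (Y : ℕ → ℕ) (s : ℕ) : Finset (Fin s → ℕ) :=
  Fintype.piFinset (fun j : Fin s => Finset.Ioc (Y j) (2 * Y j))

theorem card_ybox (Y : ℕ → ℕ) (s : ℕ) : (ybox Y s).card = ∏ j : Fin s, Y j := by
  unfold ybox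
  rw [Fintype.card_piFinset]
  refine Finset.prod_congr rfl fun j _ => ?_
  rw [Nat.card_Ioc]
  omega

theorem Y_le_first (k : ℕ) (hk : 1 ≤ k) (Y : ℕ → ℕ) (hY1 : ∀ j, 1 ≤ Y j)
    (hYr : ∀ j, Y (j + 1) ^ k ≤ Y j ^ (k - 1)) : ∀ i j, Y (i + j) ≤ Y i := by
  intro i j
  induction j with
  | zero => simp
  | succ j ih =>
    refine le_trans ?_ ih
    have h1 := hYr (i + j)
    have h2 : Y (i + j) ^ (k - 1) ≤ Y (i + j) ^ k := Nat.pow_le_pow_right (hY1 _) (by omega)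
    have h3 := h1.trans h2
    exact (Nat.pow_le_pow_iff_left (by omega)).1 h3

/-- Multiplicity bound for the diminishing ranges. -/
theorem ybox_multiplicity (k S H : ℕ) (hk : 1 ≤ k) (hS : 1 ≤ S) (hH : 1 ≤ H) :
    ∀ (s : ℕ) (_ : s ≤ S) (Y : ℕ → ℕ) (_ : ∀ j, 1 ≤ Y j)
      (_ : ∀ j, Y (j + 1) ^ k ≤ Y j ^ (k - 1)) (h : Fin s → ℤ)
      (_ : ∀ j, h j ≠ 0 ∧ |h j| ≤ H) (v : ℤ),
    (((ybox Y s).filter (fun y => ∑ j, h j * (y j : ℤ) ^ k = v)).card : ℝ) ≤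
      ∏ j, ((2 : ℝ) ^ (k + 2) * S * H / |(h j : ℝ)|) := by
  intro s
  induction s with
  | zero =>
    intro _ Y _ _ h _ v
    simp only [Finset.univ_eq_empty, Finset.prod_empty]
    have : (((ybox Y 0).filter (fun y => ∑ j, h j * (y j : ℤ) ^ k = v)).card) ≤ 1 := by
      refine (Finset.card_le_univ _).trans ?_
      simp
    exact_mod_cast this
  | succ s ih =>
    intro hs Y hY1 hYr h hh v
    classical
    -- the good set of first coordinates
    set A := (ybox Y (s + 1)).filter (fun y => ∑ j, h j * (y j : ℤ) ^ k = v) with hA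
    set S0 : Finset ℕ := A.image (fun y => y 0) with hS0
    let B : ℕ → Finset (Fin s → ℕ) := fun y0 =>
      (ybox (fun j => Y (j + 1)) s).filter
        (fun y => ∑ j, h (Fin.succ j) * (y j : ℤ) ^ k = v - h 0 * (y0 : ℤ) ^ k)
    have hmemA : ∀ y, y ∈ A → (∀ j : Fin (s + 1), Y j < y j ∧ y j ≤ 2 * Y j) ∧
        ∑ j, h j * (y j : ℤ) ^ k = v := by
      intro y hy
      rw [hA, Finset.mem_filter, ybox, Fintype.mem_piFinset] at hy
      refine ⟨fun j => ?_, hy.2⟩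
      have := hy.1 j
      rwa [Finset.mem_Ioc] at this
    have hsub : A ⊆ S0.biUnion (fun y0 => (B y0).image (fun y => (Fin.cons y0 y : Fin (s + 1) → ℕ))) := by
      intro y hy
      obtain ⟨h1, h2⟩ := hmemA y hy
      rw [Finset.mem_biUnion]
      refine ⟨y 0, Finset.mem_image_of_mem _ hy, ?_⟩
      rw [Finset.mem_image]
      refine ⟨Fin.tail y, ?_, Fin.cons_self_tail y⟩
      rw [Finset.mem_filter, ybox, Fintype.mem_piFinset]
      refine ⟨fun j => ?_, ?_⟩
      · rw [Finset.mem_Ioc]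
        have := h1 j.succ
        simpa [Fin.tail] using this
      · rw [Fin.sum_univ_succ] at h2
        simp only [Fin.tail]
        linarith
    have hcardB : ∀ y0 ∈ S0, (((B y0).image (fun y => (Fin.cons y0 y : Fin (s + 1) → ℕ))).card : ℝ) ≤
        ∏ j : Fin s, ((2 : ℝ) ^ (k + 2) * S * H / |(h j.succ : ℝ)|) := by
      intro y0 _
      have h1 := ih (by omega) (fun j => Y (j + 1)) (fun j => hY1 _) (fun j => hYr _)
        (fun j => h j.succ) (fun j => hh _) (v - h 0 * (y0 : ℤ) ^ k)
      refine le_trans ?_ h1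
      exact_mod_cast Finset.card_image_le
    have hcardA : (A.card : ℝ) ≤ S0.card * ∏ j : Fin s, ((2 : ℝ) ^ (k + 2) * S * H / |(h j.succ : ℝ)|) := by
      have h1 : A.card ≤ ∑ y0 ∈ S0, ((B y0).image (fun y => (Fin.cons y0 y : Fin (s + 1) → ℕ))).card :=
        (Finset.card_le_card hsub).trans Finset.card_biUnion_le
      have h2 : (A.card : ℝ) ≤ ∑ y0 ∈ S0, (((B y0).image (fun y => (Fin.cons y0 y : Fin (s + 1) → ℕ))).card : ℝ) := by
        exact_mod_cast h1
      refine h2.trans ((Finset.sum_le_sum hcardB).trans ?_)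
      rw [Finset.sum_const, nsmul_eq_mul]
    have hY0pos : (0 : ℝ) < (Y 0 : ℝ) := by exact_mod_cast hY1 0
    have hHpos : (1 : ℝ) ≤ H := by exact_mod_cast hH
    have hSpos : (1 : ℝ) ≤ S := by exact_mod_cast hS
    set T : ℝ := S * H * 2 ^ k * (Y 0 : ℝ) ^ (k - 1) with hT
    have hTS : ∀ y ∈ S0, |(h 0 : ℝ) * (y : ℝ) ^ k - v| ≤ T := by
      intro y0 hy0
      rw [hS0, Finset.mem_image] at hy0
      obtain ⟨y, hy, rfl⟩ := hy0
      obtain ⟨h1, h2⟩ := hmemA y hy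
      rw [Fin.sum_univ_succ] at h2
      have h3 : (h 0 : ℝ) * (y 0 : ℝ) ^ k - v = - ∑ j : Fin s, (h j.succ : ℝ) * (y j.succ : ℝ) ^ k := by
        have h4 : ((h 0 * (y 0 : ℤ) ^ k + ∑ j : Fin s, h j.succ * (y j.succ : ℤ) ^ k : ℤ) : ℝ) = (v : ℝ) := by
          rw [h2]
        push_cast at h4
        linarith
      rw [h3, abs_neg]
      refine (Finset.abs_sum_le_sum_abs _ _).trans ?_
      have h5 : ∀ j ∈ (Finset.univ : Finset (Fin s)), |(h j.succ : ℝ) * (y j.succ : ℝ) ^ k| ≤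
          H * 2 ^ k * (Y 0 : ℝ) ^ (k - 1) := by
        intro j _
        rw [abs_mul, abs_of_nonneg (by positivity : (0 : ℝ) ≤ (y j.succ : ℝ) ^ k)]
        have h6 : |(h j.succ : ℝ)| ≤ H := by
          have := (hh j.succ).2
          exact_mod_cast this
        have h7 : (y j.succ : ℝ) ^ k ≤ 2 ^ k * (Y 0 : ℝ) ^ (k - 1) := by
          have h8 : y j.succ ≤ 2 * Y (0 + 1) := by
            have h9 := (h1 j.succ).2
            have h10 := Y_le_first k hk Y hY1 hYr 1 j
            simp only [Fin.val_succ] at h9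
            rw [add_comm 1 (j : ℕ)] at h10
            simp only [zero_add]
            omega
          have h11 : (y j.succ) ^ k ≤ 2 ^ k * Y 0 ^ (k - 1) := by
            calc (y j.succ) ^ k ≤ (2 * Y (0 + 1)) ^ k := Nat.pow_le_pow_left h8 k
              _ = 2 ^ k * Y (0 + 1) ^ k := by rw [mul_pow]
              _ ≤ _ := Nat.mul_le_mul_left _ (hYr 0)
          exact_mod_cast h11
        calc |(h j.succ : ℝ)| * (y j.succ : ℝ) ^ k ≤ H * (2 ^ k * (Y 0 : ℝ) ^ (k - 1)) := by gcongr
          _ = _ := by ring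
      refine (Finset.sum_le_sum h5).trans ?_
      rw [Finset.sum_const, nsmul_eq_mul, Finset.card_univ, Fintype.card_fin, hT]
      have h12 : (s : ℝ) ≤ S := by exact_mod_cast (by omega : s ≤ S)
      calc (s : ℝ) * (H * 2 ^ k * (Y 0 : ℝ) ^ (k - 1)) ≤ S * (H * 2 ^ k * (Y 0 : ℝ) ^ (k - 1)) := by
            gcongr
        _ = _ := by ring
    have hcardS := spacing k (Y 0) hk (hY1 0) (h 0) (hh 0).1 v T (by positivity) S0 (by
      intro y0 hy0
      rw [hS0, Finset.mem_image] at hy0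
      obtain ⟨y, hy, rfl⟩ := hy0
      exact ((hmemA y hy).1 0).1) hTS
    have hh0 : (0 : ℝ) < |(h 0 : ℝ)| := by
      rw [abs_pos]
      exact_mod_cast (hh 0).1
    have hh0H : |(h 0 : ℝ)| ≤ H := by
      have := (hh 0).2
      exact_mod_cast this
    have hS0 : (S0.card : ℝ) ≤ (2 : ℝ) ^ (k + 2) * S * H / |(h 0 : ℝ)| := by
      refine hcardS.trans ?_
      have h1 : 2 * T / (|(h 0 : ℝ)| * (Y 0 : ℝ) ^ (k - 1)) = 2 * S * H * 2 ^ k / |(h 0 : ℝ)| := by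
        rw [hT]
        field_simp
      rw [h1, div_add_one hh0.ne', div_le_div_iff_of_pos_right hh0]
      have h2 : (1 : ℝ) ≤ 2 ^ k := one_le_pow₀ (by norm_num)
      have h3 : (1 : ℝ) ≤ S * 2 ^ k := by nlinarith
      have h4 : (H : ℝ) ≤ S * 2 ^ k * H := by nlinarith
      rw [pow_add]
      nlinarith
    rw [Fin.prod_univ_succ]
    refine hcardA.trans ?_
    apply mul_le_mul_of_nonneg_right hS0
    apply Finset.prod_nonneg
    intros
    positivity

/-- The phase. -/
noncomputable def theta (a : ℤ) (q k : ℕ) (α : ℝ) (x y : ℕ) : ℝ :=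
  (a : ℝ) / q * ((x : ℝ) * y) ^ k + α * (x * y)

/-- nonzero frequencies -/
noncomputable def hset (H : ℕ) : Finset ℤ := (Finset.Icc (-(H : ℤ)) (H : ℤ)).erase 0

theorem mem_hset (H : ℕ) (h : ℤ) : h ∈ hset H ↔ h ≠ 0 ∧ |h| ≤ H := by
  unfold hset
  rw [Finset.mem_erase, Finset.mem_Icc, abs_le]

theorem card_hset (H : ℕ) : (hset H).card = 2 * H := by
  unfold hset
  rw [Finset.card_erase_of_mem, Int.card_Icc]
  · omega
  · rw [Finset.mem_Icc]
    omega

theorem sum_hset_inv (H : ℕ) : ∑ h ∈ hset H, 1 / |(h : ℝ)| ≤ 2 * (1 + Real.log H) := by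
  have h1 : hset H ⊆ (Finset.Icc 1 H).image (fun n : ℕ => (n : ℤ)) ∪
      (Finset.Icc 1 H).image (fun n : ℕ => -(n : ℤ)) := by
    intro h hh
    rw [mem_hset] at hh
    obtain ⟨h0, h1⟩ := hh
    rw [Finset.mem_union, Finset.mem_image, Finset.mem_image]
    rw [abs_le] at h1
    rcases lt_or_gt_of_ne h0 with h2 | h2
    · right
      refine ⟨(-h).toNat, ?_, ?_⟩
      · rw [Finset.mem_Icc]
        omega
      · omega
    · left
      refine ⟨h.toNat, ?_, ?_⟩
      · rw [Finset.mem_Icc]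
        omega
      · omega
  have hharm : ∑ n ∈ Finset.Icc 1 H, 1 / (n : ℝ) ≤ 1 + Real.log H := by
    have h2 := harmonic_le_one_add_log H
    rw [harmonic_eq_sum_Icc] at h2
    push_cast at h2
    simpa [one_div] using h2
  calc ∑ h ∈ hset H, 1 / |(h : ℝ)| ≤ ∑ h ∈ (Finset.Icc 1 H).image (fun n : ℕ => (n : ℤ)) ∪
      (Finset.Icc 1 H).image (fun n : ℕ => -(n : ℤ)), 1 / |(h : ℝ)| := by
        apply Finset.sum_le_sum_of_subset_of_nonneg h1
        intros
        positivity
    _ ≤ ∑ h ∈ (Finset.Icc 1 H).image (fun n : ℕ => (n : ℤ)), 1 / |(h : ℝ)| +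
        ∑ h ∈ (Finset.Icc 1 H).image (fun n : ℕ => -(n : ℤ)), 1 / |(h : ℝ)| := by
        rw [← Finset.sum_union_inter]
        apply le_add_of_nonneg_right
        apply Finset.sum_nonneg
        intros
        positivity
    _ = ∑ n ∈ Finset.Icc 1 H, 1 / (n : ℝ) + ∑ n ∈ Finset.Icc 1 H, 1 / (n : ℝ) := by
        rw [Finset.sum_image (by intro x _ y _ hxy; simpa using hxy),
          Finset.sum_image (by intro x _ y _ hxy; simpa using hxy)]
        simp
    _ ≤ _ := by linarith

/-- per x and j -/
theorem single_lower (Hs : Finset ℤ) (w : ℤ → ℝ) (hw : ∀ h, |w h| ≤ 1) (S : Finset ℕ) (f : ℕ → ℝ)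
    (hf : ∀ y ∈ S, (∑ h ∈ Hs, (w h : ℂ) * ee (h * f y)).re ≤ -(1 / 2)) :
    (S.card : ℝ) / 2 ≤ ∑ h ∈ Hs, ‖∑ y ∈ S, ee (h * f y)‖ := by
  have h1 : (∑ y ∈ S, ∑ h ∈ Hs, (w h : ℂ) * ee (h * f y)).re ≤ -((S.card : ℝ) / 2) := by
    rw [Complex.re_sum]
    refine (Finset.sum_le_sum hf).trans ?_
    rw [Finset.sum_const, nsmul_eq_mul]
    linarith
  have h2 : ‖∑ y ∈ S, ∑ h ∈ Hs, (w h : ℂ) * ee (h * f y)‖ ≤ ∑ h ∈ Hs, ‖∑ y ∈ S, ee (h * f y)‖ := by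
    rw [Finset.sum_comm]
    refine (norm_sum_le _ _).trans (Finset.sum_le_sum fun h _ => ?_)
    rw [← Finset.mul_sum, norm_mul, Complex.norm_real, Real.norm_eq_abs]
    exact mul_le_of_le_one_left (norm_nonneg _) (hw h)
  have h3 := (abs_le.1 (Complex.abs_re_le_norm (∑ y ∈ S, ∑ h ∈ Hs, (w h : ℂ) * ee (h * f y)))).1
  linarith

/-- The sum over the box. -/
noncomputable def Gsum (a : ℤ) (q k : ℕ) (α : ℝ) (Y : ℕ → ℕ) (s : ℕ) (h : Fin s → ℤ) (x : ℕ) : ℂ :=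
  ∑ y ∈ ybox Y s, ee (α * (x * (∑ j, h j * (y j : ℤ) : ℤ))) *
    ee ((a : ℝ) * (x : ℝ) ^ k * ((∑ j, h j * (y j : ℤ) ^ k : ℤ) : ℝ) / q)

theorem Gsum_eq (a : ℤ) (q k : ℕ) (α : ℝ) (Y : ℕ → ℕ) (s : ℕ) (h : Fin s → ℤ) (x : ℕ) :
    Gsum a q k α Y s h x =
      ∏ j : Fin s, ∑ y ∈ Finset.Ioc (Y j) (2 * Y j), ee (h j * theta a q k α x y) := by
  unfold Gsum ybox
  rw [Finset.prod_univ_sum]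
  refine Finset.sum_congr rfl fun y _ => ?_
  rw [← ee_sum, ← ee_add]
  congr 1
  unfold theta
  push_cast
  rw [Finset.mul_sum, Finset.mul_sum, Finset.mul_sum, Finset.sum_div, ← Finset.sum_add_distrib]
  refine Finset.sum_congr rfl fun j _ => ?_
  ring

theorem Gsum_lower (a : ℤ) (q k : ℕ) (α : ℝ) (Y : ℕ → ℕ) (s H : ℕ) (w : ℤ → ℝ) (hw : ∀ h, |w h| ≤ 1)
    (x : ℕ) (hlow : ∀ j : Fin s, ∀ y ∈ Finset.Ioc (Y j) (2 * Y j),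
      (∑ h ∈ hset H, (w h : ℂ) * ee (h * theta a q k α x y)).re ≤ -(1 / 2)) :
    ((ybox Y s).card : ℝ) / 2 ^ s ≤
      ∑ h ∈ Fintype.piFinset (fun _ : Fin s => hset H), ‖Gsum a q k α Y s h x‖ := by
  have h1 : ∏ j : Fin s, ((Y j : ℝ) / 2) ≤
      ∏ j : Fin s, ∑ h ∈ hset H, ‖∑ y ∈ Finset.Ioc (Y j) (2 * Y j), ee (h * theta a q k α x y)‖ := by
    apply Finset.prod_le_prod
    · intros
      positivity
    · intro j _
      have h2 := single_lower (hset H) w hw (Finset.Ioc (Y j) (2 * Y j)) (theta a q k α x) (hlow j)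
      rw [Nat.card_Ioc] at h2
      have h3 : 2 * Y j - Y j = Y j := by omega
      rwa [h3] at h2
  rw [card_ybox]
  rw [Finset.prod_univ_sum] at h1
  rw [Finset.prod_div_distrib, Finset.prod_const, Finset.card_univ, Fintype.card_fin] at h1
  push_cast
  refine h1.trans (le_of_eq ?_)
  refine Finset.sum_congr rfl fun h _ => ?_
  rw [Gsum_eq, norm_prod]

/-- inner sums -/
noncomputable def gin (a : ℤ) (q k : ℕ) (𝒳 : Finset ℕ) (c : ℕ → ℂ) (v : ℤ) : ℂ :=
  ∑ x ∈ 𝒳, c x * ee ((a : ℝ) * (x : ℝ) ^ k * (v : ℝ) / q)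

theorem gin_periodic (a : ℤ) (q k : ℕ) (hq : 1 ≤ q) (𝒳 : Finset ℕ) (c : ℕ → ℂ) (v : ℤ) :
    gin a q k 𝒳 c v = gin a q k 𝒳 c (((v % q).toNat : ℕ) : ℤ) := by
  unfold gin
  refine Finset.sum_congr rfl fun x _ => ?_
  congr 1
  have hq0 : (q : ℤ) ≠ 0 := by omega
  have hqr : (q : ℝ) ≠ 0 := by
    have : q ≠ 0 := by omega
    exact_mod_cast this
  have h1 : (((v % q).toNat : ℕ) : ℤ) = v % q := Int.toNat_of_nonneg (Int.emod_nonneg _ hq0)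
  rw [h1]
  have h2 : (v : ℝ) = ((v % q : ℤ) : ℝ) + (q : ℝ) * ((v / q : ℤ) : ℝ) := by
    have := Int.emod_add_mul_ediv v q
    have h3 : ((v % q + q * (v / q) : ℤ) : ℝ) = (v : ℝ) := by rw [this]
    push_cast at h3
    push_cast
    linarith
  have h4 : (a : ℝ) * (x : ℝ) ^ k * (v : ℝ) / q =
      (a : ℝ) * (x : ℝ) ^ k * ((v % q : ℤ) : ℝ) / q + ((a * (x : ℤ) ^ k * (v / q) : ℤ) : ℝ) := by
    rw [h2]
    field_simp
    push_cast
    ring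
  rw [h4, ee_add, ee_int, mul_one]

theorem sum_interval_le (q : ℕ) (hq : 1 ≤ q) (V : ℤ) (R : ℕ) (hV : V ≤ R * q) (F : ℕ → ℝ) (hF : ∀ r, 0 ≤ F r) :
    ∑ v ∈ Finset.Icc (-V) V, F ((v % q).toNat) ≤ (2 * R + 1) * ∑ r ∈ Finset.range q, F r := by
  have hq0 : (0 : ℤ) < q := by omega
  have h1 : ∑ v ∈ Finset.Icc (-V) V, F ((v % q).toNat) ≤
      ∑ p ∈ Finset.Icc (-(R : ℤ)) R ×ˢ Finset.range q, F p.2 := by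
    have hinj : Set.InjOn (fun v : ℤ => (v / q, (v % q).toNat)) (Finset.Icc (-V) V : Finset ℤ) := by
      intro v _ v' _ h
      simp only [Prod.mk.injEq] at h
      have e1 := Int.emod_add_mul_ediv v q
      have e2 := Int.emod_add_mul_ediv v' q
      have e3 := Int.emod_nonneg v hq0.ne'
      have e4 := Int.emod_nonneg v' hq0.ne'
      have e5 : v % q = v' % q := by omega
      rw [← e1, ← e2, e5, h.1]
    rw [← Finset.sum_image (g := fun v : ℤ => (v / q, (v % q).toNat)) (f := fun p => F p.2) hinj]
    apply Finset.sum_le_sum_of_subset_of_nonneg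
    · intro p hp
      rw [Finset.mem_image] at hp
      obtain ⟨v, hv, rfl⟩ := hp
      rw [Finset.mem_Icc] at hv
      rw [Finset.mem_product, Finset.mem_Icc, Finset.mem_range]
      simp only
      refine ⟨⟨?_, ?_⟩, ?_⟩
      · rw [Int.le_ediv_iff_mul_le hq0]
        linarith
      · have : v / q ≤ (R * q : ℤ) / q := Int.ediv_le_ediv hq0 (by linarith)
        rwa [Int.mul_ediv_cancel _ hq0.ne'] at this
      · have := Int.emod_lt_of_pos v hq0
        omega
    · intros
      exact hF _
  refine h1.trans (le_of_eq ?_)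
  rw [Finset.sum_product]
  simp only
  rw [Finset.sum_const, nsmul_eq_mul, Int.card_Icc]
  congr 1
  have : ((R : ℤ) + 1 - -(R : ℤ)).toNat = 2 * R + 1 := by omega
  rw [this]
  push_cast
  ring

/-- The main bound for fixed frequencies. -/
theorem Gsum_upper (a : ℤ) (q k : ℕ) (hk : 1 ≤ k) (hq : 1 ≤ q) (α : ℝ) (Y : ℕ → ℕ) (hY1 : ∀ j, 1 ≤ Y j)
    (hYr : ∀ j, Y (j + 1) ^ k ≤ Y j ^ (k - 1)) (s H t R : ℕ) (hs : 1 ≤ s) (hH : 1 ≤ H) (ht : 1 ≤ t)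
    (hR : s * H * (2 * Y 0) ^ k ≤ R * q) (𝒳 : Finset ℕ) (E : ℝ)
    (hE : ∀ c : ℕ → ℂ, (∀ x, ‖c x‖ ≤ 1) →
      ∑ v ∈ Finset.range q, ‖gin a q k 𝒳 c (v : ℤ)‖ ^ (2 * t) ≤ q * E)
    (h : Fin s → ℤ) (hh : ∀ j, h j ≠ 0 ∧ |h j| ≤ H) :
    (∑ x ∈ 𝒳, ‖Gsum a q k α Y s h x‖) ^ (2 * t) ≤
      ((ybox Y s).card : ℝ) ^ (2 * t - 1) * ((4 * s * H * Y 0 + 1) * ((2 * R + 1) * (q * E)) *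
        ∏ j, ((2 : ℝ) ^ (k + 2) * s * H / |(h j : ℝ)|)) := by
  classical
  set V := ybox Y s with hV
  set M : ℝ := ∏ j, ((2 : ℝ) ^ (k + 2) * s * H / |(h j : ℝ)|) with hM
  have hM0 : 0 ≤ M := Finset.prod_nonneg fun _ _ => by positivity
  let vv : (Fin s → ℕ) → ℤ := fun y => ∑ j, h j * (y j : ℤ) ^ k
  let ww : (Fin s → ℕ) → ℤ := fun y => ∑ j, h j * (y j : ℤ)
  -- unimodular coefficients
  let ε : ℕ → ℂ := fun x => (starRingEnd ℂ) (Gsum a q k α Y s h x) / ‖Gsum a q k α Y s h x‖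
  have hε : ∀ x, ‖ε x‖ ≤ 1 := by
    intro x
    simp only [ε]
    rw [norm_div, RCLike.norm_conj, Complex.norm_real, norm_norm]
    exact div_self_le_one _
  have hεG : ∀ x, ε x * Gsum a q k α Y s h x = (‖Gsum a q k α Y s h x‖ : ℂ) := by
    intro x
    simp only [ε]
    rw [div_mul_eq_mul_div, mul_comm, Complex.mul_conj, Complex.normSq_eq_norm_sq]
    by_cases h0 : ‖Gsum a q k α Y s h x‖ = 0
    · rw [h0]
      simp
    · have : (‖Gsum a q k α Y s h x‖ : ℂ) ≠ 0 := by exact_mod_cast h0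
      field_simp
      push_cast
      ring
  let cc : ℤ → ℕ → ℂ := fun w x => ε x * ee (α * (x * w))
  have hcc : ∀ w x, ‖cc w x‖ ≤ 1 := by
    intro w x
    simp only [cc]
    rw [norm_mul, norm_ee, mul_one]
    exact hε x
  have h1 : ∑ x ∈ 𝒳, ‖Gsum a q k α Y s h x‖ ≤ ∑ y ∈ V, ‖gin a q k 𝒳 (cc (ww y)) (vv y)‖ := by
    have h2 : ((∑ x ∈ 𝒳, ‖Gsum a q k α Y s h x‖ : ℝ) : ℂ) = ∑ y ∈ V, gin a q k 𝒳 (cc (ww y)) (vv y) := by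
      push_cast
      have h3 : ∀ x ∈ 𝒳, (‖Gsum a q k α Y s h x‖ : ℂ) = ε x * Gsum a q k α Y s h x := fun x _ => (hεG x).symm
      rw [Finset.sum_congr rfl h3]
      unfold gin
      rw [Finset.sum_comm]
      refine Finset.sum_congr rfl fun x _ => ?_
      conv_lhs => rw [Gsum]
      rw [Finset.mul_sum]
      refine Finset.sum_congr rfl fun y _ => ?_
      simp only [cc, ww, vv]
      ring
    have h3 : ‖((∑ x ∈ 𝒳, ‖Gsum a q k α Y s h x‖ : ℝ) : ℂ)‖ ≤ ∑ y ∈ V, ‖gin a q k 𝒳 (cc (ww y)) (vv y)‖ := by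
      rw [h2]
      exact norm_sum_le _ _
    rw [Complex.norm_real, Real.norm_eq_abs] at h3
    exact (le_abs_self _).trans h3
  have h4 : (∑ y ∈ V, ‖gin a q k 𝒳 (cc (ww y)) (vv y)‖) ^ (2 * t) ≤
      (V.card : ℝ) ^ (2 * t - 1) * ∑ y ∈ V, ‖gin a q k 𝒳 (cc (ww y)) (vv y)‖ ^ (2 * t) := by
    have h5 : 2 * t = (2 * t - 1) + 1 := by omega
    rw [h5]
    simp only [Nat.add_sub_cancel]
    exact pow_sum_le_card_mul_sum_pow (fun _ _ => norm_nonneg _) _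
  have hybound : ∀ y ∈ V, ∀ j : Fin s, (y j : ℤ) ≤ 2 * Y 0 := by
    intro y hy j
    rw [hV, ybox, Fintype.mem_piFinset] at hy
    have h5 := hy j
    rw [Finset.mem_Ioc] at h5
    have h6 := Y_le_first k hk Y hY1 hYr 0 j
    rw [zero_add] at h6
    omega
  have hww : ∀ y ∈ V, ww y ∈ Finset.Icc (-((2 * s * H * Y 0 : ℕ) : ℤ)) ((2 * s * H * Y 0 : ℕ) : ℤ) := by
    intro y hy
    rw [Finset.mem_Icc, ← abs_le]
    refine (Finset.abs_sum_le_sum_abs _ _).trans ?_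
    have h5 : ∀ j ∈ (Finset.univ : Finset (Fin s)), |h j * (y j : ℤ)| ≤ H * (2 * Y 0) := by
      intro j _
      rw [abs_mul, Nat.abs_cast]
      exact mul_le_mul (hh j).2 (hybound y hy j) (by positivity) (by positivity)
    refine (Finset.sum_le_sum h5).trans (le_of_eq ?_)
    rw [Finset.sum_const, nsmul_eq_mul, Finset.card_univ, Fintype.card_fin]
    push_cast
    ring
  have hvv : ∀ y ∈ V, vv y ∈ Finset.Icc (-((s * H * (2 * Y 0) ^ k : ℕ) : ℤ)) ((s * H * (2 * Y 0) ^ k : ℕ) : ℤ) := by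
    intro y hy
    rw [Finset.mem_Icc, ← abs_le]
    refine (Finset.abs_sum_le_sum_abs _ _).trans ?_
    have h5 : ∀ j ∈ (Finset.univ : Finset (Fin s)), |h j * (y j : ℤ) ^ k| ≤ H * (2 * Y 0) ^ k := by
      intro j _
      rw [abs_mul, abs_pow, Nat.abs_cast]
      exact mul_le_mul (hh j).2 (pow_le_pow_left₀ (by positivity) (hybound y hy j) _) (by positivity) (by positivity)
    refine (Finset.sum_le_sum h5).trans (le_of_eq ?_)
    rw [Finset.sum_const, nsmul_eq_mul, Finset.card_univ, Fintype.card_fin]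
    push_cast
    ring
  have h6 : ∀ w : ℤ, ∑ y ∈ V, ‖gin a q k 𝒳 (cc w) (vv y)‖ ^ (2 * t) ≤ (2 * R + 1) * (q * E) * M := by
    intro w
    rw [← Finset.sum_fiberwise_of_maps_to hvv]
    have h7 : ∀ v ∈ Finset.Icc (-((s * H * (2 * Y 0) ^ k : ℕ) : ℤ)) ((s * H * (2 * Y 0) ^ k : ℕ) : ℤ),
        ∑ y ∈ V with vv y = v, ‖gin a q k 𝒳 (cc w) (vv y)‖ ^ (2 * t) ≤
          M * ‖gin a q k 𝒳 (cc w) (((v % q).toNat : ℕ) : ℤ)‖ ^ (2 * t) := by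
      intro v _
      have h8 : ∀ y ∈ V.filter (fun y => vv y = v), ‖gin a q k 𝒳 (cc w) (vv y)‖ ^ (2 * t) =
          ‖gin a q k 𝒳 (cc w) (((v % q).toNat : ℕ) : ℤ)‖ ^ (2 * t) := by
        intro y hy
        rw [Finset.mem_filter] at hy
        rw [hy.2, gin_periodic a q k hq]
      rw [Finset.sum_congr rfl h8, Finset.sum_const, nsmul_eq_mul]
      apply mul_le_mul_of_nonneg_right _ (by positivity)
      exact ybox_multiplicity k s H hk hs hH s le_rfl Y hY1 hYr h hh v
    refine (Finset.sum_le_sum h7).trans ?_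
    rw [← Finset.mul_sum]
    have h9 := sum_interval_le q hq ((s * H * (2 * Y 0) ^ k : ℕ) : ℤ) R (by exact_mod_cast hR)
      (fun r => ‖gin a q k 𝒳 (cc w) (r : ℤ)‖ ^ (2 * t)) (fun r => by positivity)
    have h10 := hE (cc w) (hcc w)
    calc _ ≤ M * ((2 * R + 1) * ∑ r ∈ Finset.range q, ‖gin a q k 𝒳 (cc w) (r : ℤ)‖ ^ (2 * t)) :=
          mul_le_mul_of_nonneg_left h9 hM0
      _ ≤ M * ((2 * R + 1) * (q * E)) := by gcongr
      _ = _ := by ring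
  have h11 : ∑ y ∈ V, ‖gin a q k 𝒳 (cc (ww y)) (vv y)‖ ^ (2 * t) ≤
      (4 * s * H * Y 0 + 1) * ((2 * R + 1) * (q * E) * M) := by
    have h12 : ∑ y ∈ V, ‖gin a q k 𝒳 (cc (ww y)) (vv y)‖ ^ (2 * t) ≤
        ∑ y ∈ V, ∑ w ∈ Finset.Icc (-((2 * s * H * Y 0 : ℕ) : ℤ)) ((2 * s * H * Y 0 : ℕ) : ℤ),
          ‖gin a q k 𝒳 (cc w) (vv y)‖ ^ (2 * t) := by
      refine Finset.sum_le_sum fun y hy => ?_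
      exact Finset.single_le_sum (f := fun w => ‖gin a q k 𝒳 (cc w) (vv y)‖ ^ (2 * t))
        (fun _ _ => by positivity) (hww y hy)
    refine h12.trans ?_
    rw [Finset.sum_comm]
    refine (Finset.sum_le_sum fun w _ => h6 w).trans (le_of_eq ?_)
    rw [Finset.sum_const, nsmul_eq_mul, Int.card_Icc]
    congr 1
    have : (((2 * s * H * Y 0 : ℕ) : ℤ) + 1 - -((2 * s * H * Y 0 : ℕ) : ℤ)).toNat = 4 * s * H * Y 0 + 1 := by
      have e : (((2 * s * H * Y 0 : ℕ) : ℤ) + 1 - -((2 * s * H * Y 0 : ℕ) : ℤ)) = ((4 * s * H * Y 0 + 1 : ℕ) : ℤ) := by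
        push_cast
        ring
      rw [e, Int.toNat_natCast]
    rw [this]
    push_cast
    ring
  calc (∑ x ∈ 𝒳, ‖Gsum a q k α Y s h x‖) ^ (2 * t)
      ≤ (∑ y ∈ V, ‖gin a q k 𝒳 (cc (ww y)) (vv y)‖) ^ (2 * t) :=
        pow_le_pow_left₀ (Finset.sum_nonneg fun _ _ => norm_nonneg _) h1 _
    _ ≤ _ := h4
    _ ≤ (V.card : ℝ) ^ (2 * t - 1) * ((4 * s * H * Y 0 + 1) * ((2 * R + 1) * (q * E) * M)) :=
        mul_le_mul_of_nonneg_left h11 (by positivity)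
    _ = _ := by ring

/-- The G-inequality. -/
theorem G_ineq (a : ℤ) (q k : ℕ) (hk : 1 ≤ k) (hq : 1 ≤ q) (α : ℝ) (Y : ℕ → ℕ) (hY1 : ∀ j, 1 ≤ Y j)
    (hYr : ∀ j, Y (j + 1) ^ k ≤ Y j ^ (k - 1)) (s H t R : ℕ) (hs : 1 ≤ s) (hH : 1 ≤ H) (ht : 1 ≤ t)
    (hR : s * H * (2 * Y 0) ^ k ≤ R * q) (𝒳 : Finset ℕ) (E : ℝ)
    (hE : ∀ c : ℕ → ℂ, (∀ x, ‖c x‖ ≤ 1) →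
      ∑ v ∈ Finset.range q, ‖gin a q k 𝒳 c (v : ℤ)‖ ^ (2 * t) ≤ q * E)
    (w : ℤ → ℝ) (hw : ∀ h, |w h| ≤ 1)
    (hlow : ∀ x ∈ 𝒳, ∀ j : Fin s, ∀ y ∈ Finset.Ioc (Y j) (2 * Y j),
      (∑ h ∈ hset H, (w h : ℂ) * ee (h * theta a q k α x y)).re ≤ -(1 / 2)) :
    (𝒳.card : ℝ) ^ (2 * t) * (∏ j : Fin s, (Y j : ℝ)) ≤
      2 ^ (2 * t * s) * (2 * (H : ℝ)) ^ (s * (2 * t - 1)) *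
        (2 ^ (k + 2) * s * H * (2 * (1 + Real.log H))) ^ s *
        ((4 * s * H * Y 0 + 1) * ((2 * R + 1) * (q * E))) := by
  set V : ℝ := ((ybox Y s).card : ℝ) with hV
  have hVe : V = ∏ j : Fin s, (Y j : ℝ) := by
    rw [hV, card_ybox]
    push_cast
    rfl
  have hVpos : 0 < V := by
    rw [hVe]
    apply Finset.prod_pos
    intro j _
    exact_mod_cast hY1 j
  set P := Fintype.piFinset (fun _ : Fin s => hset H) with hP
  have hcardP : (P.card : ℝ) = (2 * (H : ℝ)) ^ s := by
    rw [hP, Fintype.card_piFinset]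
    simp [card_hset]
  set A : (Fin s → ℤ) → ℝ := fun h => ∑ x ∈ 𝒳, ‖Gsum a q k α Y s h x‖ with hA
  have h1 : (𝒳.card : ℝ) * (V / 2 ^ s) ≤ ∑ h ∈ P, A h := by
    simp only [hA]
    rw [Finset.sum_comm, ← nsmul_eq_mul, ← Finset.sum_const]
    exact Finset.sum_le_sum fun x hx => Gsum_lower a q k α Y s H w hw x (hlow x hx)
  have h2 : (∑ h ∈ P, A h) ^ (2 * t) ≤ (P.card : ℝ) ^ (2 * t - 1) * ∑ h ∈ P, A h ^ (2 * t) := by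
    have h5 : 2 * t = (2 * t - 1) + 1 := by omega
    rw [h5]
    simp only [Nat.add_sub_cancel]
    exact pow_sum_le_card_mul_sum_pow
      (fun _ _ => Finset.sum_nonneg fun _ _ => norm_nonneg _) _
  set D : ℝ := (4 * s * H * Y 0 + 1) * ((2 * R + 1) * (q * E)) with hD
  have hE0 : 0 ≤ q * E := by
    refine le_trans ?_ (hE (fun _ => 0) (by simp))
    exact Finset.sum_nonneg fun _ _ => by positivity
  have hD0 : 0 ≤ D := by positivity
  have h3 : ∑ h ∈ P, A h ^ (2 * t) ≤ V ^ (2 * t - 1) * (D *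
      (2 ^ (k + 2) * s * H * (2 * (1 + Real.log H))) ^ s) := by
    have h4 : ∀ h ∈ P, A h ^ (2 * t) ≤ V ^ (2 * t - 1) * (D *
        ∏ j, ((2 : ℝ) ^ (k + 2) * s * H / |(h j : ℝ)|)) := by
      intro h hh
      rw [hP, Fintype.mem_piFinset] at hh
      exact Gsum_upper a q k hk hq α Y hY1 hYr s H t R hs hH ht hR 𝒳 E hE h
        (fun j => (mem_hset H (h j)).1 (hh j))
    refine (Finset.sum_le_sum h4).trans ?_
    rw [← Finset.mul_sum, ← Finset.mul_sum]
    apply mul_le_mul_of_nonneg_left _ (by positivity)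
    apply mul_le_mul_of_nonneg_left _ hD0
    have h5 : ∑ h ∈ P, ∏ j, ((2 : ℝ) ^ (k + 2) * s * H / |(h j : ℝ)|) =
        ∏ _j : Fin s, ∑ h ∈ hset H, ((2 : ℝ) ^ (k + 2) * s * H / |(h : ℝ)|) := by
      rw [Finset.prod_univ_sum]
    rw [h5, Finset.prod_const, Finset.card_univ, Fintype.card_fin]
    apply pow_le_pow_left₀
    · exact Finset.sum_nonneg fun _ _ => by positivity
    · have h6 : ∀ h ∈ hset H, ((2 : ℝ) ^ (k + 2) * s * H / |(h : ℝ)|) =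
          ((2 : ℝ) ^ (k + 2) * s * H) * (1 / |(h : ℝ)|) := fun h _ => by ring
      rw [Finset.sum_congr rfl h6, ← Finset.mul_sum]
      exact mul_le_mul_of_nonneg_left (sum_hset_inv H) (by positivity)
  have h7 : ((𝒳.card : ℝ) * (V / 2 ^ s)) ^ (2 * t) ≤ ((2 * (H : ℝ)) ^ s) ^ (2 * t - 1) * (V ^ (2 * t - 1) * (D *
      (2 ^ (k + 2) * s * H * (2 * (1 + Real.log H))) ^ s)) := by
    calc _ ≤ (∑ h ∈ P, A h) ^ (2 * t) := pow_le_pow_left₀ (by positivity) h1 _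
      _ ≤ _ := h2
      _ ≤ _ := by
        rw [hcardP]
        exact mul_le_mul_of_nonneg_left h3 (by positivity)
  rw [← hVe]
  have h8 : ((𝒳.card : ℝ) * (V / 2 ^ s)) ^ (2 * t) * 2 ^ (2 * t * s) =
      V ^ (2 * t - 1) * ((𝒳.card : ℝ) ^ (2 * t) * V) := by
    have h5 : 2 * t = (2 * t - 1) + 1 := by omega
    rw [mul_pow, div_pow, ← pow_mul, mul_comm s (2 * t)]
    have h9 : V ^ (2 * t) = V ^ (2 * t - 1) * V := by
      conv_lhs => rw [h5]
      rw [pow_succ]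
    rw [h9]
    have h11 : (2 : ℝ) ^ (2 * t * s) ≠ 0 := by positivity
    generalize (2 : ℝ) ^ (2 * t * s) = u at h11 ⊢
    generalize V ^ (2 * t - 1) = u'
    generalize (𝒳.card : ℝ) ^ (2 * t) = u''
    field_simp
  have h10 : V ^ (2 * t - 1) * ((𝒳.card : ℝ) ^ (2 * t) * V) ≤ V ^ (2 * t - 1) *
      (2 ^ (2 * t * s) * (2 * (H : ℝ)) ^ (s * (2 * t - 1)) *
        (2 ^ (k + 2) * s * H * (2 * (1 + Real.log H))) ^ s * D) := by
    rw [← h8]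
    calc _ ≤ ((2 * (H : ℝ)) ^ s) ^ (2 * t - 1) * (V ^ (2 * t - 1) * (D *
      (2 ^ (k + 2) * s * H * (2 * (1 + Real.log H))) ^ s)) * 2 ^ (2 * t * s) :=
        mul_le_mul_of_nonneg_right h7 (by positivity)
      _ = _ := by
        rw [pow_mul (2 * (H : ℝ)) s]
        ring
  exact le_of_mul_le_mul_left h10 (by positivity)

theorem orth_q (q : ℕ) (hq : 1 ≤ q) (n : ℤ) :
    ∑ v ∈ Finset.range q, ee ((n : ℝ) * v / q) = if (q : ℤ) ∣ n then (q : ℂ) else 0 := by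
  have hqr : (q : ℝ) ≠ 0 := by
    have : q ≠ 0 := by omega
    exact_mod_cast this
  have h1 : ∀ v ∈ Finset.range q, ee ((n : ℝ) * v / q) = ee ((n : ℝ) / q) ^ v := by
    intro v _
    rw [← ee_nat_mul]
    congr 1
    ring
  rw [Finset.sum_congr rfl h1]
  split_ifs with h
  · obtain ⟨m, rfl⟩ := h
    have : (((q : ℤ) * m : ℤ) : ℝ) / q = (m : ℤ) := by
      push_cast
      field_simp
    rw [this, ee_int]
    simp
  · have hne : ee ((n : ℝ) / q) ≠ 1 := by
      intro h2
      rw [ee_eq_one_iff] at h2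
      obtain ⟨m, hm⟩ := h2
      apply h
      refine ⟨m, ?_⟩
      rw [div_eq_iff hqr] at hm
      have h3 : (n : ℝ) = ((q * m : ℤ) : ℝ) := by
        push_cast
        linarith
      exact_mod_cast h3
    rw [geom_sum_eq hne, ← ee_nat_mul]
    have : (q : ℝ) * ((n : ℝ) / q) = n := by field_simp
    rw [this, ee_int]
    simp

/-- Parseval modulo `q`. -/
theorem parseval_q {ι : Type*} (q : ℕ) (hq : 1 ≤ q) (I : Finset ι) (u : ι → ℤ) (c : ι → ℂ)
    (hc : ∀ i, ‖c i‖ ≤ 1) :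
    ∑ v ∈ Finset.range q, ‖∑ i ∈ I, c i * ee ((u i : ℝ) * v / q)‖ ^ 2 ≤
      q * (((I ×ˢ I).filter (fun p => (q : ℤ) ∣ u p.1 - u p.2)).card : ℝ) := by
  have h1 : ((∑ v ∈ Finset.range q, ‖∑ i ∈ I, c i * ee ((u i : ℝ) * v / q)‖ ^ 2 : ℝ) : ℂ) =
      ∑ p ∈ (I ×ˢ I).filter (fun p => (q : ℤ) ∣ u p.1 - u p.2), c p.1 * (starRingEnd ℂ) (c p.2) * q := by
    push_cast
    have h2 : ∀ v ∈ Finset.range q, ((‖∑ i ∈ I, c i * ee ((u i : ℝ) * v / q)‖ : ℂ)) ^ 2 =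
        ∑ p ∈ I ×ˢ I, c p.1 * (starRingEnd ℂ) (c p.2) * ee (((u p.1 - u p.2 : ℤ) : ℝ) * v / q) := by
      intro v _
      rw [← Complex.mul_conj', map_sum, Finset.sum_mul_sum, ← Finset.sum_product']
      refine Finset.sum_congr rfl fun p _ => ?_
      have : (((u p.1 - u p.2 : ℤ) : ℝ) * v / q) = (u p.1 : ℝ) * v / q - (u p.2 : ℝ) * v / q := by
        push_cast
        ring
      rw [this, ee_sub, map_mul]
      ring
    rw [Finset.sum_congr rfl h2, Finset.sum_comm, Finset.sum_filter]
    refine Finset.sum_congr rfl fun p _ => ?_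
    rw [← Finset.mul_sum, orth_q q hq]
    split_ifs <;> simp
  have h3 : ‖((∑ v ∈ Finset.range q, ‖∑ i ∈ I, c i * ee ((u i : ℝ) * v / q)‖ ^ 2 : ℝ) : ℂ)‖ ≤
      q * (((I ×ˢ I).filter (fun p => (q : ℤ) ∣ u p.1 - u p.2)).card : ℝ) := by
    rw [h1]
    refine (norm_sum_le _ _).trans ?_
    have h4 : ∀ p ∈ (I ×ˢ I).filter (fun p => (q : ℤ) ∣ u p.1 - u p.2),
        ‖c p.1 * (starRingEnd ℂ) (c p.2) * q‖ ≤ q := by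
      intro p _
      rw [norm_mul, norm_mul, RCLike.norm_conj, Complex.norm_natCast]
      have := hc p.1
      have h5 := hc p.2
      have h6 : ‖c p.1‖ * ‖c p.2‖ ≤ 1 := by
        calc _ ≤ 1 * (1 : ℝ) := by gcongr
          _ = 1 := by norm_num
      exact mul_le_of_le_one_left (by positivity) h6
    refine (Finset.sum_le_sum h4).trans (le_of_eq ?_)
    rw [Finset.sum_const, nsmul_eq_mul, mul_comm]
  rw [Complex.norm_real, Real.norm_eq_abs] at h3
  exact (le_abs_self _).trans h3

/-- number of `k`-th roots of unity modulo `q` -/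
noncomputable def rootsCard (k q : ℕ) : ℕ := Nat.card {z : (ZMod q)ˣ // z ^ k = 1}

theorem rootsCard_mul (k m n : ℕ) (h : Nat.Coprime m n) :
    rootsCard k (m * n) = rootsCard k m * rootsCard k n := by
  unfold rootsCard
  rw [← Nat.card_prod]
  let e : (ZMod (m * n))ˣ ≃* (ZMod m)ˣ × (ZMod n)ˣ :=
    (Units.mapEquiv (ZMod.chineseRemainder h).toMulEquiv).trans MulEquiv.prodUnits
  apply Nat.card_congr
  refine (Equiv.subtypeEquiv e.toEquiv (q := fun z => z.1 ^ k = 1 ∧ z.2 ^ k = 1) ?_).trans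
    (Equiv.subtypeProdEquivProd (p := fun z : (ZMod m)ˣ => z ^ k = 1) (q := fun z : (ZMod n)ˣ => z ^ k = 1))
  intro z
  have h1 : z ^ k = 1 ↔ (e z) ^ k = 1 := by
    rw [← map_pow, MulEquiv.map_eq_one_iff]
  rw [h1, Prod.ext_iff]
  rfl

theorem rootsCard_cyclic {G : Type*} [CommGroup G] [Finite G] [IsCyclic G] (k : ℕ) (hk : 1 ≤ k) :
    Nat.card {z : G // z ^ k = 1} ≤ k := by
  classical
  have := Fintype.ofFinite G
  have h1 := IsCyclic.card_pow_eq_one_le (α := G) (n := k) (by omega)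
  rw [Nat.card_eq_fintype_card, Fintype.card_subtype]
  exact h1

theorem rootsCard_index_two {G : Type*} [CommGroup G] [Finite G] (C : Subgroup G) [IsCyclic C]
    (hC : C.index = 2) (k : ℕ) (hk : 1 ≤ k) :
    Nat.card {z : G // z ^ k = 1} ≤ 2 * k := by
  classical
  have := Fintype.ofFinite G
  rw [Nat.card_eq_fintype_card, Fintype.card_subtype]
  set T : Finset G := Finset.univ.filter (fun z : G => z ^ k = 1) with hT
  have h1 : (T.filter (fun z => z ∈ C)).card ≤ k := by
    have h2 := rootsCard_cyclic (G := C) k hk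
    rw [Nat.card_eq_fintype_card, Fintype.card_subtype] at h2
    refine le_trans ?_ h2
    rw [← Finset.card_map (Function.Embedding.subtype (fun z => z ∈ C))]
    apply Finset.card_le_card
    intro z hz
    rw [hT, Finset.mem_filter, Finset.mem_filter] at hz
    rw [Finset.mem_map]
    refine ⟨⟨z, hz.2⟩, ?_, rfl⟩
    rw [Finset.mem_filter]
    refine ⟨Finset.mem_univ _, ?_⟩
    ext
    simpa using hz.1.2
  have h3 : (T.filter (fun z => z ∉ C)).card ≤ k := by
    rcases (T.filter (fun z => z ∉ C)).eq_empty_or_nonempty with h | ⟨z0, hz0⟩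
    · rw [h]
      simp
    · refine le_trans ?_ h1
      rw [hT, Finset.mem_filter, Finset.mem_filter] at hz0
      apply Finset.card_le_card_of_injOn (fun z => z * z0)
      · intro z hz
        rw [hT, Finset.mem_coe, Finset.mem_filter, Finset.mem_filter] at hz
        rw [hT, Finset.mem_coe, Finset.mem_filter, Finset.mem_filter]
        refine ⟨⟨Finset.mem_univ _, ?_⟩, ?_⟩
        · rw [mul_pow, hz.1.2, hz0.1.2, mul_one]
        · rw [Subgroup.mul_mem_iff_of_index_two hC]
          simp [hz.2, hz0.2]
      · intro z _ z' _ h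
        exact mul_right_cancel h
  rw [← Finset.card_filter_add_card_filter_not (s := T) (fun z => z ∈ C)]
  omega

theorem rootsCard_two_pow (k : ℕ) (hk : 1 ≤ k) (n : ℕ) : rootsCard k (2 ^ n) ≤ 2 * k := by
  unfold rootsCard
  rcases lt_or_ge n 3 with hn | hn
  · have hc : IsCyclic (ZMod (2 ^ n))ˣ := by
      rw [ZMod.isCyclic_units_two_pow_iff]
      omega
    have : NeZero (2 ^ n) := ⟨by positivity⟩
    refine (rootsCard_cyclic k hk).trans (by omega)
  · obtain ⟨m, rfl⟩ := Nat.exists_eq_add_of_le' (by omega : 2 ≤ n)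
    have : NeZero (2 ^ (m + 2)) := ⟨by positivity⟩
    have h5 : IsUnit (5 : ZMod (2 ^ (m + 2))) := by
      have : (5 : ZMod (2 ^ (m + 2))) = ((5 : ℕ) : ZMod (2 ^ (m + 2))) := by norm_num
      rw [this, ZMod.isUnit_iff_coprime]
      exact Nat.Coprime.pow_right _ (by norm_num)
    obtain ⟨u, hu⟩ := h5
    have hord : orderOf u = 2 ^ m := by
      rw [← orderOf_units, hu, ZMod.orderOf_five]
    refine rootsCard_index_two (Subgroup.zpowers u) ?_ k hk
    have h1 := Subgroup.card_mul_index (Subgroup.zpowers u)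
    rw [Nat.card_zpowers, hord, Nat.card_eq_fintype_card, ZMod.card_units_eq_totient,
      Nat.totient_prime_pow Nat.prime_two (by omega)] at h1
    have h2 : 2 ^ (m + 2 - 1) * (2 - 1) = 2 ^ m * 2 := by
      rw [show m + 2 - 1 = m + 1 by omega, pow_succ]
      norm_num
    rw [h2] at h1
    exact Nat.eq_of_mul_eq_mul_left (by positivity) h1

theorem rootsCard_prime_pow (k : ℕ) (hk : 1 ≤ k) (p n : ℕ) (hp : p.Prime) :
    rootsCard k (p ^ n) ≤ 2 * k := by
  by_cases h2 : p = 2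
  · subst h2
    exact rootsCard_two_pow k hk n
  · unfold rootsCard
    have hc := ZMod.isCyclic_units_of_prime_pow p hp h2 n
    have : NeZero (p ^ n) := ⟨by have := hp.pos; positivity⟩
    refine (rootsCard_cyclic k hk).trans (by omega)

theorem rootsCard_bound (k : ℕ) (hk : 1 ≤ k) (κ : ℝ) (hκ : 0 < κ) :
    ∃ K : ℝ, 0 < K ∧ ∀ q : ℕ, 1 ≤ q → (rootsCard k q : ℝ) ≤ K * (q : ℝ) ^ κ := by
  obtain ⟨P0, hP0⟩ : ∃ P0 : ℕ, ∀ p : ℕ, P0 ≤ p → (2 * k : ℝ) ≤ (p : ℝ) ^ κ := by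
    have h1 := ((tendsto_rpow_atTop hκ).comp tendsto_natCast_atTop_atTop).eventually_ge_atTop (2 * k : ℝ)
    rw [Filter.eventually_atTop] at h1
    exact h1
  have h2k : (1 : ℝ) ≤ 2 * k := by
    have : (1 : ℝ) ≤ k := by exact_mod_cast hk
    linarith
  have key : ∀ q : ℕ, 1 ≤ q → (rootsCard k q : ℝ) ≤
      (2 * k : ℝ) ^ ((q.primeFactors.filter (fun p => p < P0)).card) * (q : ℝ) ^ κ := by
    intro q
    induction q using Nat.recOnPosPrimePosCoprime with
    | prime_pow p n hp hn =>
      intro _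
      have h1 : (rootsCard k (p ^ n) : ℝ) ≤ 2 * k := by exact_mod_cast rootsCard_prime_pow k hk p n hp
      rw [Nat.primeFactors_prime_pow hn.ne' hp, Finset.filter_singleton]
      have hp1 : (1 : ℝ) ≤ p := by exact_mod_cast hp.one_le
      split_ifs with h
      · rw [Finset.card_singleton, pow_one]
        refine h1.trans ?_
        apply le_mul_of_one_le_right (by positivity)
        apply Real.one_le_rpow _ hκ.le
        push_cast
        exact one_le_pow₀ hp1
      · rw [Finset.card_empty, pow_zero, one_mul]
        refine h1.trans ((hP0 p (by omega)).trans ?_)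
        apply Real.rpow_le_rpow (by positivity) _ hκ.le
        push_cast
        exact le_self_pow₀ hp1 hn.ne'
    | zero =>
      intro h
      omega
    | one =>
      intro _
      have h1 := rootsCard_prime_pow k hk 2 0 Nat.prime_two
      simp only [Nat.primeFactors_one, Finset.filter_empty, Finset.card_empty, pow_zero, Nat.cast_one,
        Real.one_rpow, mul_one]
      have h2 : rootsCard k 1 ≤ 1 := by
        unfold rootsCard
        have : Subsingleton (ZMod 1)ˣ := inferInstance
        rw [Finite.card_le_one_iff_subsingleton]
        infer_instance
      exact_mod_cast h2
    | coprime a b ha hb hab iha ihb =>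
      intro _
      rw [rootsCard_mul k a b hab, hab.primeFactors_mul, Finset.filter_union, Finset.card_union_of_disjoint
        (Finset.disjoint_filter_filter hab.disjoint_primeFactors), pow_add]
      push_cast
      rw [Real.mul_rpow (by positivity) (by positivity)]
      have h1 := iha (by omega)
      have h2 := ihb (by omega)
      calc (rootsCard k a : ℝ) * rootsCard k b ≤ _ := mul_le_mul h1 h2 (by positivity) (by positivity)
        _ = _ := by ring
  refine ⟨(2 * k : ℝ) ^ P0, by positivity, fun q hq => (key q hq).trans ?_⟩
  apply mul_le_mul_of_nonneg_right _ (by positivity)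
  apply pow_le_pow_right₀ h2k
  calc (q.primeFactors.filter (fun p => p < P0)).card ≤ (Finset.range P0).card := by
        apply Finset.card_le_card
        intro p hp
        rw [Finset.mem_filter] at hp
        rw [Finset.mem_range]
        exact hp.2
    _ = P0 := Finset.card_range P0

/-- counting solutions of `x^k ≡ x'^k (mod q)` -/
theorem count_congr_pow (k q : ℕ) (hq : 1 ≤ q) (𝒳 : Finset ℕ)
    (hco : ∀ x ∈ 𝒳, Nat.Coprime x q) (hinj : ∀ x ∈ 𝒳, x < q) :
    ((𝒳 ×ˢ 𝒳).filter (fun p => (q : ℤ) ∣ (p.1 : ℤ) ^ k - (p.2 : ℤ) ^ k)).card ≤ 𝒳.card * rootsCard k q := by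
  classical
  have : NeZero q := ⟨by omega⟩
  unfold rootsCard
  rw [Nat.card_eq_fintype_card, Fintype.card_subtype, ← Finset.card_product]
  let φ : ℕ → (ZMod q)ˣ := fun x => if h : Nat.Coprime x q then ZMod.unitOfCoprime x h else 1
  have hφ : ∀ x ∈ 𝒳, ((φ x : (ZMod q)ˣ) : ZMod q) = (x : ZMod q) := by
    intro x hx
    simp only [φ]
    rw [dif_pos (hco x hx)]
    rfl
  have hφinj : ∀ x ∈ 𝒳, ∀ y ∈ 𝒳, φ x = φ y → x = y := by
    intro x hx y hy h
    have h1 : (x : ZMod q) = (y : ZMod q) := by rw [← hφ x hx, ← hφ y hy, h]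
    rw [ZMod.natCast_eq_natCast_iff] at h1
    exact Nat.ModEq.eq_of_lt_of_lt h1 (hinj x hx) (hinj y hy)
  apply Finset.card_le_card_of_injOn (fun p => (p.2, φ p.1 / φ p.2))
  · rintro ⟨x, y⟩ hp
    rw [Finset.mem_coe, Finset.mem_filter, Finset.mem_product] at hp
    rw [Finset.mem_coe, Finset.mem_product, Finset.mem_filter]
    refine ⟨hp.1.2, Finset.mem_univ _, ?_⟩
    simp only at hp ⊢
    rw [div_pow, div_eq_one]
    ext
    rw [Units.val_pow_eq_pow_val, Units.val_pow_eq_pow_val, hφ x hp.1.1, hφ y hp.1.2]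
    have h1 := (ZMod.intCast_zmod_eq_zero_iff_dvd _ q).2 hp.2
    push_cast at h1
    exact sub_eq_zero.1 h1
  · rintro ⟨x, y⟩ hp ⟨x', y'⟩ hp' h
    rw [Finset.mem_coe, Finset.mem_filter, Finset.mem_product] at hp hp'
    simp only [Prod.mk.injEq] at h hp hp' ⊢
    obtain ⟨rfl, h2⟩ := h
    refine ⟨?_, rfl⟩
    exact hφinj x hp.1.1 x' hp'.1.1 (div_left_injective h2)

/-- The hypothesis `hE` for `t = 1`. -/
theorem hE_one (a : ℤ) (q k : ℕ) (hq : 1 ≤ q) (ha : IsCoprime (q : ℤ) a) (𝒳 : Finset ℕ)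
    (hco : ∀ x ∈ 𝒳, Nat.Coprime x q) (hinj : ∀ x ∈ 𝒳, x < q) (c : ℕ → ℂ) (hc : ∀ x, ‖c x‖ ≤ 1) :
    ∑ v ∈ Finset.range q, ‖gin a q k 𝒳 c (v : ℤ)‖ ^ (2 * 1) ≤ q * ((𝒳.card : ℝ) * rootsCard k q) := by
  have h1 := parseval_q q hq 𝒳 (fun x => a * (x : ℤ) ^ k) c hc
  have h2 : ∀ v ∈ Finset.range q, ‖gin a q k 𝒳 c (v : ℤ)‖ ^ (2 * 1) =
      ‖∑ i ∈ 𝒳, c i * ee (((a * (i : ℤ) ^ k : ℤ) : ℝ) * v / q)‖ ^ 2 := by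
    intro v _
    unfold gin
    push_cast
    rfl
  rw [Finset.sum_congr rfl h2]
  refine h1.trans ?_
  apply mul_le_mul_of_nonneg_left _ (by positivity)
  have h3 := count_congr_pow k q hq 𝒳 hco hinj
  have h4 : (𝒳 ×ˢ 𝒳).filter (fun p => (q : ℤ) ∣ a * (p.1 : ℤ) ^ k - a * (p.2 : ℤ) ^ k) =
      (𝒳 ×ˢ 𝒳).filter (fun p => (q : ℤ) ∣ (p.1 : ℤ) ^ k - (p.2 : ℤ) ^ k) := by
    apply Finset.filter_congr
    intro p _
    rw [← mul_sub]
    exact ⟨fun h => ha.dvd_of_dvd_mul_left h, fun h => Dvd.dvd.mul_left h a⟩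
  rw [h4]
  exact_mod_cast h3

/-- number of solutions of the Waring-type equation -/
noncomputable def Jcount (k t : ℕ) (𝒳 : Finset ℕ) : ℕ :=
  (((Fintype.piFinset (fun _ : Fin t => 𝒳)) ×ˢ (Fintype.piFinset (fun _ : Fin t => 𝒳))).filter
    (fun p => ∑ i, (p.1 i : ℤ) ^ k = ∑ i, (p.2 i : ℤ) ^ k)).card

/-- The hypothesis `hE` for general `t`. -/
theorem hE_gen (a : ℤ) (q k t X : ℕ) (hq : 1 ≤ q) (ha : IsCoprime (q : ℤ) a) (𝒳 : Finset ℕ)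
    (hX : ∀ x ∈ 𝒳, x ≤ X) (htX : t * X ^ k < q) (c : ℕ → ℂ) (hc : ∀ x, ‖c x‖ ≤ 1) :
    ∑ v ∈ Finset.range q, ‖gin a q k 𝒳 c (v : ℤ)‖ ^ (2 * t) ≤ q * (Jcount k t 𝒳 : ℝ) := by
  have h1 := parseval_q q hq (Fintype.piFinset (fun _ : Fin t => 𝒳)) (fun x => a * ∑ i, (x i : ℤ) ^ k)
    (fun x => ∏ i, c (x i)) (fun x => by
      rw [norm_prod]
      exact Finset.prod_le_one (fun _ _ => norm_nonneg _) (fun _ _ => hc _))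
  have h2 : ∀ v ∈ Finset.range q, ‖gin a q k 𝒳 c (v : ℤ)‖ ^ (2 * t) =
      ‖∑ x ∈ Fintype.piFinset (fun _ : Fin t => 𝒳), (∏ i, c (x i)) *
        ee (((a * ∑ i, (x i : ℤ) ^ k : ℤ) : ℝ) * v / q)‖ ^ 2 := by
    intro v _
    rw [mul_comm, pow_mul, ← norm_pow]
    congr 2
    have h3 : gin a q k 𝒳 c (v : ℤ) ^ t = ∏ _i : Fin t, gin a q k 𝒳 c (v : ℤ) := by simp
    rw [h3]
    unfold gin
    rw [Finset.prod_univ_sum]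
    refine Finset.sum_congr rfl fun x _ => ?_
    rw [Finset.prod_mul_distrib, ← ee_sum]
    congr 2
    push_cast
    rw [Finset.mul_sum, Finset.sum_mul, Finset.sum_div]
  rw [Finset.sum_congr rfl h2]
  refine h1.trans (le_of_eq ?_)
  congr 2
  unfold Jcount
  congr 1
  apply Finset.filter_congr
  rintro ⟨x, y⟩ hp
  rw [Finset.mem_product, Fintype.mem_piFinset, Fintype.mem_piFinset] at hp
  simp only at hp ⊢
  have hdv : ∀ z : ℤ, (q : ℤ) ∣ a * z ↔ (q : ℤ) ∣ z :=
    fun z => ⟨fun h => ha.dvd_of_dvd_mul_left h, fun h => Dvd.dvd.mul_left h a⟩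
  rw [← mul_sub, hdv]
  have hb : ∀ z : Fin t → ℕ, (∀ i, z i ∈ 𝒳) → 0 ≤ ∑ i, (z i : ℤ) ^ k ∧ ∑ i, (z i : ℤ) ^ k < q := by
    intro z hz
    constructor
    · positivity
    · have h5 : ∑ i : Fin t, (z i) ^ k ≤ ∑ _i : Fin t, X ^ k :=
        Finset.sum_le_sum fun i _ => Nat.pow_le_pow_left (hX _ (hz i)) k
      rw [Finset.sum_const, Finset.card_univ, Fintype.card_fin, smul_eq_mul] at h5
      exact_mod_cast h5.trans_lt htX
  obtain ⟨b1, b2⟩ := hb x hp.1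
  obtain ⟨b3, b4⟩ := hb y hp.2
  constructor
  · intro h
    have h6 := Int.eq_zero_of_abs_lt_dvd h (by rw [abs_lt]; constructor <;> linarith)
    linarith
  · intro h
    rw [h, sub_self]
    exact dvd_zero _

open MeasureTheory

/-- exponential sum over `k`-th powers -/
noncomputable def fX (k : ℕ) (S : Finset ℕ) (θ : ℝ) : ℂ := ∑ x ∈ S, ee (θ * (x : ℝ) ^ k)

theorem continuous_fX (k : ℕ) (S : Finset ℕ) : Continuous (fX k S) := by
  unfold fX
  refine continuous_finsetSum _ fun x _ => ?_
  exact continuous_ee.comp (by fun_prop)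

theorem fX_periodic (k : ℕ) (S : Finset ℕ) : Function.Periodic (fX k S) 1 := by
  intro θ
  unfold fX
  refine Finset.sum_congr rfl fun x _ => ?_
  have : (θ + 1) * (x : ℝ) ^ k = θ * (x : ℝ) ^ k + ((x ^ k : ℕ) : ℝ) := by
    push_cast
    ring
  rw [this, ee_add, ee_nat, mul_one]

theorem integral_ee (n : ℤ) : ∫ θ in (0 : ℝ)..1, ee (n * θ) = if n = 0 then 1 else 0 := by
  split_ifs with h
  · subst h
    simp [ee_zero]
  · have h1 : ∀ θ : ℝ, ee (n * θ) = Complex.exp ((2 * Real.pi * n * Complex.I) * θ) := by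
      intro θ
      unfold ee
      congr 1
      push_cast
      ring
    simp_rw [h1]
    have h2 : (2 * Real.pi * n * Complex.I : ℂ) ≠ 0 := by
      have : (n : ℂ) ≠ 0 := by exact_mod_cast h
      have h3 : (Real.pi : ℂ) ≠ 0 := by exact_mod_cast Real.pi_ne_zero
      simp [this, h3]
    rw [integral_exp_mul_complex h2]
    have h3 := ee_int n
    unfold ee at h3
    have h4 : (2 * Real.pi * n * Complex.I : ℂ) * ((1 : ℝ) : ℂ) = 2 * Real.pi * ((n : ℝ) : ℂ) * Complex.I := by
      push_cast
      ring
    rw [h4, h3]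
    simp

/-- shift invariance -/
theorem integral_twist_zero (G : ℝ → ℝ) (hG : Function.Periodic G 1) (P : ℕ) (hP : 1 ≤ P)
    (n : ℤ) (hn : ¬ (P : ℤ) ∣ n) : ∫ θ in (0 : ℝ)..1, ee (n * θ) * (G (P * θ) : ℂ) = 0 := by
  have hPr : (P : ℝ) ≠ 0 := by
    have : P ≠ 0 := by omega
    exact_mod_cast this
  set F : ℝ → ℂ := fun θ => ee (n * θ) * (G (P * θ) : ℂ) with hF
  have hper : Function.Periodic F 1 := by
    intro θ
    simp only [hF]
    have h1 : (n : ℝ) * (θ + 1) = n * θ + (n : ℝ) := by ring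
    have h2 : (P : ℝ) * (θ + 1) = P * θ + P * 1 := by ring
    rw [h1, ee_add, ee_int, mul_one, h2]
    rw [(hG.nat_mul P) (P * θ)]
  have hshift : ∀ θ, F (θ + 1 / P) = ee ((n : ℝ) / P) * F θ := by
    intro θ
    simp only [hF]
    have h1 : (n : ℝ) * (θ + 1 / P) = n * θ + n / P := by ring
    have h2 : (P : ℝ) * (θ + 1 / P) = P * θ + 1 := by field_simp
    rw [h1, ee_add, h2, hG]
    ring
  have h1 : ∫ θ in (0 : ℝ)..1, F (θ + 1 / P) = ∫ θ in (0 : ℝ)..1, F θ := by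
    rw [intervalIntegral.integral_comp_add_right]
    have := hper.intervalIntegral_add_eq (0 + 1 / (P : ℝ)) 0
    rw [show (0 : ℝ) + 1 / P + 1 = 1 + 1 / P by ring] at this
    rw [this, zero_add]
  simp_rw [hshift] at h1
  rw [intervalIntegral.integral_const_mul] at h1
  have hne : ee ((n : ℝ) / P) ≠ 1 := by
    intro h2
    rw [ee_eq_one_iff] at h2
    obtain ⟨m, hm⟩ := h2
    apply hn
    refine ⟨m, ?_⟩
    rw [div_eq_iff hPr] at hm
    have h3 : (n : ℝ) = ((P * m : ℤ) : ℝ) := by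
      push_cast
      linarith
    exact_mod_cast h3
  have h2 : (ee ((n : ℝ) / P) - 1) * ∫ θ in (0 : ℝ)..1, F θ = 0 := by
    rw [sub_mul, h1]
    ring
  rcases mul_eq_zero.1 h2 with h3 | h3
  · exact absurd (sub_eq_zero.1 h3) hne
  · exact h3

theorem integral_dilate (G : ℝ → ℝ) (hG : Function.Periodic G 1) (hGc : Continuous G) (P : ℕ) (hP : 1 ≤ P) :
    ∫ θ in (0 : ℝ)..1, G (P * θ) = ∫ θ in (0 : ℝ)..1, G θ := by
  have hPr : (P : ℝ) ≠ 0 := by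
    have : P ≠ 0 := by omega
    exact_mod_cast this
  rw [intervalIntegral.integral_comp_mul_left _ hPr]
  have h1 := hG.intervalIntegral_add_zsmul_eq (P : ℤ) 0
  simp only [zero_add, mul_zero, mul_one, zsmul_eq_mul, Int.cast_natCast] at h1 ⊢
  rw [h1 (fun t₁ t₂ => hGc.intervalIntegrable t₁ t₂), smul_eq_mul]
  field_simp

theorem integral_twist_le (G : ℝ → ℝ) (hG : Function.Periodic G 1) (hGc : Continuous G) (hG0 : ∀ θ, 0 ≤ G θ)
    (P : ℕ) (hP : 1 ≤ P) (n : ℤ) :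
    ‖∫ θ in (0 : ℝ)..1, ee (n * θ) * (G (P * θ) : ℂ)‖ ≤ ∫ θ in (0 : ℝ)..1, G θ := by
  rw [← integral_dilate G hG hGc P hP]
  refine (intervalIntegral.norm_integral_le_integral_norm (by norm_num)).trans (le_of_eq ?_)
  congr 1
  ext θ
  rw [norm_mul, norm_ee, one_mul, Complex.norm_real, Real.norm_eq_abs, abs_of_nonneg (hG0 _)]

/-- twisted second moment -/
theorem integral_sq_twist_le (k : ℕ) (S : Finset ℕ) (G : ℝ → ℝ) (hG : Function.Periodic G 1)
    (hGc : Continuous G) (hG0 : ∀ θ, 0 ≤ G θ) (P : ℕ) (hP : 1 ≤ P) :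
    ∫ θ in (0 : ℝ)..1, ‖fX k S θ‖ ^ 2 * G (P * θ) ≤
      (((S ×ˢ S).filter (fun p => (P : ℤ) ∣ (p.1 : ℤ) ^ k - (p.2 : ℤ) ^ k)).card : ℝ) *
        ∫ θ in (0 : ℝ)..1, G θ := by
  have hexp : ∀ θ : ℝ, ((‖fX k S θ‖ ^ 2 * G (P * θ) : ℝ) : ℂ) =
      ∑ p ∈ S ×ˢ S, ee ((((p.1 : ℤ) ^ k - (p.2 : ℤ) ^ k : ℤ) : ℝ) * θ) * (G (P * θ) : ℂ) := by
    intro θ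
    push_cast
    rw [← Complex.mul_conj', ← Finset.sum_mul]
    congr 1
    unfold fX
    rw [map_sum, Finset.sum_mul_sum, ← Finset.sum_product']
    refine Finset.sum_congr rfl fun p _ => ?_
    rw [← ee_sub]
    congr 1
    ring
  have h1 : ((∫ θ in (0 : ℝ)..1, ‖fX k S θ‖ ^ 2 * G (P * θ) : ℝ) : ℂ) =
      ∑ p ∈ S ×ˢ S, ∫ θ in (0 : ℝ)..1, ee ((((p.1 : ℤ) ^ k - (p.2 : ℤ) ^ k : ℤ) : ℝ) * θ) * (G (P * θ) : ℂ) := by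
    rw [← intervalIntegral.integral_ofReal, ← intervalIntegral.integral_finsetSum]
    · congr 1
      ext θ
      exact hexp θ
    · intro p _
      apply Continuous.intervalIntegrable
      apply Continuous.mul
      · exact continuous_ee.comp (by fun_prop)
      · exact Complex.continuous_ofReal.comp (hGc.comp (by fun_prop))
  have h2 : ‖((∫ θ in (0 : ℝ)..1, ‖fX k S θ‖ ^ 2 * G (P * θ) : ℝ) : ℂ)‖ ≤
      (((S ×ˢ S).filter (fun p => (P : ℤ) ∣ (p.1 : ℤ) ^ k - (p.2 : ℤ) ^ k)).card : ℝ) *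
        ∫ θ in (0 : ℝ)..1, G θ := by
    rw [h1, ← Finset.sum_filter_add_sum_filter_not (S ×ˢ S) (fun p => (P : ℤ) ∣ (p.1 : ℤ) ^ k - (p.2 : ℤ) ^ k)]
    have h3 : ∑ p ∈ S ×ˢ S with ¬ (P : ℤ) ∣ (p.1 : ℤ) ^ k - (p.2 : ℤ) ^ k,
        ∫ θ in (0 : ℝ)..1, ee ((((p.1 : ℤ) ^ k - (p.2 : ℤ) ^ k : ℤ) : ℝ) * θ) * (G (P * θ) : ℂ) = 0 := by
      apply Finset.sum_eq_zero
      intro p hp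
      rw [Finset.mem_filter] at hp
      exact integral_twist_zero G hG P hP _ hp.2
    rw [h3, add_zero]
    refine (norm_sum_le _ _).trans ?_
    refine (Finset.sum_le_sum fun p _ => integral_twist_le G hG hGc hG0 P hP _).trans (le_of_eq ?_)
    rw [Finset.sum_const, nsmul_eq_mul]
  rw [Complex.norm_real, Real.norm_eq_abs] at h2
  exact (le_abs_self _).trans h2

/-- The mean value counts solutions. -/
theorem Jcount_eq (k t : ℕ) (S : Finset ℕ) :
    (Jcount k t S : ℝ) = ∫ θ in (0 : ℝ)..1, ‖fX k S θ‖ ^ (2 * t) := by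
  set I := Fintype.piFinset (fun _ : Fin t => S) with hI
  have hexp : ∀ θ : ℝ, ((‖fX k S θ‖ ^ (2 * t) : ℝ) : ℂ) =
      ∑ p ∈ I ×ˢ I, ee (((∑ i, (p.1 i : ℤ) ^ k - ∑ i, (p.2 i : ℤ) ^ k : ℤ) : ℝ) * θ) := by
    intro θ
    have h3 : fX k S θ ^ t = ∑ x ∈ I, ee (((∑ i, (x i : ℤ) ^ k : ℤ) : ℝ) * θ) := by
      have h4 : fX k S θ ^ t = ∏ _i : Fin t, fX k S θ := by simp
      rw [h4]
      unfold fX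
      rw [Finset.prod_univ_sum]
      refine Finset.sum_congr rfl fun x _ => ?_
      rw [← ee_sum]
      congr 1
      push_cast
      rw [Finset.sum_mul]
      exact Finset.sum_congr rfl fun i _ => by ring
    rw [mul_comm, pow_mul, ← norm_pow]
    push_cast
    rw [← Complex.mul_conj', h3, map_sum, Finset.sum_mul_sum, ← Finset.sum_product']
    refine Finset.sum_congr rfl fun p _ => ?_
    rw [← ee_sub]
    congr 1
    push_cast
    ring
  have h1 : ((∫ θ in (0 : ℝ)..1, ‖fX k S θ‖ ^ (2 * t) : ℝ) : ℂ) = (Jcount k t S : ℂ) := by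
    rw [← intervalIntegral.integral_ofReal]
    simp_rw [hexp]
    rw [intervalIntegral.integral_finsetSum]
    · simp_rw [integral_ee]
      rw [← Finset.sum_filter, Finset.sum_const, nsmul_eq_mul, mul_one]
      unfold Jcount
      congr 2
      apply Finset.filter_congr
      intro p _
      rw [sub_eq_zero]
    · intro p _
      apply Continuous.intervalIntegrable
      exact continuous_ee.comp (by fun_prop)
  exact_mod_cast h1.symm

/-- pointwise inequality -/
theorem pointwise_ineq (i : ℕ) (PP : Finset ℕ) (g : ℕ → ℂ) (f : ℂ) (hf : f = ∑ p ∈ PP, g p) :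
    (PP.card : ℝ) * ‖f‖ ^ (2 * (i + 1)) ≤ PP.card * (4 ^ (i + 1) * ∑ p ∈ PP, ‖g p‖ ^ (2 * (i + 1))) +
      4 * (PP.card : ℝ) ^ (2 * i) * ∑ p ∈ PP, ‖f - g p‖ ^ 2 * ‖g p‖ ^ (2 * i) := by
  have hn1 : 0 ≤ ∑ p ∈ PP, ‖g p‖ ^ (2 * (i + 1)) := Finset.sum_nonneg fun _ _ => by positivity
  have hn2 : 0 ≤ ∑ p ∈ PP, ‖f - g p‖ ^ 2 * ‖g p‖ ^ (2 * i) := Finset.sum_nonneg fun _ _ => by positivity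
  by_cases h : ∃ p ∈ PP, ‖f‖ ≤ 2 * ‖g p‖
  · obtain ⟨p, hp, hle⟩ := h
    have h1 : ‖f‖ ^ (2 * (i + 1)) ≤ 4 ^ (i + 1) * ‖g p‖ ^ (2 * (i + 1)) := by
      calc ‖f‖ ^ (2 * (i + 1)) ≤ (2 * ‖g p‖) ^ (2 * (i + 1)) := pow_le_pow_left₀ (norm_nonneg _) hle _
        _ = _ := by
          rw [mul_pow, pow_mul (2 : ℝ)]
          norm_num
    have h2 : ‖g p‖ ^ (2 * (i + 1)) ≤ ∑ p ∈ PP, ‖g p‖ ^ (2 * (i + 1)) :=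
      Finset.single_le_sum (f := fun p => ‖g p‖ ^ (2 * (i + 1))) (fun _ _ => by positivity) hp
    have h3 : ‖f‖ ^ (2 * (i + 1)) ≤ 4 ^ (i + 1) * ∑ p ∈ PP, ‖g p‖ ^ (2 * (i + 1)) :=
      h1.trans (mul_le_mul_of_nonneg_left h2 (by positivity))
    have h4 := mul_le_mul_of_nonneg_left h3 (by positivity : (0 : ℝ) ≤ PP.card)
    have h5 : 0 ≤ 4 * (PP.card : ℝ) ^ (2 * i) * ∑ p ∈ PP, ‖f - g p‖ ^ 2 * ‖g p‖ ^ (2 * i) := by positivity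
    linarith
  · push Not at h
    have h1 : ∀ p ∈ PP, ‖f‖ ^ 2 ≤ 4 * ‖f - g p‖ ^ 2 := by
      intro p hp
      have h2 := h p hp
      have h3 := norm_sub_norm_le f (g p)
      have h4 : ‖f‖ ≤ 2 * ‖f - g p‖ := by linarith
      nlinarith [norm_nonneg f, norm_nonneg (f - g p)]
    have h2 : (PP.card : ℝ) * ‖f‖ ^ (2 * i) ≤ (PP.card : ℝ) ^ (2 * i) * ∑ p ∈ PP, ‖g p‖ ^ (2 * i) := by
      rcases Nat.eq_zero_or_pos i with rfl | hi
      · simp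
      · have h3 : ‖f‖ ^ (2 * i) ≤ (PP.card : ℝ) ^ (2 * i - 1) * ∑ p ∈ PP, ‖g p‖ ^ (2 * i) := by
          have h4 : ‖f‖ ≤ ∑ p ∈ PP, ‖g p‖ := by
            rw [hf]
            exact norm_sum_le _ _
          refine (pow_le_pow_left₀ (norm_nonneg _) h4 _).trans ?_
          have h5 : 2 * i = (2 * i - 1) + 1 := by omega
          rw [h5]
          simp only [Nat.add_sub_cancel]
          exact pow_sum_le_card_mul_sum_pow (fun _ _ => norm_nonneg _) _
        have h6 : (PP.card : ℝ) ^ (2 * i) = PP.card * (PP.card : ℝ) ^ (2 * i - 1) := by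
          rw [← pow_succ']
          congr 1
          omega
        rw [h6, mul_assoc]
        exact mul_le_mul_of_nonneg_left h3 (by positivity)
    have h3 : (PP.card : ℝ) * ‖f‖ ^ (2 * (i + 1)) ≤
        4 * (PP.card : ℝ) ^ (2 * i) * ∑ p ∈ PP, ‖f - g p‖ ^ 2 * ‖g p‖ ^ (2 * i) := by
      calc (PP.card : ℝ) * ‖f‖ ^ (2 * (i + 1)) = ‖f‖ ^ 2 * ((PP.card : ℝ) * ‖f‖ ^ (2 * i)) := by ring
        _ ≤ ‖f‖ ^ 2 * ((PP.card : ℝ) ^ (2 * i) * ∑ p ∈ PP, ‖g p‖ ^ (2 * i)) :=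
          mul_le_mul_of_nonneg_left h2 (by positivity)
        _ = (PP.card : ℝ) ^ (2 * i) * ∑ p ∈ PP, ‖f‖ ^ 2 * ‖g p‖ ^ (2 * i) := by
          rw [← Finset.mul_sum]
          ring
        _ ≤ (PP.card : ℝ) ^ (2 * i) * ∑ p ∈ PP, (4 * ‖f - g p‖ ^ 2) * ‖g p‖ ^ (2 * i) := by
          apply mul_le_mul_of_nonneg_left _ (by positivity)
          exact Finset.sum_le_sum fun p hp => mul_le_mul_of_nonneg_right (h1 p hp) (by positivity)
        _ = _ := by
          simp_rw [mul_assoc]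
          rw [← Finset.mul_sum]
          ring
    have h5 : 0 ≤ PP.card * (4 ^ (i + 1) * ∑ p ∈ PP, ‖g p‖ ^ (2 * (i + 1))) := by positivity
    linarith

/-- One step of the recursion. -/
theorem mean_step (k i : ℕ) (hk : 1 ≤ k) (S PP : Finset ℕ) (hprime : ∀ p ∈ PP, p.Prime)
    (hcop : ∀ p ∈ PP, ∀ x ∈ S, ¬ p ∣ x) (S' : Finset ℕ) (hS' : S' = (PP ×ˢ S).image (fun z => z.1 * z.2))
    (hinj : Set.InjOn (fun z : ℕ × ℕ => z.1 * z.2) (PP ×ˢ S : Finset (ℕ × ℕ)))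
    (hlt : ∀ p ∈ PP, ∀ x ∈ S', x < p ^ k) :
    (PP.card : ℝ) * Jcount k (i + 1) S' ≤
      (4 ^ (i + 1) * (PP.card : ℝ) ^ 2 * (S.card : ℝ) ^ 2 +
        8 * k * (PP.card : ℝ) ^ (2 * i + 1) * S'.card) * Jcount k i S := by
  classical
  set D : ℝ := (PP.card : ℝ) with hD
  set K : ℝ := (Jcount k i S : ℝ) with hK
  have hKi : K = ∫ θ in (0 : ℝ)..1, ‖fX k S θ‖ ^ (2 * i) := Jcount_eq k i S
  let g : ℕ → ℝ → ℂ := fun p θ => fX k S (((p ^ k : ℕ) : ℝ) * θ)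
  have hgc : ∀ p, Continuous (g p) := fun p => (continuous_fX k S).comp (by fun_prop)
  have hfc := continuous_fX k S'
  have hg_eq : ∀ p θ, g p θ = ∑ x ∈ S, ee (θ * ((p * x : ℕ) : ℝ) ^ k) := by
    intro p θ
    simp only [g, fX]
    refine Finset.sum_congr rfl fun x _ => ?_
    congr 1
    push_cast
    ring
  have hf : ∀ θ, fX k S' θ = ∑ p ∈ PP, g p θ := by
    intro θ
    unfold fX
    rw [hS', Finset.sum_image hinj, Finset.sum_product]
    exact Finset.sum_congr rfl fun p _ => (hg_eq p θ).symm
  have hdiff : ∀ p ∈ PP, ∀ θ, fX k S' θ - g p θ = fX k (S'.filter (fun x => ¬ p ∣ x)) θ := by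
    intro p hp θ
    have h1 : g p θ = ∑ x ∈ S'.filter (fun x => p ∣ x), ee (θ * (x : ℝ) ^ k) := by
      rw [hg_eq]
      have h2 : S'.filter (fun x => p ∣ x) = S.image (fun x => p * x) := by
        ext y
        rw [Finset.mem_filter, hS', Finset.mem_image, Finset.mem_image]
        constructor
        · rintro ⟨⟨⟨p', x⟩, hz, rfl⟩, hdvd⟩
          rw [Finset.mem_product] at hz
          simp only at hz hdvd ⊢
          rcases (Nat.Prime.dvd_mul (hprime p hp)).1 hdvd with h3 | h3
          · have : p = p' := (Nat.prime_dvd_prime_iff_eq (hprime p hp) (hprime p' hz.1)).1 h3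
            subst this
            exact ⟨x, hz.2, rfl⟩
          · exact absurd h3 (hcop p hp x hz.2)
        · rintro ⟨x, hx, rfl⟩
          exact ⟨⟨(p, x), Finset.mem_product.2 ⟨hp, hx⟩, rfl⟩, dvd_mul_right _ _⟩
      rw [h2, Finset.sum_image]
      intro x _ y _ hxy
      exact Nat.eq_of_mul_eq_mul_left (hprime p hp).pos hxy
    rw [h1]
    unfold fX
    rw [← Finset.sum_filter_add_sum_filter_not S' (fun x => p ∣ x)]
    ring
  -- first term
  have hterm1 : ∀ p ∈ PP, ∫ θ in (0 : ℝ)..1, ‖g p θ‖ ^ (2 * (i + 1)) ≤ (S.card : ℝ) ^ 2 * K := by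
    intro p hp
    have hpk : 1 ≤ p ^ k := Nat.one_le_pow _ _ (hprime p hp).pos
    have h1 := integral_dilate (fun θ => ‖fX k S θ‖ ^ (2 * (i + 1)))
      (by intro θ; simp only [fX_periodic k S θ]) (by have := continuous_fX k S; fun_prop) (p ^ k) hpk
    simp only [g]
    rw [h1, hKi, ← intervalIntegral.integral_const_mul]
    apply intervalIntegral.integral_mono_on (by norm_num)
    · apply Continuous.intervalIntegrable
      have := continuous_fX k S
      fun_prop
    · apply Continuous.intervalIntegrable
      have := continuous_fX k S
      fun_prop
    · intro θ _
      have h2 : ‖fX k S θ‖ ≤ S.card := by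
        unfold fX
        refine (norm_sum_le _ _).trans (le_of_eq ?_)
        simp [norm_ee]
      have h3 : ‖fX k S θ‖ ^ (2 * (i + 1)) = ‖fX k S θ‖ ^ 2 * ‖fX k S θ‖ ^ (2 * i) := by ring
      rw [h3]
      gcongr
  have hterm2 : ∀ p ∈ PP, ∫ θ in (0 : ℝ)..1, ‖fX k S' θ - g p θ‖ ^ 2 * ‖g p θ‖ ^ (2 * i) ≤
      2 * k * S'.card * K := by
    intro p hp
    have hpk : 1 ≤ p ^ k := Nat.one_le_pow _ _ (hprime p hp).pos
    have h1 := integral_sq_twist_le k (S'.filter (fun x => ¬ p ∣ x)) (fun θ => ‖fX k S θ‖ ^ (2 * i))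
      (by intro θ; simp only [fX_periodic k S θ]) (by have := continuous_fX k S; fun_prop)
      (fun θ => by positivity) (p ^ k) hpk
    rw [← hKi] at h1
    simp_rw [hdiff p hp]
    refine h1.trans ?_
    apply mul_le_mul_of_nonneg_right _ (by positivity)
    have h2 := count_congr_pow k (p ^ k) hpk (S'.filter (fun x => ¬ p ∣ x)) (by
      intro x hx
      rw [Finset.mem_filter] at hx
      exact (((Nat.Prime.coprime_iff_not_dvd (hprime p hp)).2 hx.2).symm).pow_right k) (by
      intro x hx
      rw [Finset.mem_filter] at hx
      exact hlt p hp x hx.1)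
    have h3 := rootsCard_prime_pow k hk p k (hprime p hp)
    have h4 : (S'.filter (fun x => ¬ p ∣ x)).card * rootsCard k (p ^ k) ≤ S'.card * (2 * k) :=
      Nat.mul_le_mul (Finset.card_filter_le _ _) h3
    have h5 := h2.trans h4
    have h6 : ((((S'.filter (fun x => ¬ p ∣ x)) ×ˢ (S'.filter (fun x => ¬ p ∣ x))).filter
      (fun z => ((p ^ k : ℕ) : ℤ) ∣ (z.1 : ℤ) ^ k - (z.2 : ℤ) ^ k)).card : ℝ) ≤ ((S'.card * (2 * k) : ℕ) : ℝ) := by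
      exact_mod_cast h5
    refine h6.trans (le_of_eq ?_)
    push_cast
    ring
  have hmain : D * Jcount k (i + 1) S' ≤ ∫ θ in (0 : ℝ)..1, (D * (4 ^ (i + 1) * ∑ p ∈ PP, ‖g p θ‖ ^ (2 * (i + 1))) +
      4 * D ^ (2 * i) * ∑ p ∈ PP, ‖fX k S' θ - g p θ‖ ^ 2 * ‖g p θ‖ ^ (2 * i)) := by
    rw [Jcount_eq, ← intervalIntegral.integral_const_mul]
    apply intervalIntegral.integral_mono_on (by norm_num)
    · apply Continuous.intervalIntegrable
      fun_prop
    · apply Continuous.intervalIntegrable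
      fun_prop
    · intro θ _
      exact pointwise_ineq i PP (fun p => g p θ) (fX k S' θ) (hf θ)
  refine hmain.trans ?_
  rw [intervalIntegral.integral_add, intervalIntegral.integral_const_mul, intervalIntegral.integral_const_mul,
    intervalIntegral.integral_const_mul, intervalIntegral.integral_finsetSum, intervalIntegral.integral_finsetSum]
  · have h1 := Finset.sum_le_sum hterm1
    have h2 := Finset.sum_le_sum hterm2
    rw [Finset.sum_const, nsmul_eq_mul] at h1 h2
    calc _ ≤ D * (4 ^ (i + 1) * (PP.card * ((S.card : ℝ) ^ 2 * K))) +
          4 * D ^ (2 * i) * (PP.card * (2 * k * S'.card * K)) := by gcongr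
      _ = _ := by
        rw [← hD]
        ring
  · intro p _
    apply Continuous.intervalIntegrable
    have := hgc p
    fun_prop
  · intro p _
    apply Continuous.intervalIntegrable
    have := hgc p
    fun_prop
  · apply Continuous.intervalIntegrable
    fun_prop
  · apply Continuous.intervalIntegrable
    fun_prop

/-- iterated product sets -/
def Xset (PP : ℕ → Finset ℕ) : ℕ → Finset ℕ
  | 0 => {1}
  | i + 1 => (PP i ×ˢ Xset PP i).image (fun z => z.1 * z.2)

theorem Xset_prime_dvd (PP : ℕ → Finset ℕ) (m : ℕ) (hprime : ∀ i < m, ∀ p ∈ PP i, p.Prime) :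
    ∀ i ≤ m, ∀ x ∈ Xset PP i, ∀ p, p.Prime → p ∣ x → ∃ j < i, p ∈ PP j := by
  intro i
  induction i with
  | zero =>
    intro _ x hx p hp hdvd
    simp only [Xset, Finset.mem_singleton] at hx
    subst hx
    exact absurd (Nat.dvd_one.1 hdvd) hp.one_lt.ne'
  | succ i ih =>
    intro hi x hx p hp hdvd
    simp only [Xset, Finset.mem_image, Finset.mem_product] at hx
    obtain ⟨⟨p', y⟩, ⟨hp', hy⟩, rfl⟩ := hx
    simp only at hp' hy hdvd
    rcases (Nat.Prime.dvd_mul hp).1 hdvd with h | h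
    · have : p = p' := (Nat.prime_dvd_prime_iff_eq hp (hprime i (by omega) p' hp')).1 h
      subst this
      exact ⟨i, by omega, hp'⟩
    · obtain ⟨j, hj, hpj⟩ := ih (by omega) y hy p hp h
      exact ⟨j, by omega, hpj⟩

theorem Xset_le (PP : ℕ → Finset ℕ) (m Z : ℕ) (hprime : ∀ i < m, ∀ p ∈ PP i, p.Prime)
    (hZ : ∀ i < m, ∀ p ∈ PP i, p ≤ Z) :
    ∀ i ≤ m, ∀ x ∈ Xset PP i, 1 ≤ x ∧ x ≤ Z ^ i := by
  intro i
  induction i with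
  | zero =>
    intro _ x hx
    simp only [Xset, Finset.mem_singleton] at hx
    subst hx
    simp
  | succ i ih =>
    intro hi x hx
    simp only [Xset, Finset.mem_image, Finset.mem_product] at hx
    obtain ⟨⟨p', y⟩, ⟨hp', hy⟩, rfl⟩ := hx
    simp only at hp' hy ⊢
    obtain ⟨h1, h2⟩ := ih (by omega) y hy
    have h3 := hZ i (by omega) p' hp'
    have h4 := (hprime i (by omega) p' hp').pos
    constructor
    · exact Nat.mul_pos h4 h1
    · rw [pow_succ, mul_comm]
      exact Nat.mul_le_mul h2 h3

/-- The mean value theorem for products of primes. -/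
theorem prime_mean (k m Z D : ℕ) (hk : 1 ≤ k) (hD : 1 ≤ D) (hZ1 : 1 ≤ Z) (PP : ℕ → Finset ℕ)
    (hprime : ∀ i < m, ∀ p ∈ PP i, p.Prime) (hZ : ∀ i < m, ∀ p ∈ PP i, p ≤ Z)
    (hZk : ∀ i < m, ∀ p ∈ PP i, Z ^ m < p ^ k) (hcard : ∀ i < m, (PP i).card = D)
    (hdisj : ∀ i < m, ∀ j < m, i ≠ j → Disjoint (PP i) (PP j)) :
    ∀ i ≤ m, (Xset PP i).card = D ^ i ∧
      (Jcount k i (Xset PP i) : ℝ) ≤ (4 ^ m + 8 * k : ℝ) ^ i * (D : ℝ) ^ (∑ j ∈ Finset.range i, (3 * j + 1)) := by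
  intro i
  induction i with
  | zero =>
    intro _
    constructor
    · simp [Xset]
    · rw [Jcount_eq]
      simp
  | succ i ih =>
    intro hi
    obtain ⟨ih1, ih2⟩ := ih (by omega)
    have hcop : ∀ p ∈ PP i, ∀ x ∈ Xset PP i, ¬ p ∣ x := by
      intro p hp x hx hdvd
      obtain ⟨j, hj, hpj⟩ := Xset_prime_dvd PP m hprime i (by omega) x hx p (hprime i (by omega) p hp) hdvd
      exact Finset.disjoint_left.1 (hdisj i (by omega) j (by omega) (by omega)) hp hpj
    have hinj : Set.InjOn (fun z : ℕ × ℕ => z.1 * z.2) (PP i ×ˢ Xset PP i : Finset (ℕ × ℕ)) := by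
      rintro ⟨p, x⟩ h1 ⟨p', x'⟩ h2 h
      rw [Finset.mem_coe, Finset.mem_product] at h1 h2
      simp only at h1 h2 h
      have hpp := hprime i (by omega) p h1.1
      have hdvd : p ∣ p' * x' := by
        rw [← h]
        exact dvd_mul_right _ _
      rcases (Nat.Prime.dvd_mul hpp).1 hdvd with h3 | h3
      · have : p = p' := (Nat.prime_dvd_prime_iff_eq hpp (hprime i (by omega) p' h2.1)).1 h3
        subst this
        rw [Nat.eq_of_mul_eq_mul_left hpp.pos h]
      · exact absurd h3 (hcop p h1.1 x' h2.2)
    have hc : (Xset PP (i + 1)).card = D ^ (i + 1) := by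
      simp only [Xset]
      rw [Finset.card_image_of_injOn hinj, Finset.card_product, ih1, hcard i (by omega), pow_succ, mul_comm]
    refine ⟨hc, ?_⟩
    have hstep := mean_step k i hk (Xset PP i) (PP i) (hprime i (by omega)) hcop (Xset PP (i + 1)) rfl hinj (by
      intro p hp x hx
      have h1 := (Xset_le PP m Z hprime hZ (i + 1) hi x hx).2
      have h2 : Z ^ (i + 1) ≤ Z ^ m := Nat.pow_le_pow_right hZ1 hi
      exact (h1.trans h2).trans_lt (hZk i (by omega) p hp))
    rw [hc, ih1, hcard i (by omega)] at hstep
    have hDr : (1 : ℝ) ≤ D := by exact_mod_cast hD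
    have h1 : 4 ^ (i + 1) * (D : ℝ) ^ 2 * ((D ^ i : ℕ) : ℝ) ^ 2 + 8 * k * (D : ℝ) ^ (2 * i + 1) * ((D ^ (i + 1) : ℕ) : ℝ)
        ≤ D * ((4 ^ m + 8 * k : ℝ) * (D : ℝ) ^ (3 * i + 1)) := by
      push_cast
      have e1 : 4 ^ (i + 1) * (D : ℝ) ^ 2 * ((D : ℝ) ^ i) ^ 2 = 4 ^ (i + 1) * (D : ℝ) ^ (2 * i + 2) := by ring
      have e2 : 8 * k * (D : ℝ) ^ (2 * i + 1) * (D : ℝ) ^ (i + 1) = 8 * k * (D : ℝ) ^ (3 * i + 2) := by ring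
      rw [e1, e2]
      have h2 : (4 : ℝ) ^ (i + 1) ≤ 4 ^ m := pow_le_pow_right₀ (by norm_num) hi
      have h3 : (D : ℝ) ^ (2 * i + 2) ≤ (D : ℝ) ^ (3 * i + 2) := pow_le_pow_right₀ hDr (by omega)
      calc 4 ^ (i + 1) * (D : ℝ) ^ (2 * i + 2) + 8 * k * (D : ℝ) ^ (3 * i + 2) ≤
          4 ^ m * (D : ℝ) ^ (3 * i + 2) + 8 * k * (D : ℝ) ^ (3 * i + 2) := by gcongr
        _ = _ := by ring
    have h2 : (D : ℝ) * Jcount k (i + 1) (Xset PP (i + 1)) ≤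
        D * ((4 ^ m + 8 * k : ℝ) ^ (i + 1) * (D : ℝ) ^ (∑ j ∈ Finset.range (i + 1), (3 * j + 1))) := by
      refine hstep.trans ?_
      calc _ ≤ D * ((4 ^ m + 8 * k : ℝ) * (D : ℝ) ^ (3 * i + 1)) *
            ((4 ^ m + 8 * k : ℝ) ^ i * (D : ℝ) ^ (∑ j ∈ Finset.range i, (3 * j + 1))) := by gcongr
        _ = _ := by
          rw [Finset.sum_range_succ, pow_add (D : ℝ), pow_succ (4 ^ m + 8 * k : ℝ)]
          ring
    exact le_of_mul_le_mul_left h2 (by positivity)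

theorem sum_3j1 (m : ℕ) : 2 * ∑ j ∈ Finset.range m, (3 * j + 1) + m = 3 * m ^ 2 := by
  induction m with
  | zero => simp
  | succ m ih =>
    rw [Finset.sum_range_succ]
    nlinarith

lemma half_le_floor (x : ℝ) (hx : 1 ≤ x) : x / 2 ≤ (⌊x⌋₊ : ℝ) := by
  have h1 : (1 : ℝ) ≤ (⌊x⌋₊ : ℝ) := by
    have : 1 ≤ ⌊x⌋₊ := (Nat.one_le_floor_iff x).2 hx
    exact_mod_cast this
  have h2 := Nat.lt_floor_add_one x
  linarith

noncomputable def Yseq (q k : ℕ) : ℕ → ℕ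
  | 0 => ⌊(q : ℝ) ^ (1 / (k : ℝ))⌋₊
  | (j + 1) => ⌊((Yseq q k j : ℕ) : ℝ) ^ (1 - 1 / (k : ℝ))⌋₊

lemma one_sub_inv_nonneg (k : ℕ) (hk : 1 ≤ k) : (0 : ℝ) ≤ 1 - 1 / (k : ℝ) := by
  have : (1 : ℝ) ≤ k := by exact_mod_cast hk
  have h : 1 / (k : ℝ) ≤ 1 := by
    rw [div_le_one (by linarith)]; exact this
  linarith

lemma Yseq_one_le (q k : ℕ) (hk : 1 ≤ k) (hq : 1 ≤ q) : ∀ j, 1 ≤ Yseq q k j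
  | 0 => by
    rw [Yseq, Nat.one_le_floor_iff]
    exact Real.one_le_rpow (by exact_mod_cast hq) (by positivity)
  | (j + 1) => by
    rw [Yseq, Nat.one_le_floor_iff]
    exact Real.one_le_rpow (by exact_mod_cast Yseq_one_le q k hk hq j)
      (one_sub_inv_nonneg k hk)

lemma Yseq_step (q k : ℕ) (hk : 1 ≤ k) (j : ℕ) :
    Yseq q k (j + 1) ^ k ≤ Yseq q k j ^ (k - 1) := by
  have h0 : ((Yseq q k (j + 1) : ℕ) : ℝ) ≤ ((Yseq q k j : ℕ) : ℝ) ^ (1 - 1 / (k : ℝ)) := by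
    rw [Yseq]; exact Nat.floor_le (by positivity)
  have hk0 : (k : ℝ) ≠ 0 := by positivity
  have h1 : ((Yseq q k (j + 1) : ℕ) : ℝ) ^ k ≤ ((Yseq q k j : ℕ) : ℝ) ^ (k - 1) := by
    calc ((Yseq q k (j + 1) : ℕ) : ℝ) ^ k
        ≤ (((Yseq q k j : ℕ) : ℝ) ^ (1 - 1 / (k : ℝ))) ^ k := by gcongr
      _ = ((Yseq q k j : ℕ) : ℝ) ^ (k - 1) := by
        rw [← Real.rpow_natCast, ← Real.rpow_mul (by positivity), ← Real.rpow_natCast]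
        congr 1
        rw [Nat.cast_sub hk]
        push_cast
        field_simp
  exact_mod_cast h1

lemma Yseq_zero_pow (q k : ℕ) (hk : 1 ≤ k) : Yseq q k 0 ^ k ≤ q := by
  have hk0 : (k : ℝ) ≠ 0 := by positivity
  have h0 : ((Yseq q k 0 : ℕ) : ℝ) ≤ (q : ℝ) ^ (1 / (k : ℝ)) := by
    rw [Yseq]; exact Nat.floor_le (by positivity)
  have h1 : ((Yseq q k 0 : ℕ) : ℝ) ^ k ≤ (q : ℝ) := by
    calc ((Yseq q k 0 : ℕ) : ℝ) ^ k ≤ ((q : ℝ) ^ (1 / (k : ℝ))) ^ k := by gcongr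
      _ = q := by
        rw [← Real.rpow_natCast, ← Real.rpow_mul (by positivity)]
        rw [one_div_mul_cancel hk0, Real.rpow_one]
  exact_mod_cast h1

lemma Yseq_zero_le (q k : ℕ) : ((Yseq q k 0 : ℕ) : ℝ) ≤ (q : ℝ) ^ (1 / (k : ℝ)) := by
  rw [Yseq]; exact Nat.floor_le (by positivity)

lemma Yseq_le_zero (q k : ℕ) (hk : 1 ≤ k) (hq : 1 ≤ q) : ∀ j, Yseq q k j ≤ Yseq q k 0
  | 0 => le_rfl
  | (j + 1) => by
    refine le_trans ?_ (Yseq_le_zero q k hk hq j)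
    rw [Yseq]
    have h1 : (1 : ℝ) ≤ (Yseq q k j : ℝ) := by exact_mod_cast Yseq_one_le q k hk hq j
    have : ((Yseq q k j : ℕ) : ℝ) ^ (1 - 1 / (k : ℝ)) ≤ (Yseq q k j : ℝ) := by
      conv_rhs => rw [← Real.rpow_one ((Yseq q k j : ℕ) : ℝ)]
      apply Real.rpow_le_rpow_of_exponent_le h1
      have : (0 : ℝ) ≤ 1 / (k : ℝ) := by positivity
      linarith
    exact Nat.floor_le_of_le this

lemma Yseq_lower (q k : ℕ) (hk : 1 ≤ k) (hq : 1 ≤ q) (j : ℕ) :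
    (q : ℝ) ^ ((1 / (k : ℝ)) * (1 - 1 / (k : ℝ)) ^ j) ≤ 2 ^ (j + 1) * (Yseq q k j : ℝ) := by
  have hθ := one_sub_inv_nonneg k hk
  have hθ1 : (1 - 1 / (k : ℝ)) ≤ 1 := by
    have : (0 : ℝ) ≤ 1 / (k : ℝ) := by positivity
    linarith
  have hq1 : (1 : ℝ) ≤ q := by exact_mod_cast hq
  induction j with
  | zero =>
    have := half_le_floor ((q : ℝ) ^ (1 / (k : ℝ))) (Real.one_le_rpow hq1 (by positivity))
    rw [Yseq]
    simp only [pow_zero, mul_one, zero_add, pow_one]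
    linarith
  | succ j ih =>
    have hy1 : (1 : ℝ) ≤ (Yseq q k j : ℝ) := by exact_mod_cast Yseq_one_le q k hk hq j
    have h := half_le_floor (((Yseq q k j : ℕ) : ℝ) ^ (1 - 1 / (k : ℝ)))
      (Real.one_le_rpow hy1 hθ)
    rw [Yseq]
    calc (q : ℝ) ^ ((1 / (k : ℝ)) * (1 - 1 / (k : ℝ)) ^ (j + 1))
        = ((q : ℝ) ^ ((1 / (k : ℝ)) * (1 - 1 / (k : ℝ)) ^ j)) ^ (1 - 1 / (k : ℝ)) := by
          rw [← Real.rpow_mul (by positivity)]; ring_nf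
      _ ≤ (2 ^ (j + 1) * (Yseq q k j : ℝ)) ^ (1 - 1 / (k : ℝ)) := by
          gcongr
      _ = ((2 : ℝ) ^ (j + 1)) ^ (1 - 1 / (k : ℝ)) * (Yseq q k j : ℝ) ^ (1 - 1 / (k : ℝ)) := by
          rw [Real.mul_rpow (by positivity) (by positivity)]
      _ ≤ (2 : ℝ) ^ (j + 1) * (Yseq q k j : ℝ) ^ (1 - 1 / (k : ℝ)) := by
          gcongr
          conv_rhs => rw [← Real.rpow_one ((2 : ℝ) ^ (j + 1))]
          exact Real.rpow_le_rpow_of_exponent_le (one_le_pow₀ (by norm_num)) hθ1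
      _ ≤ _ := by
          rw [pow_succ _ (j + 1), mul_assoc]
          gcongr
          linarith

lemma Yseq_prod (q k : ℕ) (hk : 1 ≤ k) (hq : 1 ≤ q) (s : ℕ) :
    (q : ℝ) ^ (1 - (1 - 1 / (k : ℝ)) ^ s) ≤
      2 ^ (s * (s + 1)) * ∏ j : Fin s, (Yseq q k j : ℝ) := by
  have hq1 : (0 : ℝ) < q := by exact_mod_cast hq
  rw [Fin.prod_univ_eq_prod_range (fun j => (Yseq q k j : ℝ))]
  have h1 : ∏ j ∈ Finset.range s, (q : ℝ) ^ ((1 / (k : ℝ)) * (1 - 1 / (k : ℝ)) ^ j) ≤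
      ∏ j ∈ Finset.range s, (2 ^ (s + 1) * (Yseq q k j : ℝ)) := by
    apply Finset.prod_le_prod
    · intros; positivity
    · intro j hj
      refine (Yseq_lower q k hk hq j).trans ?_
      have := Finset.mem_range.1 hj
      gcongr
      norm_num
  rw [Finset.prod_mul_distrib, Finset.prod_const, Finset.card_range, ← pow_mul,
    mul_comm (s + 1) s] at h1
  refine le_trans (le_of_eq ?_) h1
  rw [← Real.rpow_sum_of_pos hq1, ← Finset.mul_sum]
  congr 1
  have hk0 : (k : ℝ) ≠ 0 := by positivity
  have := mul_neg_geom_sum (1 - 1 / (k : ℝ)) s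
  rw [← this]; ring

/-- the main inequality with the explicit sequence -/
lemma core_G (k s t : ℕ) (hk : 1 ≤ k) (hs : 1 ≤ s) (ht : 1 ≤ t) :
    ∃ C : ℝ, 0 < C ∧ ∀ (a : ℤ) (q : ℕ) (_ : 1 ≤ q) (α : ℝ) (H : ℕ) (_ : 1 ≤ H)
      (𝒳 : Finset ℕ) (E : ℝ) (_ : 0 ≤ E)
      (_ : ∀ c : ℕ → ℂ, (∀ x, ‖c x‖ ≤ 1) →
        ∑ v ∈ Finset.range q, ‖gin a q k 𝒳 c (v : ℤ)‖ ^ (2 * t) ≤ q * E)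
      (w : ℤ → ℝ) (_ : ∀ h, |w h| ≤ 1)
      (_ : ∀ x ∈ 𝒳, ∀ y : ℕ, 1 ≤ y → (y : ℝ) ≤ 2 * (q : ℝ) ^ (1 / (k : ℝ)) →
        (∑ h ∈ hset H, (w h : ℂ) * ee (h * theta a q k α x y)).re ≤ -(1 / 2)),
      (𝒳.card : ℝ) ^ (2 * t) ≤ C * ((H : ℝ) ^ (2 * t * s + 2) * (1 + Real.log H) ^ s *
        (q : ℝ) ^ (1 / (k : ℝ) + (1 - 1 / (k : ℝ)) ^ s) * E) := by
  refine ⟨2 ^ (s * (s + 1)) * (2 ^ (2 * t * s) * 2 ^ (s * (2 * t - 1)) * (2 ^ (k + 2) * s * 2) ^ s *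
    ((4 * s + 1) * (2 * s * 2 ^ k + 1))), by positivity, ?_⟩
  intro a q hq α H hH 𝒳 E hE0 hE w hw hlow
  have hq0 : (0 : ℝ) < q := by exact_mod_cast hq
  have hH1 : (1 : ℝ) ≤ H := by exact_mod_cast hH
  have hlog : 0 ≤ Real.log H := Real.log_nonneg hH1
  have hY1 := Yseq_one_le q k hk hq
  have h := G_ineq a q k hk hq α (Yseq q k) hY1 (Yseq_step q k hk) s H t
    (s * H * 2 ^ k) hs hH ht (by
      rw [mul_pow, ← mul_assoc]
      exact Nat.mul_le_mul_left _ (Yseq_zero_pow q k hk)) 𝒳 E hE w hw (by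
      intro x hx j y hy
      rw [Finset.mem_Ioc] at hy
      refine hlow x hx y (by omega) ?_
      have h1 : y ≤ 2 * Yseq q k 0 := hy.2.trans (Nat.mul_le_mul_left _ (Yseq_le_zero q k hk hq j))
      have h2 : (y : ℝ) ≤ 2 * (Yseq q k 0 : ℝ) := by exact_mod_cast h1
      have := Yseq_zero_le q k
      linarith)
  have hp := Yseq_prod q k hk hq s
  set Pr := ∏ j : Fin s, (Yseq q k j : ℝ) with hPr
  set W := (1 - 1 / (k : ℝ)) ^ s with hW
  have hY0 := Yseq_zero_le q k
  have hqk1 : (1 : ℝ) ≤ (q : ℝ) ^ (1 / (k : ℝ)) :=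
    Real.one_le_rpow (by exact_mod_cast hq) (by positivity)
  have hsH : (1 : ℝ) ≤ s := by exact_mod_cast hs
  have e1 : (4 * (s : ℝ) * H * (Yseq q k 0 : ℝ) + 1) ≤ (4 * s + 1) * (H * (q : ℝ) ^ (1 / (k : ℝ))) := by
    have : (4 * (s : ℝ) * H * (Yseq q k 0 : ℝ)) ≤ 4 * s * H * (q : ℝ) ^ (1 / (k : ℝ)) := by gcongr
    nlinarith [one_le_mul_of_one_le_of_one_le hH1 hqk1]
  have e2 : (2 * ((s * H * 2 ^ k : ℕ) : ℝ) + 1) ≤ (2 * s * 2 ^ k + 1) * H := by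
    push_cast; nlinarith
  have e3 : (q : ℝ) ^ (1 - W) * (𝒳.card : ℝ) ^ (2 * t) ≤ 2 ^ (s * (s + 1)) * (
      2 ^ (2 * t * s) * (2 * (H : ℝ)) ^ (s * (2 * t - 1)) *
      (2 ^ (k + 2) * s * H * (2 * (1 + Real.log H))) ^ s *
      (((4 * s + 1) * (H * (q : ℝ) ^ (1 / (k : ℝ)))) * (((2 * s * 2 ^ k + 1) * H) * (q * E)))) := by
    calc (q : ℝ) ^ (1 - W) * (𝒳.card : ℝ) ^ (2 * t)
        ≤ (2 ^ (s * (s + 1)) * Pr) * (𝒳.card : ℝ) ^ (2 * t) := by gcongr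
      _ = 2 ^ (s * (s + 1)) * ((𝒳.card : ℝ) ^ (2 * t) * Pr) := by ring
      _ ≤ _ := by
        refine mul_le_mul_of_nonneg_left (h.trans ?_) (by positivity)
        gcongr
  have e4 : (q : ℝ) ^ (1 / (k : ℝ)) * q = (q : ℝ) ^ (1 - W) * (q : ℝ) ^ (1 / (k : ℝ) + W) := by
    rw [← Real.rpow_add hq0]
    nth_rewrite 2 [← Real.rpow_one (q : ℝ)]
    rw [← Real.rpow_add hq0]; ring_nf
  have hpos : 0 < (q : ℝ) ^ (1 - W) := by positivity
  refine le_of_mul_le_mul_left (e3.trans (le_of_eq ?_)) hpos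
  have e5 : (H : ℝ) ^ (2 * t * s + 2) = H ^ (s * (2 * t - 1)) * H ^ s * H * H := by
    rw [← pow_add, ← pow_succ, ← pow_succ]
    congr 1
    obtain ⟨t, rfl⟩ : ∃ t', t = t' + 1 := ⟨t - 1, by omega⟩
    have : 2 * (t + 1) - 1 = 2 * t + 1 := by omega
    rw [this]; ring
  rw [e5, mul_pow 2 (H : ℝ)]
  have e6 : (2 ^ (k + 2) * (s : ℝ) * H * (2 * (1 + Real.log H))) ^ s =
      (2 ^ (k + 2) * s * 2) ^ s * (H ^ s * (1 + Real.log H) ^ s) := by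
    rw [← mul_pow, ← mul_pow]; congr 1; ring
  rw [e6]
  linear_combination (2 ^ (s * (s + 1)) * (2 ^ (2 * t * s) * (2 ^ (s * (2 * t - 1)) * (H:ℝ) ^ (s * (2 * t - 1))) *
      ((2 ^ (k + 2) * s * 2) ^ s * (H ^ s * (1 + Real.log H) ^ s)) * ((4 * s + 1) * H * ((2 * s * 2 ^ k + 1) * H) * E))) * e4

lemma ev_rpow (C κ : ℝ) (hκ : 0 < κ) : ∃ N₀ : ℕ, ∀ N : ℕ, N₀ ≤ N → C ≤ (N : ℝ) ^ κ := by
  have h := (tendsto_rpow_atTop hκ).comp (tendsto_natCast_atTop_atTop (R := ℝ))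
  have h2 := (Filter.tendsto_atTop.1 h) C
  exact Filter.eventually_atTop.1 h2

lemma one_add_log_le (ν x : ℝ) (hν : 0 < ν) (hx : 1 ≤ x) :
    1 + Real.log x ≤ (1 + 1 / ν) * x ^ ν := by
  have h1 := Real.log_le_rpow_div (by linarith : (0:ℝ) ≤ x) hν
  have h2 : 1 ≤ x ^ ν := Real.one_le_rpow hx hν.le
  have : (1 + 1 / ν) * x ^ ν = x ^ ν + x ^ ν / ν := by ring
  linarith

lemma core_N (k s t : ℕ) (hk : 1 ≤ k) (hs : 1 ≤ s) (ht : 1 ≤ t) (ρ κ : ℝ) (hρ : 0 < ρ)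
    (hκ : 0 < κ) :
    ∃ C : ℝ, 0 < C ∧ ∃ N₀ : ℕ, ∀ N : ℕ, N₀ ≤ N → ∀ (α₁ αk : ℝ)
      (_ : ∀ n : ℕ, 1 ≤ n → n ≤ N →
        (N : ℝ) ^ (-ρ) < nearestIntDist (αk * (n : ℝ) ^ k + α₁ * (n : ℝ)))
      (a : ℤ) (q : ℕ) (_ : 1 ≤ q) (𝒳 : Finset ℕ) (E : ℝ) (_ : 0 ≤ E)
      (_ : ∀ c : ℕ → ℂ, (∀ x, ‖c x‖ ≤ 1) →
        ∑ v ∈ Finset.range q, ‖gin a q k 𝒳 c (v : ℤ)‖ ^ (2 * t) ≤ q * E)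
      (_ : ∀ x ∈ 𝒳, 1 ≤ x ∧ (x : ℝ) * (2 * (q : ℝ) ^ (1 / (k : ℝ))) ≤ N ∧
        |αk - (a : ℝ) / q| * ((x : ℝ) * (2 * (q : ℝ) ^ (1 / (k : ℝ)))) ^ k ≤ (N : ℝ) ^ (-ρ) / 2),
      (𝒳.card : ℝ) ^ (2 * t) ≤ C * ((N : ℝ) ^ ((ρ + κ) * (2 * t * s + 2) + κ) *
        (q : ℝ) ^ (1 / (k : ℝ) + (1 - 1 / (k : ℝ)) ^ s) * E) := by
  obtain ⟨C, hC, hcore⟩ := core_G k s t hk hs ht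
  obtain ⟨m, hm⟩ := exists_nat_ge ((ρ + κ) / κ + 1)
  have hm1 : (1 : ℝ) ≤ m := by
    have : 0 < (ρ + κ) / κ := by positivity
    linarith
  have hm0 : 0 < m := by
    have : (0 : ℝ) < m := by linarith
    exact_mod_cast this
  have hmκ : ρ + κ + κ ≤ m * κ := by
    have : (ρ + κ) / κ + 1 = (ρ + κ + κ) / κ := by field_simp
    rw [this, div_le_iff₀ hκ] at hm
    exact hm
  obtain ⟨N₁, hN₁⟩ := ev_rpow (8 * m) κ hκ
  set ν : ℝ := κ / (s * (ρ + κ)) with hν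
  have hs0 : (0 : ℝ) < s := by exact_mod_cast hs
  have hν0 : 0 < ν := by positivity
  refine ⟨C * ((2 * m) ^ (2 * t * s + 2) * ((1 + 1 / ν) * (2 * m) ^ ν) ^ s), by positivity,
    max N₁ 1, ?_⟩
  intro N hN α₁ αk hbad a q hq 𝒳 E hE0 hE hX
  have hN1 : 1 ≤ N := (le_max_right _ _).trans hN
  have hN1r : (1 : ℝ) ≤ N := by exact_mod_cast hN1
  have hN0 : (0 : ℝ) < N := by linarith
  have h8 := hN₁ N ((le_max_left _ _).trans hN)
  set T := (N : ℝ) ^ (ρ + κ) with hT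
  have hT1 : 1 ≤ T := Real.one_le_rpow hN1r (by positivity)
  set L := ⌈T⌉₊ with hL
  have hLT : T ≤ L := Nat.le_ceil _
  have hL2 : (L : ℝ) ≤ 2 * T := by
    have := Nat.ceil_lt_add_one (by linarith : (0:ℝ) ≤ T)
    linarith
  have hL0 : 0 < L := by
    have : (0 : ℝ) < L := by linarith
    exact_mod_cast this
  have hδ : 0 < (N : ℝ) ^ (-ρ) / 2 := by positivity
  obtain ⟨w, hw, hker⟩ := kernel m L hm0 hL0 ((N : ℝ) ^ (-ρ) / 2) hδ (by
    have h1 : (N : ℝ) ^ κ ≤ 2 * ((N : ℝ) ^ (-ρ) / 2) * L := by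
      calc (N : ℝ) ^ κ = (N : ℝ) ^ (-ρ) * T := by
            rw [hT, ← Real.rpow_add hN0]; ring_nf
        _ ≤ (N : ℝ) ^ (-ρ) * L := by gcongr
        _ = _ := by ring
    calc 4 * (m : ℝ) * L ≤ 4 * m * (2 * T) := by gcongr
      _ = 8 * m * T := by ring
      _ ≤ (N : ℝ) ^ κ * T := by gcongr
      _ = (N : ℝ) ^ (ρ + κ + κ) := by rw [hT, ← Real.rpow_add hN0]; ring_nf
      _ ≤ (N : ℝ) ^ (κ * (2 * m : ℕ)) := by
          apply Real.rpow_le_rpow_of_exponent_le hN1r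
          push_cast
          have : 0 < (m : ℝ) * κ := by positivity
          nlinarith
      _ = ((N : ℝ) ^ κ) ^ (2 * m) := by rw [Real.rpow_mul_natCast (by positivity)]
      _ ≤ _ := by gcongr)
  have hH1 : 1 ≤ m * L := Nat.mul_pos hm0 hL0
  have hHr : (1 : ℝ) ≤ ((m * L : ℕ) : ℝ) := by exact_mod_cast hH1
  have hHT : ((m * L : ℕ) : ℝ) ≤ 2 * m * T := by push_cast; nlinarith
  have h := hcore a q hq α₁ (m * L) hH1 𝒳 E hE0 hE w hw (by
    intro x hx y hy1 hy
    obtain ⟨hx1, hxN, hxe⟩ := hX x hx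
    apply hker
    have hxy : (x : ℝ) * y ≤ x * (2 * (q : ℝ) ^ (1 / (k : ℝ))) := by gcongr
    have hn : x * y ≤ N := by
      have : ((x * y : ℕ) : ℝ) ≤ N := by push_cast; linarith
      exact_mod_cast this
    have hb := hbad (x * y) (Nat.mul_pos hx1 hy1) hn
    have he : αk * ((x * y : ℕ) : ℝ) ^ k + α₁ * ((x * y : ℕ) : ℝ) =
        theta a q k α₁ x y + (αk - (a : ℝ) / q) * ((x : ℝ) * y) ^ k := by
      rw [theta]; push_cast; ring
    rw [he] at hb
    have h2 := nearestIntDist_add_le (theta a q k α₁ x y) ((αk - (a : ℝ) / q) * ((x : ℝ) * y) ^ k)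
    have h3 : |(αk - (a : ℝ) / q) * ((x : ℝ) * y) ^ k| ≤ (N : ℝ) ^ (-ρ) / 2 := by
      rw [abs_mul, abs_of_nonneg (by positivity : (0:ℝ) ≤ ((x : ℝ) * y) ^ k)]
      refine le_trans ?_ hxe
      gcongr
    linarith)
  refine h.trans ?_
  have hq0 : (0 : ℝ) < q := by exact_mod_cast hq
  have hlogH : 0 ≤ Real.log ((m * L : ℕ) : ℝ) := Real.log_nonneg hHr
  have hl : (1 + Real.log ((m * L : ℕ) : ℝ)) ^ s ≤
      ((1 + 1 / ν) * (2 * m) ^ ν) ^ s * (N : ℝ) ^ κ := by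
    have h1 : 1 + Real.log ((m * L : ℕ) : ℝ) ≤ ((1 + 1 / ν) * (2 * m) ^ ν) * T ^ ν := by
      refine (one_add_log_le ν _ hν0 hHr).trans ?_
      rw [mul_assoc, ← Real.mul_rpow (by positivity) (by positivity)]
      gcongr
    calc (1 + Real.log ((m * L : ℕ) : ℝ)) ^ s ≤ (((1 + 1 / ν) * (2 * m) ^ ν) * T ^ ν) ^ s := by
          gcongr
      _ = _ := by
          rw [mul_pow]; congr 1
          rw [← Real.rpow_mul_natCast (by positivity), hT, ← Real.rpow_mul (by positivity)]
          congr 1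
          rw [hν]; field_simp
  have hp : ((m * L : ℕ) : ℝ) ^ (2 * t * s + 2) ≤
      (2 * m) ^ (2 * t * s + 2) * (N : ℝ) ^ ((ρ + κ) * (2 * t * s + 2)) := by
    calc ((m * L : ℕ) : ℝ) ^ (2 * t * s + 2) ≤ (2 * m * T) ^ (2 * t * s + 2) := by gcongr
      _ = _ := by
        rw [mul_pow]; congr 1
        rw [hT, ← Real.rpow_mul_natCast (by positivity)]
        push_cast; rfl
  calc _ ≤ C * (((2 * m) ^ (2 * t * s + 2) * (N : ℝ) ^ ((ρ + κ) * (2 * t * s + 2))) *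
        (((1 + 1 / ν) * (2 * m) ^ ν) ^ s * (N : ℝ) ^ κ) *
        (q : ℝ) ^ (1 / (k : ℝ) + (1 - 1 / (k : ℝ)) ^ s) * E) := by
        gcongr
    _ = _ := by rw [Real.rpow_add hN0]; ring

lemma pi_lower (κ : ℝ) (hκ : 0 < κ) :
    ∃ Z₀ : ℕ, ∀ Z : ℕ, Z₀ ≤ Z → (Z : ℝ) ^ (1 - κ) ≤ (Nat.primeCounting Z : ℝ) := by
  obtain ⟨N₁, hN₁⟩ := ev_rpow 12 (1 / 2) (by norm_num)
  obtain ⟨N₂, hN₂⟩ := ev_rpow (4 * (1 + 1 / (κ / 2))) (κ / 2) (by positivity)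
  refine ⟨max (max N₁ N₂) 2, fun Z hZ => ?_⟩
  have h1 := hN₁ Z (((le_max_left _ _).trans (le_max_left _ _)).trans hZ)
  have h2 := hN₂ Z (((le_max_right _ _).trans (le_max_left _ _)).trans hZ)
  have hZ2 : (2 : ℝ) ≤ Z := by exact_mod_cast (le_max_right _ _).trans hZ
  have hZ0 : (0 : ℝ) < Z := by linarith
  refine le_trans ?_ (Chebyshev.pi_ge Z)
  have hlog : 0 < Real.log Z := Real.log_pos (by linarith)
  rw [le_div_iff₀ hlog]
  have hl2 := Real.log_two_gt_d9
  have hl2' := Real.log_two_lt_d9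
  have h3 : Real.log ((Z : ℝ) + 1) ≤ Z / 4 := by
    have e1 : Real.log ((Z : ℝ) + 1) ≤ Real.log (2 * Z) := Real.log_le_log (by linarith) (by linarith)
    rw [Real.log_mul (by norm_num) (by linarith)] at e1
    have e2 := one_add_log_le (1 / 2) Z (by norm_num) (by linarith)
    have e3 : (Z : ℝ) ^ (1 / 2 : ℝ) * (Z : ℝ) ^ (1 / 2 : ℝ) = Z := by
      rw [← Real.rpow_add hZ0]; norm_num
    norm_num at e2 e3 h1 ⊢
    nlinarith
  have h4 := one_add_log_le (κ / 2) Z (by positivity) (by linarith)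
  have h5 : (Z : ℝ) ^ (1 - κ) * ((Z : ℝ) ^ (κ / 2) * (Z : ℝ) ^ (κ / 2)) = Z := by
    rw [← Real.rpow_add hZ0, ← Real.rpow_add hZ0]
    conv_rhs => rw [← Real.rpow_one (Z : ℝ)]
    congr 1; ring
  have hp : 0 < (Z : ℝ) ^ (1 - κ) := by positivity
  have hp2 : 0 < (Z : ℝ) ^ (κ / 2) := by positivity
  have h6 : (Z : ℝ) ^ (1 - κ) * Real.log Z ≤ Z / 4 := by
    calc (Z : ℝ) ^ (1 - κ) * Real.log Z ≤
        (Z : ℝ) ^ (1 - κ) * (((Z : ℝ) ^ (κ / 2) / 4) * (Z : ℝ) ^ (κ / 2)) := by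
          gcongr
          have : (1 + 1 / (κ / 2)) * (Z : ℝ) ^ (κ / 2) ≤ ((Z : ℝ) ^ (κ / 2) / 4) * (Z : ℝ) ^ (κ / 2) := by
            gcongr; linarith
          linarith
      _ = Z / 4 := by linear_combination h5 / 4
  nlinarith

lemma card_primesLE (Z : ℕ) : ((Finset.Icc 1 Z).filter Nat.Prime).card = Nat.primeCounting Z := by
  rw [Nat.primeCounting, Nat.primeCounting', Nat.count_eq_card_filter_range]
  congr 1
  ext p
  simp only [Finset.mem_filter, Finset.mem_Icc, Finset.mem_range]
  constructor
  · rintro ⟨⟨_, h⟩, hp⟩; exact ⟨by omega, hp⟩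
  · rintro ⟨h, hp⟩; exact ⟨⟨hp.one_le, by omega⟩, hp⟩

lemma split_parts (D m : ℕ) : ∀ S : Finset ℕ, m * D ≤ S.card → ∃ PP : ℕ → Finset ℕ,
    (∀ i < m, PP i ⊆ S) ∧ (∀ i < m, (PP i).card = D) ∧
    (∀ i < m, ∀ j < m, i ≠ j → Disjoint (PP i) (PP j)) := by
  induction m with
  | zero => exact fun S _ => ⟨fun _ => ∅, by simp, by simp, by simp⟩
  | succ m ih =>
    intro S hS
    obtain ⟨T, hTS, hT⟩ := Finset.exists_subset_card_eq (show D ≤ S.card by nlinarith)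
    obtain ⟨PP, h1, h2, h3⟩ := ih (S \ T) (by
      rw [Finset.card_sdiff_of_subset hTS, hT]
      have : (m + 1) * D = m * D + D := by ring
      omega)
    have hd : ∀ i < m, Disjoint (PP i) T := fun i hi =>
      Finset.disjoint_of_subset_left (h1 i hi) Finset.sdiff_disjoint
    refine ⟨fun i => if i = m then T else PP i, ?_, ?_, ?_⟩
    · intro i hi
      by_cases h : i = m
      · simp [h, hTS]
      · simp only [h, if_false]
        exact (h1 i (by omega)).trans Finset.sdiff_subset
    · intro i hi
      by_cases h : i = m
      · simp [h, hT]
      · simp only [h, if_false]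
        exact h2 i (by omega)
    · intro i hi j hj hij
      by_cases h : i = m
      · have h' : j ≠ m := by omega
        simp only [h, h', if_true, if_false]
        exact (hd j (by omega)).symm
      · by_cases h' : j = m
        · simp only [h, h', if_true, if_false]
          exact hd i (by omega)
        · simp only [h, h', if_false]
          exact h3 i (by omega) j (by omega) hij

lemma prime_parts (k : ℕ) (hk : 2 ≤ k) (κ : ℝ) (hκ : 0 < κ) (hκ1 : κ ≤ 1) :
    ∃ Z₀ : ℕ, ∀ Z : ℕ, Z₀ ≤ Z → ∃ (D : ℕ) (PP : ℕ → Finset ℕ), (Z : ℝ) ^ (1 - κ) ≤ D ∧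
      (∀ i < k - 1, ∀ p ∈ PP i, p.Prime) ∧ (∀ i < k - 1, ∀ p ∈ PP i, p ≤ Z) ∧
      (∀ i < k - 1, ∀ p ∈ PP i, Z ^ (k - 1) < p ^ k) ∧
      (∀ i < k - 1, (PP i).card = D) ∧
      (∀ i < k - 1, ∀ j < k - 1, i ≠ j → Disjoint (PP i) (PP j)) := by
  have hk0 : (0 : ℝ) < k := by positivity
  set κ' := min (κ / 2) (1 / (2 * (k : ℝ))) with hκ'
  have hκ'0 : 0 < κ' := lt_min (by positivity) (by positivity)
  have hκ'1 : κ' ≤ κ / 2 := min_le_left _ _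
  have hκ'2 : κ' ≤ 1 / (2 * (k : ℝ)) := min_le_right _ _
  have hk2 : 1 / (2 * (k : ℝ)) < 1 / (k : ℝ) := by
    apply one_div_lt_one_div_of_lt hk0; linarith
  obtain ⟨N₁, hN₁⟩ := ev_rpow 2 (1 / (k : ℝ) - κ') (by linarith)
  obtain ⟨N₂, hN₂⟩ := ev_rpow (4 * k) (κ - κ') (by linarith)
  obtain ⟨N₃, hN₃⟩ := pi_lower κ' hκ'0
  refine ⟨max (max N₁ N₂) (max N₃ 1), fun Z hZ => ?_⟩
  have h1 := hN₁ Z (((le_max_left _ _).trans (le_max_left _ _)).trans hZ)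
  have h2 := hN₂ Z (((le_max_right _ _).trans (le_max_left _ _)).trans hZ)
  have h3 := hN₃ Z (((le_max_left _ _).trans (le_max_right _ _)).trans hZ)
  have hZ1 : (1 : ℝ) ≤ Z := by
    exact_mod_cast ((le_max_right _ _).trans (le_max_right _ _)).trans hZ
  have hZ0 : (0 : ℝ) < Z := by linarith
  set S := ((Finset.Icc 1 Z).filter Nat.Prime).filter (fun p => Z ^ (k - 1) < p ^ k) with hS
  set D := ⌈(Z : ℝ) ^ (1 - κ)⌉₊ with hD
  have hD1 : (Z : ℝ) ^ (1 - κ) ≤ D := Nat.le_ceil _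
  have hz1 : 1 ≤ (Z : ℝ) ^ (1 - κ) := Real.one_le_rpow hZ1 (by linarith)
  have hD2 : (D : ℝ) ≤ 2 * (Z : ℝ) ^ (1 - κ) := by
    have := Nat.ceil_lt_add_one (by linarith : (0:ℝ) ≤ (Z : ℝ) ^ (1 - κ))
    linarith
  have hbad : ((((Finset.Icc 1 Z).filter Nat.Prime).filter
      (fun p => ¬ Z ^ (k - 1) < p ^ k)).card : ℝ) ≤ (Z : ℝ) ^ (1 - 1 / (k : ℝ)) := by
    have hsub : ((Finset.Icc 1 Z).filter Nat.Prime).filter (fun p => ¬ Z ^ (k - 1) < p ^ k) ⊆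
        Finset.Icc 1 ⌊(Z : ℝ) ^ (1 - 1 / (k : ℝ))⌋₊ := by
      intro p hp
      simp only [Finset.mem_filter, Finset.mem_Icc, not_lt] at hp ⊢
      refine ⟨hp.1.1.1, Nat.le_floor ?_⟩
      have hpk : (p : ℝ) ^ k ≤ (Z : ℝ) ^ (k - 1) := by exact_mod_cast hp.2
      have : ((Z : ℝ) ^ (1 - 1 / (k : ℝ))) ^ k = (Z : ℝ) ^ (k - 1) := by
        rw [← Real.rpow_mul_natCast (by positivity), ← Real.rpow_natCast]
        congr 1
        rw [Nat.cast_sub (by omega)]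
        push_cast
        field_simp
      rw [← this] at hpk
      exact le_of_pow_le_pow_left₀ (by omega) (by positivity) hpk
    have := Finset.card_le_card hsub
    rw [Nat.card_Icc, Nat.add_sub_cancel] at this
    calc _ ≤ ((⌊(Z : ℝ) ^ (1 - 1 / (k : ℝ))⌋₊ : ℕ) : ℝ) := by exact_mod_cast this
      _ ≤ _ := Nat.floor_le (by positivity)
  have hcard : S.card + (((Finset.Icc 1 Z).filter Nat.Prime).filter
      (fun p => ¬ Z ^ (k - 1) < p ^ k)).card = Nat.primeCounting Z := by
    rw [← card_primesLE, hS]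
    exact Finset.card_filter_add_card_filter_not _
  have hcard' : (S.card : ℝ) + ((((Finset.Icc 1 Z).filter Nat.Prime).filter
      (fun p => ¬ Z ^ (k - 1) < p ^ k)).card : ℝ) = Nat.primeCounting Z := by exact_mod_cast hcard
  have e1 : 2 * (Z : ℝ) ^ (1 - 1 / (k : ℝ)) ≤ (Z : ℝ) ^ (1 - κ') := by
    calc 2 * (Z : ℝ) ^ (1 - 1 / (k : ℝ)) ≤ (Z : ℝ) ^ (1 / (k : ℝ) - κ') * (Z : ℝ) ^ (1 - 1 / (k : ℝ)) := by
          gcongr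
      _ = _ := by rw [← Real.rpow_add hZ0]; ring_nf
  have e2 : 4 * k * (Z : ℝ) ^ (1 - κ) ≤ (Z : ℝ) ^ (1 - κ') := by
    calc 4 * k * (Z : ℝ) ^ (1 - κ) ≤ (Z : ℝ) ^ (κ - κ') * (Z : ℝ) ^ (1 - κ) := by
          gcongr
      _ = _ := by rw [← Real.rpow_add hZ0]; ring_nf
  have hkD : (k - 1) * D ≤ S.card := by
    have e3 : (k : ℝ) * D ≤ S.card := by
      have : (k : ℝ) * D ≤ k * (2 * (Z : ℝ) ^ (1 - κ)) := by gcongr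
      linarith
    have e4 : k * D ≤ S.card := by exact_mod_cast e3
    exact (Nat.mul_le_mul_right _ (Nat.sub_le _ _)).trans e4
  obtain ⟨PP, g1, g2, g3⟩ := split_parts D (k - 1) S hkD
  have hmem : ∀ i < k - 1, ∀ p ∈ PP i, p.Prime ∧ p ≤ Z ∧ Z ^ (k - 1) < p ^ k := by
    intro i hi p hp
    have := g1 i hi hp
    simp only [hS, Finset.mem_filter, Finset.mem_Icc] at this
    exact ⟨this.1.2, this.1.1.2, this.2⟩
  exact ⟨D, PP, hD1, fun i hi p hp => (hmem i hi p hp).1, fun i hi p hp => (hmem i hi p hp).2.1,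
    fun i hi p hp => (hmem i hi p hp).2.2, g2, g3⟩

lemma card_primeFactors_log (q : ℕ) (hq : 1 ≤ q) :
    ((q.primeFactors.card : ℕ) : ℝ) ≤ 2 * Real.log q := by
  have h1 : 2 ^ q.primeFactors.card ≤ q := by
    calc 2 ^ q.primeFactors.card ≤ ∏ p ∈ q.primeFactors, p :=
          Finset.pow_card_le_prod _ _ _ (fun p hp => (Nat.prime_of_mem_primeFactors hp).two_le)
      _ ≤ q := Nat.le_of_dvd hq (Nat.prod_primeFactors_dvd q)
  have h2 : (2 : ℝ) ^ q.primeFactors.card ≤ q := by exact_mod_cast h1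
  have h3 := Real.log_le_log (by positivity) h2
  rw [Real.log_pow] at h3
  have := Real.log_two_gt_d9
  have h0 : (0 : ℝ) ≤ q.primeFactors.card := by positivity
  nlinarith

lemma prime_coprime_count (X q : ℕ) (hq : 1 ≤ q) :
    (Nat.primeCounting X : ℝ) - 2 * Real.log q ≤
      ((((Finset.Icc 1 X).filter Nat.Prime).filter (fun p => ¬ p ∣ q)).card : ℝ) := by
  have h1 := card_primeFactors_log q hq
  have hc := Finset.card_filter_add_card_filter_not (s := (Finset.Icc 1 X).filter Nat.Prime)
    (fun p => p ∣ q)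
  rw [card_primesLE] at hc
  have h2 : (((Finset.Icc 1 X).filter Nat.Prime).filter (fun p => p ∣ q)).card ≤ q.primeFactors.card := by
    apply Finset.card_le_card
    intro p hp
    simp only [Finset.mem_filter, Finset.mem_Icc] at hp
    rw [Nat.mem_primeFactors]
    exact ⟨hp.1.2, hp.2, by omega⟩
  have h2' : ((((Finset.Icc 1 X).filter Nat.Prime).filter (fun p => p ∣ q)).card : ℝ) ≤
    q.primeFactors.card := by exact_mod_cast h2
  have hc' : ((((Finset.Icc 1 X).filter Nat.Prime).filter (fun p => p ∣ q)).card : ℝ) +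
    ((((Finset.Icc 1 X).filter Nat.Prime).filter (fun p => ¬ p ∣ q)).card : ℝ) =
      Nat.primeCounting X := by exact_mod_cast hc
  linarith

set_option maxHeartbeats 2000000 in
lemma caseB (k s : ℕ) (hk : 1 ≤ k) (hs : 1 ≤ s) (ρ η : ℝ) (hρ : 0 < ρ) (hη : 0 < η)
    (hB : ρ * (2 * s + 5) + η * (1 + k * (1 - 1 / (k : ℝ)) ^ s) < 1 - η) :
    ∃ N₀ : ℕ, ∀ N : ℕ, N₀ ≤ N → ∀ (α₁ αk : ℝ)
      (_ : ∀ n : ℕ, 1 ≤ n → n ≤ N →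
        (N : ℝ) ^ (-ρ) < nearestIntDist (αk * (n : ℝ) ^ k + α₁ * (n : ℝ)))
      (a : ℤ) (q : ℕ) (_ : 1 ≤ q) (_ : IsCoprime (q : ℤ) a)
      (_ : (N : ℝ) ^ (1 - η - 3 * ρ) < q) (_ : (q : ℝ) ≤ (N : ℝ) ^ (k * η))
      (_ : |αk - (a : ℝ) / q| * (q * (N : ℝ) ^ (k * (1 - η))) ≤ 1), False := by
  have hk0 : (0 : ℝ) < k := by exact_mod_cast hk
  have hk1 : (1 : ℝ) ≤ k := by exact_mod_cast hk
  have hθ := one_sub_inv_nonneg k hk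
  set Θ := (1 - 1 / (k : ℝ)) ^ s with hΘ
  have hΘ0 : 0 ≤ Θ := pow_nonneg hθ s
  set u := 1 - η - 3 * ρ with hu
  set g := u - ρ * (2 * s + 2) - η * (1 + k * Θ) with hg
  have hg0 : 0 < g := by rw [hg, hu]; linarith
  have hgu : g ≤ u := by
    have : 0 ≤ ρ * (2 * s + 2) + η * (1 + k * Θ) := by positivity
    rw [hg]; linarith
  have hu0 : 0 < u := by linarith
  set M := u + (2 * s + 2) + 1 + k * η + 1 with hM
  have hM0 : 0 < M := by positivity
  have hMu : u + 1 ≤ M := by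
    have : 0 ≤ (2 * (s : ℝ) + 2) + k * η := by positivity
    rw [hM]; linarith
  set κ := g / M with hκ
  have hκ0 : 0 < κ := by positivity
  have hκM : κ * M = g := by rw [hκ]; field_simp
  have hκ1 : κ < 1 := by rw [hκ, div_lt_one hM0]; linarith
  obtain ⟨C, hC, N₁, hcore⟩ := core_N k s 1 hk hs le_rfl ρ κ hρ hκ0
  obtain ⟨K, hK, hroots⟩ := rootsCard_bound k hk κ hκ0
  obtain ⟨X₀, hpi⟩ := pi_lower κ hκ0
  set ν := u * (1 - κ) / 2 with hν
  have hν0 : 0 < ν := by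
    have : 0 < 1 - κ := by linarith
    positivity
  obtain ⟨N₂, hN₂⟩ := ev_rpow (X₀ + 2) u hu0
  obtain ⟨N₃, hN₃⟩ := ev_rpow (8 * (k * η) * (1 + 1 / ν)) ν hν0
  obtain ⟨N₄, hN₄⟩ := ev_rpow (4 * C * K + 1) κ hκ0
  obtain ⟨N₅, hN₅⟩ := ev_rpow (2 ^ (k + 1)) ρ hρ
  refine ⟨max (max (max N₁ N₂) (max N₃ N₄)) (max N₅ 1), ?_⟩
  intro N hN α₁ αk hbad a q hq hcop hq1 hq2 happ
  simp only [max_le_iff] at hN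
  obtain ⟨⟨⟨n1, n2⟩, n3, n4⟩, n5, n6⟩ := hN
  have hN1 : (1 : ℝ) ≤ N := by exact_mod_cast n6
  have hN0 : (0 : ℝ) < N := by linarith
  have hq0 : (0 : ℝ) < q := by exact_mod_cast hq
  have hq1' : (1 : ℝ) ≤ q := by exact_mod_cast hq
  have b2 := hN₂ N n2
  have b3 := hN₃ N n3
  have b4 := hN₄ N n4
  have b5 := hN₅ N n5
  set X := ⌊(N : ℝ) ^ u⌋₊ with hX
  have hXle : (X : ℝ) ≤ (N : ℝ) ^ u := Nat.floor_le (by positivity)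
  have hNu1 : 1 ≤ (N : ℝ) ^ u := Real.one_le_rpow hN1 hu0.le
  have hXge : (N : ℝ) ^ u / 2 ≤ X := half_le_floor _ hNu1
  have hXX₀ : X₀ ≤ X := Nat.le_floor (by linarith)
  have hpiX := hpi X hXX₀
  set 𝒳 := ((Finset.Icc 1 X).filter Nat.Prime).filter (fun p => ¬ p ∣ q) with h𝒳
  have hmem : ∀ x ∈ 𝒳, 1 ≤ x ∧ x ≤ X ∧ x.Prime ∧ ¬ x ∣ q := by
    intro x hx
    simp only [h𝒳, Finset.mem_filter, Finset.mem_Icc] at hx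
    exact ⟨hx.1.1.1, hx.1.1.2, hx.1.2, hx.2⟩
  have hqk : (q : ℝ) ^ (1 / (k : ℝ)) ≤ (N : ℝ) ^ η := by
    calc (q : ℝ) ^ (1 / (k : ℝ)) ≤ ((N : ℝ) ^ (k * η)) ^ (1 / (k : ℝ)) := by gcongr
      _ = _ := by
        rw [← Real.rpow_mul hN0.le]; congr 1; field_simp
  have hqkk : ((q : ℝ) ^ (1 / (k : ℝ))) ^ k = q := by
    rw [← Real.rpow_mul_natCast hq0.le, one_div_mul_cancel hk0.ne', Real.rpow_one]
  have h2ρ : (2 : ℝ) ≤ (N : ℝ) ^ ρ := by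
    have : (2 : ℝ) ^ 1 ≤ 2 ^ (k + 1) := pow_le_pow_right₀ (by norm_num) (by omega)
    linarith
  have h := hcore N n1 α₁ αk hbad a q hq 𝒳 (𝒳.card * rootsCard k q) (by positivity)
    (fun c hc => hE_one a q k hq hcop 𝒳
      (fun x hx => ((hmem x hx).2.2.1.coprime_iff_not_dvd).2 (hmem x hx).2.2.2)
      (fun x hx => by
        have : (x : ℝ) ≤ X := by exact_mod_cast (hmem x hx).2.1
        have : (x : ℝ) < q := by linarith
        exact_mod_cast this) c hc) (by
    intro x hx
    have hxu : (x : ℝ) ≤ (N : ℝ) ^ u := le_trans (by exact_mod_cast (hmem x hx).2.1) hXle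
    refine ⟨(hmem x hx).1, ?_, ?_⟩
    · calc (x : ℝ) * (2 * (q : ℝ) ^ (1 / (k : ℝ))) ≤ (N : ℝ) ^ u * ((N : ℝ) ^ ρ * (N : ℝ) ^ η) := by
            gcongr
        _ = (N : ℝ) ^ (1 - 2 * ρ) := by
            rw [← Real.rpow_add hN0, ← Real.rpow_add hN0]; congr 1; rw [hu]; ring
        _ ≤ (N : ℝ) ^ (1 : ℝ) := Real.rpow_le_rpow_of_exponent_le hN1 (by linarith)
        _ = N := Real.rpow_one _
    · rw [mul_pow, mul_pow, hqkk]
      have e1 : (x : ℝ) ^ k ≤ (N : ℝ) ^ (k * (1 - η)) * (N : ℝ) ^ (-(3 * ρ)) := by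
        calc (x : ℝ) ^ k ≤ ((N : ℝ) ^ u) ^ k := by gcongr
          _ = (N : ℝ) ^ (u * k) := by rw [Real.rpow_mul_natCast hN0.le]
          _ ≤ (N : ℝ) ^ (k * (1 - η) + (-(3 * ρ))) := by
              apply Real.rpow_le_rpow_of_exponent_le hN1
              rw [hu]
              have := mul_nonneg (sub_nonneg.2 hk1) hρ.le; linarith
          _ = _ := Real.rpow_add hN0 _ _
      have e2 : (2 : ℝ) ^ k * (N : ℝ) ^ (-(3 * ρ)) ≤ (N : ℝ) ^ (-ρ) / 2 := by
        have : (N : ℝ) ^ (-ρ) = (N : ℝ) ^ (ρ) * (N : ℝ) ^ (-(3 * ρ)) * (N : ℝ) ^ ρ := by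
          rw [← Real.rpow_add hN0, ← Real.rpow_add hN0]; congr 1; ring
        rw [this]
        have p1 : 0 < (N : ℝ) ^ (-(3 * ρ)) := by positivity
        have p2 : (2 : ℝ) ^ (k + 1) * 1 ≤ (N : ℝ) ^ ρ * (N : ℝ) ^ ρ := by
          gcongr
          linarith
        rw [pow_succ] at p2
        have := mul_le_mul_of_nonneg_right p2 p1.le; linarith
      calc |αk - (a : ℝ) / q| * ((x : ℝ) ^ k * (2 ^ k * q))
          ≤ |αk - (a : ℝ) / q| * (((N : ℝ) ^ (k * (1 - η)) * (N : ℝ) ^ (-(3 * ρ))) * (2 ^ k * q)) := by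
            gcongr
        _ = (|αk - (a : ℝ) / q| * (q * (N : ℝ) ^ (k * (1 - η)))) * (2 ^ k * (N : ℝ) ^ (-(3 * ρ))) := by
            ring
        _ ≤ 1 * (2 ^ k * (N : ℝ) ^ (-(3 * ρ))) := by gcongr
        _ ≤ _ := by linarith)
  have hcount : (N : ℝ) ^ (u * (1 - κ)) / 4 ≤ 𝒳.card := by
    have h1 := prime_coprime_count X q hq
    have h2 : (N : ℝ) ^ (u * (1 - κ)) / 2 ≤ (X : ℝ) ^ (1 - κ) := by
      calc (N : ℝ) ^ (u * (1 - κ)) / 2 ≤ (N : ℝ) ^ (u * (1 - κ)) / 2 ^ (1 - κ) := by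
            gcongr
            calc (2 : ℝ) ^ (1 - κ) ≤ 2 ^ (1 : ℝ) :=
                  Real.rpow_le_rpow_of_exponent_le (by norm_num) (by linarith)
              _ = 2 := Real.rpow_one _
        _ = ((N : ℝ) ^ u / 2) ^ (1 - κ) := by
            rw [Real.div_rpow (by positivity) (by norm_num), ← Real.rpow_mul hN0.le]
        _ ≤ _ := Real.rpow_le_rpow (by positivity) hXge (by linarith)
    have h3 : 2 * Real.log q ≤ (N : ℝ) ^ (u * (1 - κ)) / 4 := by
      have e1 : Real.log q ≤ k * η * Real.log N := by
        have := Real.log_le_log hq0 hq2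
        rwa [Real.log_rpow hN0] at this
      have e2 := one_add_log_le ν N hν0 hN1
      have e3 : (N : ℝ) ^ (u * (1 - κ)) = (N : ℝ) ^ ν * (N : ℝ) ^ ν := by
        rw [← Real.rpow_add hN0]; congr 1; rw [hν]; ring
      rw [e3]
      have e4 : 8 * (k * η) * (1 + 1 / ν) * (N : ℝ) ^ ν ≤ (N : ℝ) ^ ν * (N : ℝ) ^ ν := by gcongr
      have e5 : k * η * Real.log N ≤ k * η * ((1 + 1 / ν) * (N : ℝ) ^ ν) := by
        gcongr; linarith
      linarith
    have h4 : ((𝒳.card : ℕ) : ℝ) ≥ (Nat.primeCounting X : ℝ) - 2 * Real.log q := h1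
    linarith
  have hcpos : (0 : ℝ) < 𝒳.card := lt_of_lt_of_le (by positivity) hcount
  have hr := hroots q hq
  have hqΘ : (q : ℝ) ^ (1 / (k : ℝ) + Θ) * (q : ℝ) ^ κ ≤ (N : ℝ) ^ (η * (1 + k * Θ) + k * η * κ) := by
    rw [← Real.rpow_add hq0]
    calc (q : ℝ) ^ (1 / (k : ℝ) + Θ + κ) ≤ ((N : ℝ) ^ (k * η)) ^ (1 / (k : ℝ) + Θ + κ) := by gcongr
      _ = _ := by rw [← Real.rpow_mul hN0.le]; congr 1; field_simp
  have hfin : (𝒳.card : ℝ) ≤ C * K * (N : ℝ) ^ ((ρ + κ) * (2 * s + 2) + κ +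
      (η * (1 + k * Θ) + k * η * κ)) := by
    have h5 : (𝒳.card : ℝ) * 𝒳.card ≤ 𝒳.card * (C * K * (N : ℝ) ^ ((ρ + κ) * (2 * s + 2) + κ +
      (η * (1 + k * Θ) + k * η * κ))) := by
      calc (𝒳.card : ℝ) * 𝒳.card = (𝒳.card : ℝ) ^ (2 * 1) := by ring
        _ ≤ _ := h
        _ ≤ C * ((N : ℝ) ^ ((ρ + κ) * (2 * (1 : ℕ) * s + 2) + κ) *
        (q : ℝ) ^ (1 / (k : ℝ) + Θ) * (𝒳.card * (K * (q : ℝ) ^ κ))) := by gcongr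
        _ = 𝒳.card * (C * K * ((N : ℝ) ^ ((ρ + κ) * (2 * s + 2) + κ) *
          ((q : ℝ) ^ (1 / (k : ℝ) + Θ) * (q : ℝ) ^ κ))) := by push_cast; ring_nf
        _ ≤ 𝒳.card * (C * K * ((N : ℝ) ^ ((ρ + κ) * (2 * s + 2) + κ) *
          (N : ℝ) ^ (η * (1 + k * Θ) + k * η * κ))) := by gcongr
        _ = _ := by rw [Real.rpow_add hN0 _ (η * (1 + k * Θ) + k * η * κ)]
    exact le_of_mul_le_mul_left h5 hcpos
  have hexp : u * (1 - κ) = κ + ((ρ + κ) * (2 * s + 2) + κ + (η * (1 + k * Θ) + k * η * κ)) := by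
    have : κ * M = u - ρ * (2 * s + 2) - η * (1 + k * Θ) := hκM
    rw [hM] at this
    linarith
  rw [hexp, Real.rpow_add hN0] at hcount
  set W := (N : ℝ) ^ ((ρ + κ) * (2 * s + 2) + κ + (η * (1 + k * Θ) + k * η * κ)) with hW
  have hW0 : 0 < W := by positivity
  have : (4 * C * K + 1) * W ≤ (N : ℝ) ^ κ * W := by gcongr
  linarith

set_option maxHeartbeats 2000000 in
lemma caseA (k s : ℕ) (hk : 2 ≤ k) (hs : 1 ≤ s) (ρ η : ℝ) (hρ : 0 < ρ) (hη : 0 < η) (hη1 : η < 1)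
    (hρk : ρ < k * (1 - 2 * η))
    (hA : ρ * (2 * (k - 1) * s + 2) + (1 - η) * (1 + k * (1 - 1 / (k : ℝ)) ^ s) < k * η / 2) :
    ∃ N₀ : ℕ, ∀ N : ℕ, N₀ ≤ N → ∀ (α₁ αk : ℝ)
      (_ : ∀ n : ℕ, 1 ≤ n → n ≤ N →
        (N : ℝ) ^ (-ρ) < nearestIntDist (αk * (n : ℝ) ^ k + α₁ * (n : ℝ)))
      (a : ℤ) (q : ℕ) (_ : 1 ≤ q) (_ : IsCoprime (q : ℤ) a)
      (_ : (N : ℝ) ^ (k * η) < q) (_ : (q : ℝ) ≤ (N : ℝ) ^ (k * (1 - η)))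
      (_ : |αk - (a : ℝ) / q| * (q * (N : ℝ) ^ (k * (1 - η))) ≤ 1), False := by
  have hk1 : 1 ≤ k := by omega
  have hk0 : (0 : ℝ) < k := by exact_mod_cast hk1
  obtain ⟨m, rfl⟩ : ∃ m, k = m + 1 := ⟨k - 1, by omega⟩
  have hm : 1 ≤ m := by omega
  have hm0 : (0 : ℝ) < m := by exact_mod_cast hm
  have hθ := one_sub_inv_nonneg (m + 1) hk1
  set Θ := (1 - 1 / ((m + 1 : ℕ) : ℝ)) ^ s with hΘ
  have hΘ0 : 0 ≤ Θ := pow_nonneg hθ s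
  have hkm : ((m + 1 : ℕ) : ℝ) = m + 1 := by push_cast; rfl
  set kk : ℝ := ((m + 1 : ℕ) : ℝ) with hkk
  set F₀ := (1 - η) * (1 + kk * Θ) with hF₀
  have hF₀0 : 0 ≤ F₀ := mul_nonneg (by linarith) (by positivity)
  set g := kk * η - 2 * (ρ * (2 * m * s + 2)) - 2 * F₀ with hg
  have hg0 : 0 < g := by
    have : kk - 1 = m := by rw [hkm]; ring
    rw [this] at hA
    rw [hg]; linarith
  have hgk : g ≤ kk * η := by
    have : 0 ≤ ρ * (2 * m * s + 2) := by positivity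
    rw [hg]; linarith
  set M := 2 * kk + 2 * (2 * m * s + 2) + 3 with hM
  have hM0 : 0 < M := by positivity
  set κ := g / M with hκ
  have hκ0 : 0 < κ := by positivity
  have hκM : κ * M = g := by rw [hκ]; field_simp
  have hκη : κ ≤ η / 2 := by
    rw [hκ, div_le_iff₀ hM0]
    have : 0 ≤ η / 2 * (2 * (2 * m * s + 2) + 3) := by positivity
    rw [hM]; linarith
  have hκ1 : κ < 1 := by linarith
  set v := (η - κ) / m with hv
  have hv0 : 0 < v := by
    have : 0 < η - κ := by linarith
    positivity
  have hvm : v * m = η - κ := by rw [hv]; field_simp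
  obtain ⟨C, hC, N₁, hcore⟩ := core_N (m + 1) s m hk1 hs hm ρ κ hρ hκ0
  obtain ⟨Z₀, hparts⟩ := prime_parts (m + 1) hk κ hκ0 hκ1.le
  set c₀ : ℝ := (4 ^ m + 8 * ((m + 1 : ℕ) : ℝ)) with hc₀
  have hc₀0 : 0 < c₀ := by positivity
  obtain ⟨N₂, hN₂⟩ := ev_rpow (Z₀ + 2) v hv0
  obtain ⟨N₃, hN₃⟩ := ev_rpow 2 κ hκ0
  obtain ⟨N₄, hN₄⟩ := ev_rpow (2 ^ (m ^ 2 + m) * (C * c₀ ^ m) ^ 2 + 1) κ hκ0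
  obtain ⟨N₅, hN₅⟩ := ev_rpow (2 ^ (m + 2)) (kk * (1 - 2 * η) - ρ) (by linarith)
  obtain ⟨N₆, hN₆⟩ := ev_rpow kk (kk * κ) (by positivity)
  refine ⟨max (max (max N₁ N₂) (max N₃ N₄)) (max (max N₅ N₆) 1), ?_⟩
  intro N hN α₁ αk hbad a q hq hcop hq1 hq2 happ
  simp only [max_le_iff] at hN
  obtain ⟨⟨⟨n1, n2⟩, n3, n4⟩, ⟨n5, n6⟩, n7⟩ := hN
  have hN1 : (1 : ℝ) ≤ N := by exact_mod_cast n7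
  have hN0 : (0 : ℝ) < N := by linarith
  have hq0 : (0 : ℝ) < q := by exact_mod_cast hq
  have hq1' : (1 : ℝ) ≤ q := by exact_mod_cast hq
  have b2 := hN₂ N n2
  have b3 := hN₃ N n3
  have b4 := hN₄ N n4
  have b5 := hN₅ N n5
  have b6 := hN₆ N n6
  set Z := ⌊(N : ℝ) ^ v⌋₊ with hZ
  have hZle : (Z : ℝ) ≤ (N : ℝ) ^ v := Nat.floor_le (by positivity)
  have hNv1 : 1 ≤ (N : ℝ) ^ v := Real.one_le_rpow hN1 hv0.le
  have hZge : (N : ℝ) ^ v / 2 ≤ Z := half_le_floor _ hNv1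
  have hZZ₀ : Z₀ ≤ Z := Nat.le_floor (by linarith)
  have hZ1 : 1 ≤ Z := (Nat.one_le_floor_iff _).2 hNv1
  obtain ⟨D, PP, hD, hprime, hPZ, hPZk, hcard, hdisj⟩ := hparts Z hZZ₀
  simp only [Nat.add_sub_cancel] at hprime hPZ hPZk hcard hdisj
  have hDlow : (N : ℝ) ^ (v * (1 - κ)) / 2 ≤ D := by
    refine le_trans ?_ hD
    calc (N : ℝ) ^ (v * (1 - κ)) / 2 ≤ (N : ℝ) ^ (v * (1 - κ)) / 2 ^ (1 - κ) := by
            gcongr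
            calc (2 : ℝ) ^ (1 - κ) ≤ 2 ^ (1 : ℝ) :=
                  Real.rpow_le_rpow_of_exponent_le (by norm_num) (by linarith)
              _ = 2 := Real.rpow_one _
        _ = ((N : ℝ) ^ v / 2) ^ (1 - κ) := by
            rw [Real.div_rpow (by positivity) (by norm_num), ← Real.rpow_mul hN0.le]
        _ ≤ _ := Real.rpow_le_rpow (by positivity) hZge (by linarith)
  have hDpos : (0 : ℝ) < D := lt_of_lt_of_le (by positivity) hDlow
  have hD1 : 1 ≤ D := by exact_mod_cast hDpos
  obtain ⟨hXcard, hJ⟩ := prime_mean (m + 1) m Z D hk1 hD1 hZ1 PP hprime hPZ hPZk hcard hdisj m le_rfl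
  have hXle := Xset_le PP m Z hprime hPZ m le_rfl
  set 𝒳 := Xset PP m with h𝒳
  have hZm : (Z : ℝ) ^ m ≤ (N : ℝ) ^ (η - κ) := by
    calc (Z : ℝ) ^ m ≤ ((N : ℝ) ^ v) ^ m := by gcongr
      _ = _ := by rw [← Real.rpow_mul_natCast hN0.le, hvm]
  have hqk : (q : ℝ) ^ (1 / kk) ≤ (N : ℝ) ^ (1 - η) := by
    calc (q : ℝ) ^ (1 / kk) ≤ ((N : ℝ) ^ (kk * (1 - η))) ^ (1 / kk) := by gcongr
      _ = _ := by
        rw [← Real.rpow_mul hN0.le]; congr 1; field_simp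
  have hqkk : ((q : ℝ) ^ (1 / kk)) ^ (m + 1) = q := by
    rw [← Real.rpow_mul_natCast hq0.le, one_div_mul_cancel hk0.ne', Real.rpow_one]
  have hpk : ((N : ℝ) ^ (η - κ)) ^ (m + 1) = (N : ℝ) ^ (kk * (η - κ)) := by
    rw [← Real.rpow_mul_natCast hN0.le]; congr 1; rw [← hkk]; ring
  have htX : m * (Z ^ m) ^ (m + 1) < q := by
    have : (m : ℝ) * ((Z : ℝ) ^ m) ^ (m + 1) < q := by
      calc (m : ℝ) * ((Z : ℝ) ^ m) ^ (m + 1) ≤ kk * ((N : ℝ) ^ (η - κ)) ^ (m + 1) := by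
            gcongr
            rw [hkm]; linarith
        _ ≤ (N : ℝ) ^ (kk * κ) * (N : ℝ) ^ (kk * (η - κ)) := by rw [hpk]; gcongr
        _ = (N : ℝ) ^ (kk * η) := by rw [← Real.rpow_add hN0]; congr 1; ring
        _ < q := hq1
    exact_mod_cast this
  have h := hcore N n1 α₁ αk hbad a q hq 𝒳 (Jcount (m + 1) m 𝒳) (by positivity)
    (fun c hc => hE_gen a q (m + 1) m (Z ^ m) hq hcop 𝒳 (fun x hx => (hXle x hx).2) htX c hc) (by
    intro x hx
    have hxu : (x : ℝ) ≤ (N : ℝ) ^ (η - κ) :=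
      le_trans (by exact_mod_cast (hXle x hx).2) hZm
    refine ⟨(hXle x hx).1, ?_, ?_⟩
    · calc (x : ℝ) * (2 * (q : ℝ) ^ (1 / kk)) ≤
            (N : ℝ) ^ (η - κ) * ((N : ℝ) ^ κ * (N : ℝ) ^ (1 - η)) := by gcongr
        _ = (N : ℝ) ^ (1 : ℝ) := by
            rw [← Real.rpow_add hN0, ← Real.rpow_add hN0]; congr 1; ring
        _ = N := Real.rpow_one _
    · rw [mul_pow, mul_pow, hqkk]
      have e1 : (x : ℝ) ^ (m + 1) ≤ (N : ℝ) ^ (kk * η) := by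
        calc (x : ℝ) ^ (m + 1) ≤ ((N : ℝ) ^ (η - κ)) ^ (m + 1) := by gcongr
          _ = (N : ℝ) ^ (kk * (η - κ)) := hpk
          _ ≤ (N : ℝ) ^ (kk * η) := by
              apply Real.rpow_le_rpow_of_exponent_le hN1
              have := mul_pos hk0 hκ0; linarith
      have e3 : (N : ℝ) ^ (kk * η) * (2 ^ (m + 2)) ≤ (N : ℝ) ^ (kk * (1 - η)) * (N : ℝ) ^ (-ρ) := by
        calc (N : ℝ) ^ (kk * η) * (2 ^ (m + 2)) ≤
              (N : ℝ) ^ (kk * η) * (N : ℝ) ^ (kk * (1 - 2 * η) - ρ) := by gcongr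
          _ = _ := by rw [← Real.rpow_add hN0, ← Real.rpow_add hN0]; congr 1; ring
      have e4 : (x : ℝ) ^ (m + 1) * 2 ^ (m + 1) ≤
          (N : ℝ) ^ (kk * (1 - η)) * ((N : ℝ) ^ (-ρ) / 2) := by
        have : (x : ℝ) ^ (m + 1) * 2 ^ (m + 2) ≤ (N : ℝ) ^ (kk * η) * (2 ^ (m + 2)) := by gcongr
        rw [pow_succ 2 (m + 1)] at this e3
        linarith
      calc |αk - (a : ℝ) / q| * ((x : ℝ) ^ (m + 1) * (2 ^ (m + 1) * q))
          = |αk - (a : ℝ) / q| * q * ((x : ℝ) ^ (m + 1) * 2 ^ (m + 1)) := by ring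
        _ ≤ |αk - (a : ℝ) / q| * q * ((N : ℝ) ^ (kk * (1 - η)) * ((N : ℝ) ^ (-ρ) / 2)) := by gcongr
        _ = (|αk - (a : ℝ) / q| * (q * (N : ℝ) ^ (kk * (1 - η)))) * ((N : ℝ) ^ (-ρ) / 2) := by
            ring
        _ ≤ 1 * ((N : ℝ) ^ (-ρ) / 2) := by gcongr
        _ = _ := by ring)
  set σ := ∑ j ∈ Finset.range m, (3 * j + 1) with hσ
  have hσm : 2 * σ + m = 3 * m ^ 2 := sum_3j1 m
  set F := (ρ + κ) * (2 * m * s + 2) + κ + F₀ with hF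
  have hqΘ : (q : ℝ) ^ (1 / kk + Θ) ≤ (N : ℝ) ^ F₀ := by
    calc (q : ℝ) ^ (1 / kk + Θ) ≤ ((N : ℝ) ^ (kk * (1 - η))) ^ (1 / kk + Θ) := by gcongr
      _ = _ := by rw [← Real.rpow_mul hN0.le]; congr 1; rw [hF₀]; field_simp
  have h1 : (D : ℝ) ^ (2 * m ^ 2) ≤ C * c₀ ^ m * (N : ℝ) ^ F * (D : ℝ) ^ σ := by
    rw [hXcard] at h
    calc (D : ℝ) ^ (2 * m ^ 2) = ((D ^ m : ℕ) : ℝ) ^ (2 * m) := by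
          push_cast; rw [← pow_mul]; congr 1; ring
      _ ≤ _ := h
      _ ≤ C * ((N : ℝ) ^ ((ρ + κ) * (2 * m * s + 2) + κ) * (N : ℝ) ^ F₀ * (c₀ ^ m * (D : ℝ) ^ σ)) := by
          gcongr
      _ = _ := by rw [hF, Real.rpow_add hN0 _ F₀]; ring
  have h2 : (D : ℝ) ^ (m ^ 2 + m) ≤ (C * c₀ ^ m) ^ 2 * (N : ℝ) ^ (2 * F) := by
    have e1 : ((D : ℝ) ^ (2 * m ^ 2)) ^ 2 ≤ (C * c₀ ^ m * (N : ℝ) ^ F * (D : ℝ) ^ σ) ^ 2 := by gcongr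
    have e2 : ((D : ℝ) ^ (2 * m ^ 2)) ^ 2 = (D : ℝ) ^ (m ^ 2 + m) * (D : ℝ) ^ (2 * σ) := by
      rw [← pow_mul, ← pow_add]; congr 1; omega
    have e3 : (C * c₀ ^ m * (N : ℝ) ^ F * (D : ℝ) ^ σ) ^ 2 =
        ((C * c₀ ^ m) ^ 2 * (N : ℝ) ^ (2 * F)) * (D : ℝ) ^ (2 * σ) := by
      have : (N : ℝ) ^ (2 * F) = ((N : ℝ) ^ F) ^ 2 := by
        rw [← Real.rpow_mul_natCast hN0.le]; congr 1; push_cast; ring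
      rw [this, mul_pow, mul_pow, ← pow_mul (D : ℝ), mul_comm σ 2]
    rw [e2, e3] at e1
    exact le_of_mul_le_mul_right e1 (by positivity)
  have h3 : (N : ℝ) ^ (κ + 2 * F) ≤ 2 ^ (m ^ 2 + m) * (D : ℝ) ^ (m ^ 2 + m) := by
    have e1 : ((N : ℝ) ^ (v * (1 - κ))) ^ (m ^ 2 + m) ≤ (2 * (D : ℝ)) ^ (m ^ 2 + m) := by
      gcongr; linarith
    rw [mul_pow] at e1
    refine le_trans ?_ e1
    rw [← Real.rpow_mul_natCast hN0.le]
    apply Real.rpow_le_rpow_of_exponent_le hN1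
    have e2 : v * (1 - κ) * ((m ^ 2 + m : ℕ) : ℝ) = (η - κ) * (1 - κ) * kk := by
      rw [← hvm, hkm]; push_cast; ring
    rw [e2, hF]
    have e3 : κ * M = kk * η - 2 * (ρ * (2 * m * s + 2)) - 2 * F₀ := hκM
    rw [hM] at e3
    have e4 : 0 ≤ (κ * (1 - η) + κ ^ 2) * kk := by
      have : 0 ≤ 1 - η := by linarith
      positivity
    linarith
  rw [Real.rpow_add hN0] at h3
  set W := (N : ℝ) ^ (2 * F) with hW
  have hW0 : 0 < W := by positivity
  have e6 : (2 ^ (m ^ 2 + m) * (C * c₀ ^ m) ^ 2 + 1) * W ≤ (N : ℝ) ^ κ * W := by gcongr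
  have e7 : (2 : ℝ) ^ (m ^ 2 + m) * (D : ℝ) ^ (m ^ 2 + m) ≤
    2 ^ (m ^ 2 + m) * ((C * c₀ ^ m) ^ 2 * W) := by gcongr
  linarith

lemma caseM (k : ℕ) (hk : 2 ≤ k) (ρ η : ℝ) (hρ : 0 < ρ) (hη : 0 < η) (hB : ρ * 5 < 1 - η) :
    ∃ N₀ : ℕ, ∀ N : ℕ, N₀ ≤ N → ∀ (α₁ αk : ℝ)
      (_ : ∀ n : ℕ, 1 ≤ n → n ≤ N →
        (N : ℝ) ^ (-ρ) < nearestIntDist (αk * (n : ℝ) ^ k + α₁ * (n : ℝ)))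
      (a : ℤ) (q : ℕ) (_ : 1 ≤ q)
      (_ : (q : ℝ) ≤ (N : ℝ) ^ (1 - η - 3 * ρ))
      (_ : |αk - (a : ℝ) / q| * (q * (N : ℝ) ^ (k * (1 - η))) ≤ 1), False := by
  obtain ⟨N₁, hN₁⟩ := ev_rpow 2 (ρ / 2) (by positivity)
  refine ⟨max N₁ 1, ?_⟩
  intro N hN α₁ αk hbad a q hq hq1 happ
  have hN1 : (1 : ℝ) ≤ N := by exact_mod_cast (le_max_right _ _).trans hN
  have hN0 : (0 : ℝ) < N := by linarith
  have b1 := hN₁ N ((le_max_left _ _).trans hN)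
  have hq0 : (0 : ℝ) < q := by exact_mod_cast hq
  set T := (N : ℝ) ^ (3 * ρ / 2) with hT
  have hT1 : 1 ≤ T := Real.one_le_rpow hN1 (by positivity)
  obtain ⟨m, hm0, hmM, hm⟩ := Real.exists_nat_abs_mul_sub_round_le (α₁ * q)
    (n := ⌊T⌋₊) ((Nat.one_le_floor_iff T).2 hT1)
  have hmT : (m : ℝ) ≤ T := le_trans (by exact_mod_cast hmM) (Nat.floor_le (by linarith))
  have hm' : |m * (α₁ * q) - round (m * (α₁ * q))| ≤ (N : ℝ) ^ (-(3 * ρ / 2)) := by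
    refine hm.trans ?_
    rw [Real.rpow_neg hN0.le, one_div]
    exact inv_anti₀ (by positivity) (Nat.lt_floor_add_one T).le
  have hn : q * m ≤ N := by
    have : (q : ℝ) * m ≤ N := by
      calc (q : ℝ) * m ≤ (N : ℝ) ^ (1 - η - 3 * ρ) * T := by gcongr
        _ = (N : ℝ) ^ (1 - η - 3 * ρ / 2) := by
          rw [hT, ← Real.rpow_add hN0]; congr 1; ring
        _ ≤ (N : ℝ) ^ (1 : ℝ) := Real.rpow_le_rpow_of_exponent_le hN1 (by linarith)
        _ = N := Real.rpow_one _
    exact_mod_cast this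
  have hb := hbad (q * m) (Nat.mul_pos hq hm0) hn
  obtain ⟨j, rfl⟩ : ∃ j, k = j + 1 := ⟨k - 1, by omega⟩
  have hj : (1 : ℝ) ≤ j := by exact_mod_cast (by omega : 1 ≤ j)
  have h1 := nearestIntDist_le_abs_sub (αk * ((q * m : ℕ) : ℝ) ^ (j + 1) + α₁ * ((q * m : ℕ) : ℝ))
    (a * q ^ j * m ^ (j + 1) + round (m * (α₁ * q)))
  have h2 : αk * ((q * m : ℕ) : ℝ) ^ (j + 1) + α₁ * ((q * m : ℕ) : ℝ) -
      ((a * q ^ j * m ^ (j + 1) + round (m * (α₁ * q)) : ℤ) : ℝ) =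
      (αk - (a : ℝ) / q) * (q * (q ^ j * m ^ (j + 1))) + (m * (α₁ * q) - round (m * (α₁ * q))) := by
    push_cast
    field_simp
    ring
  rw [h2] at h1
  have h3 : |(αk - (a : ℝ) / q) * (q * (q ^ j * m ^ (j + 1)))| ≤ (N : ℝ) ^ (-(3 * ρ / 2)) := by
    rw [abs_mul, abs_of_nonneg (by positivity : (0:ℝ) ≤ q * (q ^ j * m ^ (j + 1)))]
    have e1 : (q : ℝ) ^ j * m ^ (j + 1) ≤
        (N : ℝ) ^ (((j + 1 : ℕ) : ℝ) * (1 - η)) * (N : ℝ) ^ (-(3 * ρ / 2)) := by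
      calc (q : ℝ) ^ j * m ^ (j + 1) ≤ ((N : ℝ) ^ (1 - η - 3 * ρ)) ^ j * T ^ (j + 1) := by gcongr
        _ = (N : ℝ) ^ ((1 - η - 3 * ρ) * j + 3 * ρ / 2 * (j + 1 : ℕ)) := by
          rw [← Real.rpow_mul_natCast hN0.le, hT, ← Real.rpow_mul_natCast hN0.le,
            ← Real.rpow_add hN0]
        _ ≤ (N : ℝ) ^ (((j + 1 : ℕ) : ℝ) * (1 - η) + (-(3 * ρ / 2))) := by
          apply Real.rpow_le_rpow_of_exponent_le hN1
          push_cast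
          have := mul_nonneg hρ.le (sub_nonneg.2 hj)
          linarith
        _ = _ := Real.rpow_add hN0 _ _
    calc |αk - (a : ℝ) / q| * (q * (q ^ j * m ^ (j + 1)))
        ≤ |αk - (a : ℝ) / q| * (q * ((N : ℝ) ^ (((j + 1 : ℕ) : ℝ) * (1 - η)) * (N : ℝ) ^ (-(3 * ρ / 2)))) := by
          gcongr
      _ = |αk - (a : ℝ) / q| * (q * (N : ℝ) ^ (((j + 1 : ℕ) : ℝ) * (1 - η))) * (N : ℝ) ^ (-(3 * ρ / 2)) := by
          ring
      _ ≤ 1 * (N : ℝ) ^ (-(3 * ρ / 2)) := by gcongr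
      _ = _ := one_mul _
  have h4 := abs_add_le ((αk - (a : ℝ) / q) * (q * (q ^ j * m ^ (j + 1)))) (m * (α₁ * q) - round (m * (α₁ * q)))
  have h5 : 2 * (N : ℝ) ^ (-(3 * ρ / 2)) ≤ (N : ℝ) ^ (-ρ) := by
    calc 2 * (N : ℝ) ^ (-(3 * ρ / 2)) ≤ (N : ℝ) ^ (ρ / 2) * (N : ℝ) ^ (-(3 * ρ / 2)) := by gcongr
      _ = _ := by rw [← Real.rpow_add hN0]; congr 1; ring
  linarith

lemma main_P (k sA sB : ℕ) (hk : 2 ≤ k) (hsA : 1 ≤ sA) (hsB : 1 ≤ sB) (ρ η : ℝ) (hρ : 0 < ρ)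
    (hη : 0 < η) (hη1 : η ≤ 1 / 3)
    (hA : ρ * (2 * (k - 1) * sA + 2) + (1 - η) * (1 + k * (1 - 1 / (k : ℝ)) ^ sA) < k * η / 2)
    (hB : ρ * (2 * sB + 5) + η * (1 + k * (1 - 1 / (k : ℝ)) ^ sB) < 1 - η) :
    ∃ N₀ : ℕ, ∀ (α₁ αk : ℝ) (N : ℕ), N₀ ≤ N → ∃ n : ℕ, 1 ≤ n ∧ n ≤ N ∧
      nearestIntDist (αk * (n : ℝ) ^ k + α₁ * (n : ℝ)) ≤ (N : ℝ) ^ (-ρ) := by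
  have hk2 : (2 : ℝ) ≤ k := by exact_mod_cast hk
  have hθ := one_sub_inv_nonneg k (by omega)
  have hB5 : ρ * 5 < 1 - η := by
    have h1 : 0 ≤ ρ * (2 * sB) := by positivity
    have h2 : 0 ≤ η * (1 + k * (1 - 1 / (k : ℝ)) ^ sB) := by
      have := pow_nonneg hθ sB
      positivity
    linarith
  have hρk : ρ < k * (1 - 2 * η) := by
    have : 2 * (1 / 3 : ℝ) ≤ k * (1 - 2 * η) := by gcongr; linarith
    linarith
  obtain ⟨N₁, h1⟩ := caseM k hk ρ η hρ hη hB5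
  obtain ⟨N₂, h2⟩ := caseB k sB (by omega) hsB ρ η hρ hη hB
  obtain ⟨N₃, h3⟩ := caseA k sA hk hsA ρ η hρ hη (by linarith) hρk hA
  refine ⟨max (max N₁ N₂) (max N₃ 1), ?_⟩
  intro α₁ αk N hN
  simp only [max_le_iff] at hN
  obtain ⟨⟨n1, n2⟩, n3, n4⟩ := hN
  by_contra hcon
  push Not at hcon
  have hN1 : (1 : ℝ) ≤ N := by exact_mod_cast n4
  have hT1 : 1 ≤ (N : ℝ) ^ (k * (1 - η)) :=
    Real.one_le_rpow hN1 (mul_nonneg (by linarith) (by linarith))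
  obtain ⟨r, hr, hden⟩ := Real.exists_rat_abs_sub_le_and_den_le αk
    (n := ⌊(N : ℝ) ^ (k * (1 - η))⌋₊) ((Nat.one_le_floor_iff _).2 hT1)
  have hrd : (r : ℝ) = (r.num : ℝ) / r.den := by exact_mod_cast (Rat.num_div_den r).symm
  have hq : 1 ≤ r.den := r.den_pos
  have hq0 : (0 : ℝ) < r.den := by exact_mod_cast hq
  have hcop : IsCoprime (r.den : ℤ) r.num := by
    have := r.isCoprime_num_den
    exact this.symm
  have hqle : (r.den : ℝ) ≤ (N : ℝ) ^ (k * (1 - η)) :=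
    le_trans (by exact_mod_cast hden) (Nat.floor_le (by linarith))
  have happ : |αk - (r.num : ℝ) / r.den| * (r.den * (N : ℝ) ^ (k * (1 - η))) ≤ 1 := by
    rw [← hrd]
    calc |αk - (r : ℝ)| * (r.den * (N : ℝ) ^ (k * (1 - η)))
        ≤ 1 / (((⌊(N : ℝ) ^ (k * (1 - η))⌋₊ : ℝ) + 1) * r.den) *
          (r.den * ((⌊(N : ℝ) ^ (k * (1 - η))⌋₊ : ℝ) + 1)) := by
          have := (Nat.lt_floor_add_one ((N : ℝ) ^ (k * (1 - η)))).le
          gcongr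
      _ = 1 := by
          have : (0 : ℝ) < (⌊(N : ℝ) ^ (k * (1 - η))⌋₊ : ℝ) + 1 := by positivity
          field_simp
  rcases le_or_gt (r.den : ℝ) ((N : ℝ) ^ (1 - η - 3 * ρ)) with hc | hc
  · exact h1 N n1 α₁ αk hcon r.num r.den hq hc happ
  rcases le_or_gt (r.den : ℝ) ((N : ℝ) ^ (k * η)) with hd | hd
  · exact h2 N n2 α₁ αk hcon r.num r.den hq hcop hc hd happ
  · exact h3 N n3 α₁ αk hcon r.num r.den hq hcop hd hqle happ

def PP_holds (k : ℕ) (ρ : ℝ) : Prop :=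
  ∃ N₀ : ℕ, ∀ (α₁ αk : ℝ) (N : ℕ), N₀ ≤ N → ∃ n : ℕ, 1 ≤ n ∧ n ≤ N ∧
      nearestIntDist (αk * (n : ℝ) ^ k + α₁ * (n : ℝ)) ≤ (N : ℝ) ^ (-ρ)

lemma small_k (k : ℕ) (hk : 6 ≤ k) : ∃ ρ : ℝ, 0 < ρ ∧ PP_holds k ρ := by
  have hk6 : (6 : ℝ) ≤ k := by exact_mod_cast hk
  have hk0 : (0 : ℝ) < k := by linarith
  have hθ := one_sub_inv_nonneg k (by omega)
  have hθ1 : 1 - 1 / (k : ℝ) < 1 := by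
    have : 0 < 1 / (k : ℝ) := by positivity
    linarith
  obtain ⟨s, hs⟩ := exists_pow_lt_of_lt_one (show (0 : ℝ) < 1 / 10 / k by positivity) hθ1
  have hs1 : 1 ≤ s := by
    rcases Nat.eq_zero_or_pos s with h | h
    · exfalso
      rw [h, pow_zero, lt_div_iff₀ hk0] at hs
      linarith
    · exact h
  set Θ := (1 - 1 / (k : ℝ)) ^ s with hΘ
  rw [lt_div_iff₀ hk0] at hs
  have hΘ0 : 0 ≤ Θ := pow_nonneg hθ s
  set Q : ℝ := 2 * k * s + 5 with hQ
  have hQ0 : 0 < Q := by positivity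
  have hρ : 1 / 10 / Q * Q = 1 / 10 := by field_simp
  have hρ0 : 0 < 1 / 10 / Q := by positivity
  have hsr : (1 : ℝ) ≤ s := by exact_mod_cast hs1
  refine ⟨1 / 10 / Q, hρ0, main_P k s s (by omega) hs1 hs1 _ (3 / 10) hρ0 (by norm_num)
    (by norm_num) ?_ ?_⟩
  · have : 1 / 10 / Q * (2 * (k - 1) * s + 2) ≤ 1 / 10 / Q * Q := by
      gcongr
      rw [hQ]; nlinarith
    nlinarith
  · have : 1 / 10 / Q * (2 * s + 5) ≤ 1 / 10 / Q * Q := by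
      gcongr
      rw [hQ]; nlinarith
    nlinarith

lemma theta_pow_le (k s : ℕ) (hk : 1 ≤ k) (x : ℝ) (hx : k * x ≤ s) :
    (1 - 1 / (k : ℝ)) ^ s ≤ Real.exp (-x) := by
  have hk0 : (0 : ℝ) < k := by exact_mod_cast hk
  have hθ := one_sub_inv_nonneg k hk
  calc (1 - 1 / (k : ℝ)) ^ s ≤ (Real.exp (-(1 / (k : ℝ)))) ^ s := by
        gcongr
        have := Real.add_one_le_exp (-(1 / (k : ℝ)))
        linarith
    _ = Real.exp (s * (-(1 / (k : ℝ)))) := by rw [← Real.exp_nat_mul]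
    _ ≤ _ := by
        apply Real.exp_le_exp.2
        have : x ≤ s / k := by rw [le_div_iff₀ hk0]; linarith
        have e : (s : ℝ) * (-(1 / (k : ℝ))) = - (s / k) := by ring
        linarith

lemma large_k (k : ℕ) (hk : 6 ≤ k) (h1 : 1 ≤ Real.log (Real.log k))
    (h2 : 60 * Real.log (Real.log k) ≤ Real.log k) :
    PP_holds k (1 / (k * (2 * Real.log k + 140 * Real.log (Real.log k)))) := by
  have hk6 : (6 : ℝ) ≤ k := by exact_mod_cast hk
  have hk0 : (0 : ℝ) < k := by linarith
  set L1 := Real.log k with hL1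
  set L2 := Real.log L1 with hL2
  have hL1p : 0 < L1 := by linarith
  have hL2p : 0 < L2 := by linarith
  have hL1k : L1 ≤ k := by
    have := Real.log_le_sub_one_of_pos hk0
    linarith
  set sA := ⌈k * L2⌉₊ with hsA
  set sB := ⌈k * L1⌉₊ with hsB
  have hA1 : k * L2 ≤ sA := Nat.le_ceil _
  have hA2 : (sA : ℝ) ≤ k * L2 + 1 := (Nat.ceil_lt_add_one (by positivity)).le
  have hB1 : k * L1 ≤ sB := Nat.le_ceil _
  have hB2 : (sB : ℝ) ≤ k * L1 + 1 := (Nat.ceil_lt_add_one (by positivity)).le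
  have hsA1 : 1 ≤ sA := Nat.ceil_pos.2 (by positivity)
  have hsB1 : 1 ≤ sB := Nat.ceil_pos.2 (by positivity)
  have tA := theta_pow_le k sA (by omega) L2 hA1
  have tB := theta_pow_le k sB (by omega) L1 hB1
  rw [Real.exp_neg, hL2, Real.exp_log hL1p] at tA
  rw [Real.exp_neg, hL1, Real.exp_log hk0] at tB
  have tB' : k * (1 - 1 / (k : ℝ)) ^ sB ≤ 1 := by
    calc k * (1 - 1 / (k : ℝ)) ^ sB ≤ k * (k : ℝ)⁻¹ := by gcongr
      _ = 1 := by field_simp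
  have tA' : k * (1 - 1 / (k : ℝ)) ^ sA ≤ k / L1 := by
    calc k * (1 - 1 / (k : ℝ)) ^ sA ≤ k * L1⁻¹ := by gcongr
      _ = _ := by ring
  set r := L2 / L1 with hr
  have hr0 : 0 < r := by positivity
  have hrL : r * L1 = L2 := by rw [hr]; field_simp
  have hr60 : r ≤ 1 / 60 := by rw [hr, div_le_iff₀ hL1p]; linarith
  set ρ := 1 / (k * (2 * L1 + 140 * L2)) with hρ
  have hden : 0 < k * (2 * L1 + 140 * L2) := by positivity
  have hρ0 : 0 < ρ := by positivity
  have hρd : ρ * (k * (2 * L1 + 140 * L2)) = 1 := by rw [hρ]; field_simp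
  refine main_P k sA sB (by omega) hsA1 hsB1 ρ (10 * r) hρ0 (by positivity) (by linarith) ?_ ?_
  · have hρL : ρ * (2 * k * L1) ≤ 1 := by
      rw [← hρd]
      apply mul_le_mul_of_nonneg_left _ hρ0.le
      have : 0 < k * L2 := by positivity
      linarith
    -- everything multiplied by L1
    have e1 : ρ * (2 * (k - 1) * sA + 2) ≤ (k * L2 + 2) / L1 := by
      rw [le_div_iff₀ hL1p]
      calc ρ * (2 * (k - 1) * sA + 2) * L1 ≤ ρ * (2 * k * (k * L2 + 2)) * L1 := by
            gcongr
            have : 2 * ((k : ℝ) - 1) * sA ≤ 2 * k * (k * L2 + 1) := by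
              gcongr
              linarith
            nlinarith
        _ = ρ * (2 * k * L1) * (k * L2 + 2) := by ring
        _ ≤ 1 * (k * L2 + 2) := by gcongr
        _ = _ := one_mul _
    have e2 : (1 - 10 * r) * (1 + k * (1 - 1 / (k : ℝ)) ^ sA) ≤ 1 + k / L1 := by
      have hp : 0 ≤ k * (1 - 1 / (k : ℝ)) ^ sA :=
        mul_nonneg hk0.le (pow_nonneg (one_sub_inv_nonneg k (by omega)) _)
      have : (1 - 10 * r) * (1 + k * (1 - 1 / (k : ℝ)) ^ sA) ≤
          1 * (1 + k * (1 - 1 / (k : ℝ)) ^ sA) := by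
        gcongr; linarith
      linarith
    have e3 : (k * L2 + 2) / L1 + (1 + k / L1) < k * (10 * r) / 2 := by
      have : (k * L2 + 2) / L1 + (1 + k / L1) = (k * L2 + 2 + L1 + k) / L1 := by
        field_simp
        ring
      have h' : k * (10 * r) / 2 = (5 * (k * L2)) / L1 := by rw [hr]; ring
      rw [this, h']
      apply div_lt_div_of_pos_right _ hL1p
      have : k * 1 ≤ k * L2 := by gcongr
      linarith
    linarith
  · have e1 : 10 * r * (1 + k * (1 - 1 / (k : ℝ)) ^ sB) ≤ 10 * r * (1 + 1) := by gcongr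
    have e2 : ρ * (2 * sB + 5) ≤ ρ * (2 * (k * L1) + 7) :=
      mul_le_mul_of_nonneg_left (by linarith) hρ0.le
    have e3 : 2 * (k * L1) + 7 < (1 - 30 * r) * (k * (2 * L1 + 140 * L2)) := by
      have h70 : r * (k * L2) ≤ 1 / 60 * (k * L2) := by gcongr
      have : (1 - 30 * r) * (k * (2 * L1 + 140 * L2)) =
          2 * (k * L1) + 140 * (k * L2) - 60 * k * (r * L1) - 4200 * (r * (k * L2)) := by ring
      rw [this, hrL]
      have : (6 : ℝ) * 1 ≤ k * L2 := by gcongr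
      linarith
    have e4 : ρ * (2 * (k * L1) + 7) < 1 - 30 * r := by
      calc ρ * (2 * (k * L1) + 7) < ρ * ((1 - 30 * r) * (k * (2 * L1 + 140 * L2))) := by gcongr
        _ = (1 - 30 * r) * (ρ * (k * (2 * L1 + 140 * L2))) := by ring
        _ = _ := by rw [hρd, mul_one]
    linarith

lemma ev_large : ∃ K₀ : ℕ, ∀ k : ℕ, K₀ ≤ k → 1 ≤ Real.log (Real.log k) ∧
    60 * Real.log (Real.log k) ≤ Real.log k := by
  have hlog : Filter.Tendsto (fun k : ℕ => Real.log (k : ℝ)) Filter.atTop Filter.atTop :=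
    Real.tendsto_log_atTop.comp tendsto_natCast_atTop_atTop
  have h1 := (Filter.tendsto_atTop.1 (Real.tendsto_log_atTop.comp hlog)) 1
  have h2 : ∀ᶠ x : ℝ in Filter.atTop, 60 * Real.log x ≤ x := by
    have h := Real.isLittleO_log_id_atTop.bound (show (0 : ℝ) < 1 / 60 by norm_num)
    filter_upwards [h, Filter.eventually_ge_atTop (1 : ℝ)] with x hx hx1
    simp only [Real.norm_eq_abs, id] at hx
    rw [abs_of_nonneg (Real.log_nonneg hx1), abs_of_nonneg (by linarith)] at hx
    linarith
  have h3 := hlog.eventually h2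
  exact Filter.eventually_atTop.1 (h1.and h3)

lemma loglog_pos (k : ℕ) (hk : 6 ≤ k) : 0 < Real.log (Real.log k) := by
  have hk6 : (6 : ℝ) ≤ k := by exact_mod_cast hk
  apply Real.log_pos
  rw [Real.lt_log_iff_exp_lt (by linarith)]
  have := Real.exp_one_lt_d9
  linarith

/-- **Theorem 2(b) (Baker).** There is an absolute constant `B > 0` such that for every
`k ≥ 6` and `ε > 0` there is a constant `C > 0` (depending only on `k` and `ε`) such that
for all sufficiently large `N` and all real `α₁, α_k`, there is an integer `1 ≤ n ≤ N`
with `‖α_k n^k + α₁ n‖ ≤ C · N^(−ρ_k + ε)` where `ρ_k = 1/(k(2 log k + B log log k))`. -/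
theorem small_fractional_parts_binomial_log :
    ∃ B : ℝ, 0 < B ∧ ∀ (k : ℕ), 6 ≤ k → ∀ ε : ℝ, 0 < ε →
      ∃ C : ℝ, 0 < C ∧ ∃ N₀ : ℕ, ∀ (α₁ αk : ℝ) (N : ℕ), N₀ ≤ N →
        ∃ n : ℕ, 1 ≤ n ∧ n ≤ N ∧
          nearestIntDist (αk * (n : ℝ) ^ k + α₁ * (n : ℝ)) ≤
            C * (N : ℝ) ^
              (-(1 / ((k : ℝ) * (2 * Real.log k + B * Real.log (Real.log k)))) + ε) := by
  obtain ⟨K₀, hK₀⟩ := ev_large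
  have hsm : ∀ k : ℕ, ∃ ρ : ℝ, 0 < ρ ∧ (6 ≤ k → PP_holds k ρ) := by
    intro k
    by_cases hk : 6 ≤ k
    · obtain ⟨ρ, h1, h2⟩ := small_k k hk
      exact ⟨ρ, h1, fun _ => h2⟩
    · exact ⟨1, one_pos, fun h => absurd h hk⟩
  choose ρ₀ hρ₀ hP₀ using hsm
  set b : ℕ → ℝ := fun k => |1 / (k * ρ₀ k * Real.log (Real.log k))| with hb
  have hbs : 0 ≤ ∑ j ∈ Finset.range K₀, b j := Finset.sum_nonneg (fun j _ => abs_nonneg _)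
  refine ⟨140 + ∑ j ∈ Finset.range K₀, b j, by linarith, ?_⟩
  set B := 140 + ∑ j ∈ Finset.range K₀, b j with hB
  intro k hk ε hε
  have hk6 : (6 : ℝ) ≤ k := by exact_mod_cast hk
  have hk0 : (0 : ℝ) < k := by linarith
  have hL2 := loglog_pos k hk
  have hL1 : 0 < Real.log k := Real.log_pos (by linarith)
  have hB0 : 0 < B := by linarith
  have key : ∃ ρ : ℝ, PP_holds k ρ ∧
      1 / ((k : ℝ) * (2 * Real.log k + B * Real.log (Real.log k))) ≤ ρ := by
    rcases lt_or_ge k K₀ with h | h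
    · refine ⟨ρ₀ k, hP₀ k hk, ?_⟩
      have hbk : b k ≤ B := by
        have := Finset.single_le_sum (f := b) (fun j _ => abs_nonneg _) (Finset.mem_range.2 h)
        linarith
      have h1 : 1 / (k * ρ₀ k * Real.log (Real.log k)) ≤ B := (le_abs_self _).trans hbk
      have hr := hρ₀ k
      rw [div_le_iff₀ (by positivity)] at h1
      rw [div_le_iff₀ (by positivity)]
      have : 0 < ρ₀ k * (k * (2 * Real.log k)) := by positivity
      linarith
    · obtain ⟨g1, g2⟩ := hK₀ k h
      refine ⟨_, large_k k hk g1 g2, ?_⟩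
      apply one_div_le_one_div_of_le (by positivity)
      gcongr
      linarith
  obtain ⟨ρ, ⟨N₀, hN₀⟩, hle⟩ := key
  refine ⟨1, one_pos, max N₀ 1, ?_⟩
  intro α₁ αk N hN
  obtain ⟨n, hn1, hn2, hn3⟩ := hN₀ α₁ αk N ((le_max_left _ _).trans hN)
  refine ⟨n, hn1, hn2, hn3.trans ?_⟩
  rw [one_mul]
  have hN1 : (1 : ℝ) ≤ N := by exact_mod_cast (le_max_right _ _).trans hN
  apply Real.rpow_le_rpow_of_exponent_le hN1
  linarith
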